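/- Let s ≥ 2 and let (X_n)_{n≥0} be a dyadic digital (T,s)-sequence with T(m) ≤ (1/10)·log₂ m, and put Ṗ_m = (X_n)_{n=0}^{2^m-1}. Then for every w ∈ ℝ, 2^{-sm} ∑_{T ∈ Q^s(2^m)} vol{ Y ∈ [0,1)^s : D(Ṗ_m ⊕ T, Y)/M_{s,2}(Ṗ_m) < w } → Φ(w) as m → ∞. -/

import Mathlib

open MeasureTheory Filter

noncomputable section

attribute [local instance] Classical.propDecidable

/-- The `a`-th binary digit (`a ≥ 1`) of the dyadic expansion of `x ∈ [0,1)`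
(the finite expansion is used for dyadic rationals). -/
def bdigit (a : ℕ) (x : ℝ) : ℕ := (⌊x * 2 ^ a⌋).toNat % 2

/-- Digitwise addition modulo 2 of dyadic expansions: `x ⊕ y`. -/
def xorReal (x y : ℝ) : ℝ :=
  ∑' a : ℕ, (((bdigit (a + 1) x + bdigit (a + 1) y) % 2 : ℕ) : ℝ) / 2 ^ (a + 1)

/-- Coordinatewise digitwise addition `⊕` on vectors. -/
def xorVec {s : ℕ} (X Y : Fin s → ℝ) : Fin s → ℝ := fun i => xorReal (X i) (Y i)

/-- Local discrepancy `D(P, Y)` of a finite point set `P` in `[0,1)^s`. -/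
def Dloc {N s : ℕ} (P : Fin N → Fin s → ℝ) (Y : Fin s → ℝ) : ℝ :=
  (∑ n : Fin N, if ∀ i, 0 ≤ P n i ∧ P n i < Y i then (1 : ℝ) else 0) -
    (N : ℝ) * ∏ i, Y i

/-- `P` is a `(t,m,s)`-net in base 2: every elementary dyadic box of volume
`2^(t-m)` contains exactly `2^t` of the points. -/
def IsNet (t m s : ℕ) (P : Fin (2 ^ m) → Fin s → ℝ) : Prop :=
  ∀ d a : Fin s → ℕ, (∀ i, a i < 2 ^ d i) → (∑ i, d i) + t = m →
    (Finset.univ.filter fun n => ∀ i,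
        (a i : ℝ) / 2 ^ d i ≤ P n i ∧ P n i < ((a i : ℝ) + 1) / 2 ^ d i).card = 2 ^ t

/-- The digits `x_{n,i,j}` of the `n`-th point of the dyadic digital net with
generating matrices `C`. -/
def netDig (m s : ℕ) (C : Fin s → Matrix (Fin m) (Fin m) (ZMod 2)) (n : ℕ) :
    Fin s → Fin m → ZMod 2 :=
  fun i j => ∑ r : Fin m, C i j r * (if n.testBit r then 1 else 0)

/-- The `n`-th point of the dyadic digital net with generating matrices `C`. -/
def netPoint (m s : ℕ) (C : Fin s → Matrix (Fin m) (Fin m) (ZMod 2)) (n : ℕ) :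
    Fin s → ℝ :=
  fun i => ∑ j : Fin m, ((netDig m s C n i j).val : ℝ) / 2 ^ ((j : ℕ) + 1)

/-- The unit cube `[0,1]^s`. -/
def cube (s : ℕ) : Set (Fin s → ℝ) := Set.univ.pi fun _ => Set.Icc (0 : ℝ) 1

/-- The point of `Q^s(2^m)` with coordinates `T i / 2^m`. -/
def Qpt {s : ℕ} (m : ℕ) (T : Fin s → Fin (2 ^ m)) : Fin s → ℝ :=
  fun i => ((T i : ℕ) : ℝ) / 2 ^ m

/-- `M_{s,p}(P) = (2^{-sm} ∑_{T ∈ Q^s(2^m)} ∫_{[0,1]^s} |D(P ⊕ T, Y)|^p dY)^{1/p}`. -/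
def Msp (s m : ℕ) (p : ℝ) {N : ℕ} (P : Fin N → Fin s → ℝ) : ℝ :=
  ((2 : ℝ) ^ (-(s * m : ℤ)) * ∑ T : Fin s → Fin (2 ^ m),
      ∫ Y in cube s, |Dloc (fun n => xorVec (P n) (Qpt m T)) Y| ^ p) ^ (1 / p)

/-- The standard normal distribution function `Φ`. -/
def PhiCDF (w : ℝ) : ℝ :=
  (Real.sqrt (2 * Real.pi))⁻¹ * ∫ u in Set.Iio w, Real.exp (-u ^ 2 / 2)

/-- `χ_p`, the `p`-th absolute moment of the standard Gaussian. -/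
def chiMoment (p : ℝ) : ℝ :=
  (Real.sqrt (2 * Real.pi))⁻¹ * ∫ u : ℝ, |u| ^ p * Real.exp (-u ^ 2 / 2)

/-- Digits `y_{n,i,j}` of the points of the dyadic digital sequence generated by
the `ℕ × ℕ` matrices `C` over `F_2`. -/
def seqDig (s : ℕ) (C : Fin s → ℕ → ℕ → ZMod 2) (n : ℕ) : Fin s → ℕ → ZMod 2 :=
  fun i j => ∑ r ∈ Finset.range (n + 1), C i j r * (if n.testBit r then 1 else 0)

/-- The `n`-th point of the dyadic digital sequence generated by `C`. -/
def seqPoint (s : ℕ) (C : Fin s → ℕ → ℕ → ZMod 2) (n : ℕ) : Fin s → ℝ :=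
  fun i => ∑' j : ℕ, ((seqDig s C n i j).val : ℝ) / 2 ^ (j + 1)

/-- The digital sequence generated by `C` is a dyadic digital `(T,s)`-sequence:
for all `m ≥ 1` and `k ≥ 0` the block `X_{k2^m}, …, X_{k2^m+2^m-1}` is a
`(T(m),m,s)`-net in base 2. -/
def IsTSeq (s : ℕ) (Tf : ℕ → ℕ) (C : Fin s → ℕ → ℕ → ZMod 2) : Prop :=
  (∀ m, Tf m ≤ m) ∧
  ∀ m, 1 ≤ m → ∀ k : ℕ,
    IsNet (Tf m) m s fun n : Fin (2 ^ m) => seqPoint s C (k * 2 ^ m + (n : ℕ))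

/-- The dual net `P_m^⊥` of the digital net generated by `C`. -/
def dualNet (m s : ℕ) (C : Fin s → Matrix (Fin m) (Fin m) (ZMod 2)) :
    Finset (Fin s → Fin m → ZMod 2) :=
  Finset.univ.filter fun mm => ∀ n : Fin (2 ^ m),
    (∑ i, ∑ j, mm i j * netDig m s C (n : ℕ) i j) = 0

/-- `ρ(b)`: the position of the last nonzero digit (`ρ(0) = 0`). -/
def rhoF {m : ℕ} (b : Fin m → ZMod 2) : ℕ :=
  (Finset.univ.filter fun j => b j ≠ 0).sup fun j => (j : ℕ) + 1

/-- The 1-indexed component `𝔪_{i,a}` (as `0` or `1`), with the convention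
`𝔪_{i,0} = 0`. -/
def mAt {m : ℕ} (b : Fin m → ZMod 2) (a : ℕ) : ℕ :=
  if h : 1 ≤ a ∧ a ≤ m then (b ⟨a - 1, by omega⟩).val else 0

/-- The 1-indexed digit of a digit array, with the convention that digit `0`
and digits beyond `m` are `0`. -/
def dAt {m : ℕ} (y : Fin m → Fin 2) (a : ℕ) : ℕ :=
  if h : 1 ≤ a ∧ a ≤ m then (y ⟨a - 1, by omega⟩).val else 0

/-- `κ(A)`: the number of nonzero entries of `A`. -/
def kapF {s : ℕ} (A : Fin s → ℕ) : ℕ := (Finset.univ.filter fun i => A i ≠ 0).card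

/-- `a₀(A) = a₁ + ⋯ + a_s`. -/
def a0F {s : ℕ} (A : Fin s → ℕ) : ℕ := ∑ i, A i

/-- `Λ_A(T ⊕ Y^{(m)})` as a function of the digit arrays `t`, `y` of `T`, `Y`:
`∑_{𝔪 ∈ P^{⊥,*}, ρ(𝔪_i) ≤ a_i} e(∑_i (∑_j 𝔪_{i,j}(t_{i,j}+y_{i,j}) + 𝔪_{i,a_i}))`,
where `e(n) = exp(πin) = (-1)^n`. -/
def LamF (m s : ℕ) (C : Fin s → Matrix (Fin m) (Fin m) (ZMod 2)) (A : Fin s → ℕ)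
    (t y : Fin s → Fin m → Fin 2) : ℝ :=
  ∑ mm ∈ (dualNet m s C).filter fun mm => mm ≠ 0 ∧ ∀ i, rhoF (mm i) ≤ A i,
    (-1 : ℝ) ^
      (∑ i, ((∑ j, (mm i j).val * ((t i j : ℕ) + (y i j : ℕ))) + mAt (mm i) (A i)))

/-- The Rademacher function `r_A(Y)` as a function of the digit array of `Y`. -/
def rademF {m s : ℕ} (A : Fin s → ℕ) (y : Fin s → Fin m → Fin 2) : ℝ :=
  ∏ i, (-1 : ℝ) ^ dAt (y i) (A i)

/-- `Ψ_A = (-1)^{κ(A)} 2^{m-s-a₀(A)} r_A(Y) Λ_A(T ⊕ Y^{(m)})` at digit level. -/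
def PsiF (m s : ℕ) (C : Fin s → Matrix (Fin m) (Fin m) (ZMod 2)) (A : Fin s → ℕ)
    (t y : Fin s → Fin m → Fin 2) : ℝ :=
  (-1 : ℝ) ^ kapF A * (2 : ℝ) ^ ((m : ℤ) - (s : ℤ) - (a0F A : ℤ)) *
    rademF A y * LamF m s C A t y

/-- `V₀ = 10 log₂ m`. -/
def V0 (m : ℕ) : ℝ := 10 * Real.logb 2 m

/-- `I_{m,s,k} = {A ∈ I_m^s : max_i a_i = k, a₀(A) ∈ (m - t_m, m + V₀)}`. -/
def IndexSet (m s tm k : ℕ) : Finset (Fin s → ℕ) :=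
  (Fintype.piFinset fun _ : Fin s => Finset.range (m + 1)).filter fun A =>
    Finset.univ.sup A = k ∧ ((m : ℝ) - tm < a0F A ∧ (a0F A : ℝ) < m + V0 m)

/-- `I_{m,s,m+1} = {A ∈ I_m^s : a₀(A) ≥ m + V₀}`. -/
def IndexTail (m s : ℕ) : Finset (Fin s → ℕ) :=
  (Fintype.piFinset fun _ : Fin s => Finset.range (m + 1)).filter fun A =>
    (m : ℝ) + V0 m ≤ (a0F A : ℝ)

/-- `𝔇_k(T,Y) = ∑_{A ∈ I_{m,s,k}} Ψ_A` at digit level. -/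
def DDk (m s tm : ℕ) (C : Fin s → Matrix (Fin m) (Fin m) (ZMod 2)) (k : ℕ)
    (t y : Fin s → Fin m → Fin 2) : ℝ :=
  ∑ A ∈ IndexSet m s tm k, PsiF m s C A t y

/-- `R(T,Y) = ∑_{A ∈ I_{m,s,m+1}} Ψ_A` at digit level. -/
def Rtail (m s : ℕ) (C : Fin s → Matrix (Fin m) (Fin m) (ZMod 2))
    (t y : Fin s → Fin m → Fin 2) : ℝ :=
  ∑ A ∈ IndexTail m s, PsiF m s C A t y

/-- `E^{(m)}_{Y,T}(f)`: the average of `f` over all digit arrays. -/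
def Em (m s : ℕ) (f : (Fin s → Fin m → Fin 2) → (Fin s → Fin m → Fin 2) → ℝ) : ℝ :=
  (2 : ℝ) ^ (-(2 * s * m : ℤ)) *
    ∑ t : Fin s → Fin m → Fin 2, ∑ y : Fin s → Fin m → Fin 2, f t y

/-- Keep the first `k` digits of `t`, replace the remaining ones by those of `t'`. -/
def mergeDig {m s : ℕ} (k : ℕ) (t t' : Fin s → Fin m → Fin 2) :
    Fin s → Fin m → Fin 2 :=
  fun i j => if (j : ℕ) < k then t i j else t' i j

/-- The conditional expectation `E^{(m)}_{Y,T}(f | F_k)` with respect to the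
σ-field `F_k` generated by the dyadic cubes of side `2^{-k}`: the average of `f`
over the digits of index `> k`, as a function of the digit arrays `t`, `y`. -/
def EmCond (m s k : ℕ)
    (f : (Fin s → Fin m → Fin 2) → (Fin s → Fin m → Fin 2) → ℝ)
    (t y : Fin s → Fin m → Fin 2) : ℝ :=
  (2 : ℝ) ^ (-(2 * s * m : ℤ)) *
    ∑ t' : Fin s → Fin m → Fin 2, ∑ y' : Fin s → Fin m → Fin 2,
      f (mergeDig k t t') (mergeDig k y y')

/-- `Θ_{A₁,A₂,k} = E^{(m)}_{Y,T}(Ψ_{A₁}Ψ_{A₂} | F_{k-1}) - E^{(m)}_{Y,T}(Ψ_{A₁}Ψ_{A₂})`. -/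
def ThetaF (m s : ℕ) (C : Fin s → Matrix (Fin m) (Fin m) (ZMod 2))
    (A1 A2 : Fin s → ℕ) (k : ℕ) (t y : Fin s → Fin m → Fin 2) : ℝ :=
  EmCond m s (k - 1) (fun t' y' => PsiF m s C A1 t' y' * PsiF m s C A2 t' y') t y -
    Em m s fun t' y' => PsiF m s C A1 t' y' * PsiF m s C A2 t' y'

/-- `Υ_{d₁,d₂,d₃,J,k}` for a partition `J = (J₁,J₂,J₃)` of `{1,…,s}` and
`k = (k₁,k₂)`. -/
def Ups (m s tm : ℕ) (C : Fin s → Matrix (Fin m) (Fin m) (ZMod 2))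
    (J1 J2 J3 : Finset (Fin s)) (k1 k2 : ℕ) : ℝ :=
  ∑ A1 ∈ IndexSet m s tm k1, ∑ A2 ∈ IndexSet m s tm k1,
    ∑ A3 ∈ IndexSet m s tm k2, ∑ A4 ∈ IndexSet m s tm k2,
      (Em m s fun t y => ThetaF m s C A1 A2 k1 t y * ThetaF m s C A3 A4 k2 t y) *
        (if (Finset.univ.filter fun i => A1 i = A2 i) = J1 ∧
            (Finset.univ.filter fun i => A1 i < A2 i) = J2 ∧
            (Finset.univ.filter fun i => A2 i < A1 i) = J3 ∧
            (Finset.univ.filter fun i => A3 i = A4 i) = J1 ∧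
            (Finset.univ.filter fun i => A3 i < A4 i) = J2 ∧
            (Finset.univ.filter fun i => A4 i < A3 i) = J3 then (1 : ℝ) else 0)

/-- The array of the first `m` dyadic digits of the coordinates of `Y`. -/
def digitsOf (m s : ℕ) (Y : Fin s → ℝ) : Fin s → Fin m → Fin 2 :=
  fun i j => ⟨bdigit ((j : ℕ) + 1) (Y i), by unfold bdigit; omega⟩

/-- Truncation `y^{(m)}` to the first `m` dyadic digits. -/
def truncR (m : ℕ) (y : ℝ) : ℝ :=
  ∑ j ∈ Finset.range m, (bdigit (j + 1) y : ℝ) / 2 ^ (j + 1)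

/-- The elementary interval `Π_a` (`Π_0 = [0,1)`, `Π_a = [2^{-a}, 2^{1-a})`). -/
def PiBox (a : ℕ) : Set ℝ :=
  if a = 0 then Set.Ico 0 1 else Set.Ico ((2 : ℝ) ^ (-(a : ℤ))) ((2 : ℝ) ^ (1 - (a : ℤ)))

/-- `λ_A(Y) = 1_{Π_A}(Y) - vol(Π_A)`. -/
def lamA {s : ℕ} (A : Fin s → ℕ) (Y : Fin s → ℝ) : ℝ :=
  (if ∀ i, Y i ∈ PiBox (A i) then (1 : ℝ) else 0) - (2 : ℝ) ^ (-(a0F A : ℤ))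

/-- The micro-local discrepancy `λ_A(P_m^{(m)} ⊕ T ⊕ Y^{(m)})`. -/
def lamNet (m s : ℕ) (C : Fin s → Matrix (Fin m) (Fin m) (ZMod 2))
    (T Y : Fin s → ℝ) (A : Fin s → ℕ) : ℝ :=
  ∑ n : Fin (2 ^ m),
    lamA A fun i =>
      xorReal (xorReal (truncR m (netPoint m s C (n : ℕ) i)) (T i)) (truncR m (Y i))

/-- The Rademacher function `r_A(Y)` for a real point `Y`. -/
def rademReal {s : ℕ} (A : Fin s → ℕ) (Y : Fin s → ℝ) : ℝ :=
  ∏ i, if A i = 0 then (1 : ℝ) else 1 - 2 * (bdigit (A i) (Y i) : ℝ)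

/-- The truncated discrepancy
`D^{(m)}(P_m ⊕ T, Y) = 2^{-s} ∑_{A ∈ I_m^s} (-1)^{κ(A)} λ_A(P_m^{(m)} ⊕ T ⊕ Y^{(m)}) r_A(Y)`. -/
def Dm (m s : ℕ) (C : Fin s → Matrix (Fin m) (Fin m) (ZMod 2)) (T Y : Fin s → ℝ) : ℝ :=
  (2 : ℝ) ^ (-(s : ℤ)) *
    ∑ A ∈ Fintype.piFinset fun _ : Fin s => Finset.range (m + 1),
      (-1 : ℝ) ^ kapF A * lamNet m s C T Y A * rademReal A Y

/-- `𝔼_{Y,T,m}(f) = 2^{-sm} ∑_{T ∈ Q^s(2^m)} ∫_{[0,1]^s} f(T,Y) dY`. -/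
def EE (m s : ℕ) (f : (Fin s → ℝ) → (Fin s → ℝ) → ℝ) : ℝ :=
  (2 : ℝ) ^ (-(s * m : ℤ)) * ∑ T : Fin s → Fin (2 ^ m), ∫ Y in cube s, f (Qpt m T) Y

open scoped BigOperators

lemma gaussian_Iio_eq_PhiCDF (w : ℝ) :
    (ProbabilityTheory.gaussianReal 0 1 (Set.Iio w)).toReal = PhiCDF w := by
  rw [ProbabilityTheory.gaussianReal_apply_eq_integral _ one_ne_zero, ENNReal.toReal_ofReal]
  · unfold PhiCDF
    rw [← integral_const_mul]
    refine integral_congr_ae (ae_of_all _ fun u => ?_)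
    simp [ProbabilityTheory.gaussianPDFReal]
  · exact integral_nonneg fun u => ProbabilityTheory.gaussianPDFReal_nonneg _ _ _

/-- Pointwise convergence of characteristic functions to the Gaussian one gives convergence of the
distribution functions. -/
lemma tendsto_Iio_of_charFun {μ : ℕ → ProbabilityMeasure ℝ}
    (h : ∀ θ : ℝ, Tendsto (fun n => charFun (μ n : Measure ℝ) θ) atTop
      (nhds (Complex.exp (-((θ : ℂ) ^ 2 / 2))))) (w : ℝ) :
    Tendsto (fun n => ((μ n : Measure ℝ) (Set.Iio w)).toReal) atTop (nhds (PhiCDF w)) := by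
  let g : ProbabilityMeasure ℝ := ⟨ProbabilityTheory.gaussianReal 0 1, inferInstance⟩
  have hconv : Tendsto μ atTop (nhds g) := by
    refine ProbabilityMeasure.tendsto_iff_tendsto_charFun.2 fun θ => ?_
    convert h θ using 2
    change charFun (ProbabilityTheory.gaussianReal 0 1) θ = _
    rw [ProbabilityTheory.charFun_gaussianReal]
    simp
  have h1 := ProbabilityMeasure.tendsto_measure_of_null_frontier_of_tendsto' hconv
    (E := Set.Iio w) (by
      change ProbabilityTheory.gaussianReal 0 1 (frontier (Set.Iio w)) = 0
      rw [frontier_Iio]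
      have := ProbabilityTheory.nullSingletonClass_gaussianReal (μ := 0) (v := 1) one_ne_zero
      exact measure_singleton w)
  rw [← gaussian_Iio_eq_PhiCDF]
  exact (ENNReal.tendsto_toReal (measure_ne_top _ _)).comp h1

lemma abs_cos_sub_exp_le (x : ℝ) : |Real.cos x - Real.exp (-(x ^ 2 / 2))| ≤ 2 * x ^ 4 := by
  have e1 : 1 - x ^ 2 / 2 ≤ Real.exp (-(x ^ 2 / 2)) := by
    linarith [Real.add_one_le_exp (-(x ^ 2 / 2))]
  rcases le_or_gt |x| 1 with hx | hx
  · have h1 := Real.cos_bound hx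
    have h4 : |x| ^ 4 = x ^ 4 := by rw [show (4 : ℕ) = 2 * 2 by norm_num, pow_mul, pow_mul, sq_abs]
    rw [h4] at h1
    have hx2 : x ^ 2 ≤ 1 := by rw [← sq_abs]; nlinarith [abs_nonneg x]
    have e2 : |Real.exp (-(x ^ 2 / 2)) - 1 - (-(x ^ 2 / 2))| ≤ (-(x ^ 2 / 2)) ^ 2 :=
      Real.abs_exp_sub_one_sub_id_le (by rw [abs_neg, abs_of_nonneg (by positivity)]; linarith)
    rw [abs_le] at *
    constructor <;> nlinarith [h1.1, h1.2, e2.1, e2.2, sq_nonneg (x ^ 2)]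
  · have hx2 : 1 ≤ x ^ 2 := by rw [← sq_abs]; nlinarith
    have h1 := Real.abs_cos_le_one x
    have h2 : Real.exp (-(x ^ 2 / 2)) ≤ 1 := Real.exp_le_one_iff.2 (by nlinarith)
    have h3 := Real.exp_pos (-(x ^ 2 / 2))
    have h5 : 1 ≤ x ^ 4 := by nlinarith
    rw [abs_le] at *
    constructor <;> linarith [h1.1, h1.2]

lemma abs_prod_sub_prod_le {ι : Type*} (t : Finset ι) (f g : ι → ℝ)
    (hf : ∀ i ∈ t, |f i| ≤ 1) (hg : ∀ i ∈ t, |g i| ≤ 1) :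
    |∏ i ∈ t, f i - ∏ i ∈ t, g i| ≤ ∑ i ∈ t, |f i - g i| := by
  induction t using Finset.induction_on with
  | empty => simp
  | insert a t ha ih =>
    rw [Finset.prod_insert ha, Finset.prod_insert ha, Finset.sum_insert ha]
    have ih' := ih (fun i hi => hf i (Finset.mem_insert_of_mem hi))
      (fun i hi => hg i (Finset.mem_insert_of_mem hi))
    have hP : |∏ i ∈ t, f i| ≤ 1 := by
      rw [Finset.abs_prod]
      exact Finset.prod_le_one (fun _ _ => abs_nonneg _)
        fun i hi => hf i (Finset.mem_insert_of_mem hi)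
    have hga := hg a (Finset.mem_insert_self a t)
    calc |f a * ∏ i ∈ t, f i - g a * ∏ i ∈ t, g i|
        = |(f a - g a) * ∏ i ∈ t, f i + g a * (∏ i ∈ t, f i - ∏ i ∈ t, g i)| := by ring_nf
      _ ≤ |f a - g a| * |∏ i ∈ t, f i| + |g a| * |∏ i ∈ t, f i - ∏ i ∈ t, g i| := by
          rw [← abs_mul, ← abs_mul]; exact abs_add_le _ _
      _ ≤ |f a - g a| * 1 + 1 * |∏ i ∈ t, f i - ∏ i ∈ t, g i| := by gcongr
      _ ≤ _ := by linarith

lemma abs_exp_neg_sub_exp_neg_le {x y : ℝ} (hx : 0 ≤ x) (hy : 0 ≤ y) :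
    |Real.exp (-x) - Real.exp (-y)| ≤ |x - y| := by
  wlog h : x ≤ y generalizing x y
  · rw [abs_sub_comm, abs_sub_comm x]
    exact this hy hx (le_of_not_ge h)
  rw [abs_of_nonneg (sub_nonneg.2 (Real.exp_le_exp.2 (by linarith))), abs_of_nonpos (by linarith)]
  have h1 : Real.exp (-y) = Real.exp (-x) * Real.exp (-(y - x)) := by
    rw [← Real.exp_add]; ring_nf
  have h2 := Real.add_one_le_exp (-(y - x))
  have h3 : Real.exp (-x) ≤ 1 := Real.exp_le_one_iff.2 (by linarith)
  have h4 := Real.exp_pos (-x)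
  rw [h1]
  nlinarith

/-- The characteristic function of a weighted sum of independent signs is close to the Gaussian
one. -/
lemma abs_prod_cos_sub_exp_le {ι : Type*} (t : Finset ι) (f : ι → ℝ) (θ : ℝ) :
    |∏ i ∈ t, Real.cos (θ * f i) - Real.exp (-(θ ^ 2 / 2))| ≤
      2 * θ ^ 4 * ∑ i ∈ t, f i ^ 4 + θ ^ 2 / 2 * |∑ i ∈ t, f i ^ 2 - 1| := by
  have h1 : |∏ i ∈ t, Real.cos (θ * f i) - ∏ i ∈ t, Real.exp (-((θ * f i) ^ 2 / 2))| ≤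
      2 * θ ^ 4 * ∑ i ∈ t, f i ^ 4 := by
    refine (abs_prod_sub_prod_le t _ _ (fun i _ => Real.abs_cos_le_one _) fun i _ => ?_).trans ?_
    · rw [Real.abs_exp]
      exact Real.exp_le_one_iff.2 (by nlinarith [sq_nonneg (θ * f i)])
    · rw [Finset.mul_sum]
      refine Finset.sum_le_sum fun i _ => (abs_cos_sub_exp_le _).trans (le_of_eq ?_)
      ring
  have h2 : ∏ i ∈ t, Real.exp (-((θ * f i) ^ 2 / 2)) =
      Real.exp (-(θ ^ 2 / 2 * ∑ i ∈ t, f i ^ 2)) := by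
    rw [← Real.exp_sum, Finset.mul_sum, Finset.sum_neg_distrib]
    congr 2
    exact Finset.sum_congr rfl fun i _ => by ring
  have h3 : |Real.exp (-(θ ^ 2 / 2 * ∑ i ∈ t, f i ^ 2)) - Real.exp (-(θ ^ 2 / 2))| ≤
      θ ^ 2 / 2 * |∑ i ∈ t, f i ^ 2 - 1| := by
    refine (abs_exp_neg_sub_exp_neg_le
      (mul_nonneg (by positivity) (Finset.sum_nonneg fun i _ => sq_nonneg _))
      (by positivity)).trans (le_of_eq ?_)
    rw [← mul_sub_one, abs_mul, abs_of_nonneg (by positivity : (0 : ℝ) ≤ θ ^ 2 / 2)]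
  rw [h2] at h1
  calc _ ≤ _ := abs_sub_le _ (Real.exp (-(θ ^ 2 / 2 * ∑ i ∈ t, f i ^ 2))) _
    _ ≤ _ := add_le_add h1 h3

section Digits

variable {s m : ℕ}

/-- Digit arrays: the first `m` dyadic digits of a vector in `[0,1)^s`. -/
abbrev DArr (s m : ℕ) := Fin s → Fin m → ZMod 2

/-- The digit-level counterpart of `PiBox a`: the first nonzero digit has index `a`
(no condition for `a = 0`). -/
def PiD (a : ℕ) (z : Fin m → ZMod 2) : Prop :=
  a = 0 ∨ ((∀ j : Fin m, (j : ℕ) + 1 < a → z j = 0) ∧ ∃ j : Fin m, (j : ℕ) + 1 = a ∧ z j = 1)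

/-- The Rademacher sign attached to the `a`-th digit (`1` for `a = 0` and `a > m`). -/
def epsD (a : ℕ) (y : Fin m → ZMod 2) : ℝ :=
  ∏ j : Fin m, if (j : ℕ) + 1 = a ∧ y j = 1 then -1 else 1

/-- The product of the Rademacher signs of the coordinates. -/
def epsA (A : Fin s → ℕ) (y : DArr s m) : ℝ := ∏ i, epsD (A i) (y i)

/-- Number of points of the shifted digital net in the box `Π_A`. -/
def cntD (x : (Fin m → ZMod 2) →+ DArr s m) (A : Fin s → ℕ) (u : DArr s m) : ℝ :=
  ((Finset.univ.filter fun v => ∀ i, PiD (A i) ((x v + u) i)).card : ℝ)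

/-- Local discrepancy of the shifted digital net in the box `Π_A`. -/
def lamD (x : (Fin m → ZMod 2) →+ DArr s m) (A : Fin s → ℕ) (u : DArr s m) : ℝ :=
  cntD x A u - 2 ^ m / 2 ^ a0F A

/-- The digital net generated by `x` has quality parameter `t`. -/
def NetD (x : (Fin m → ZMod 2) →+ DArr s m) (t : ℕ) : Prop :=
  ∀ d : Fin s → ℕ, (∑ i, d i) + t = m → ∀ u : DArr s m,
    (Finset.univ.filter fun v => ∀ i, ∀ j : Fin m, (j : ℕ) < d i → x v i j = u i j).card = 2 ^ t

lemma exists_ge_sum_eq (hs : 0 < s) (e : Fin s → ℕ) {M : ℕ} (h : ∑ i, e i ≤ M) :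
    ∃ d : Fin s → ℕ, (∀ i, e i ≤ d i) ∧ ∑ i, d i = M := by
  refine ⟨fun i => e i + if i = ⟨0, hs⟩ then M - ∑ i, e i else 0, fun i => by simp, ?_⟩
  rw [Finset.sum_add_distrib]
  simp
  omega

lemma exists_le_sum_eq (e : Fin s → ℕ) {M : ℕ} (h : M ≤ ∑ i, e i) :
    ∃ d : Fin s → ℕ, (∀ i, d i ≤ e i) ∧ ∑ i, d i = M := by
  induction M with
  | zero => exact ⟨fun _ => 0, fun i => Nat.zero_le _, by simp⟩
  | succ M ih =>
    obtain ⟨d, hd, hM⟩ := ih (by omega)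
    have : ∃ i, d i < e i := by
      by_contra! hcon
      have := Finset.sum_le_sum fun i (_ : i ∈ Finset.univ) => hcon i
      omega
    obtain ⟨i, hi⟩ := this
    refine ⟨fun k => d k + if k = i then 1 else 0, fun k => ?_, ?_⟩
    · by_cases hk : k = i
      · subst hk; simpa using hi
      · simpa [hk] using hd k
    · rw [Finset.sum_add_distrib]
      simp [hM]

lemma PiD_congr {a : ℕ} {z z' : Fin m → ZMod 2} (h : ∀ j : Fin m, (j : ℕ) < a → z j = z' j) :
    PiD a z ↔ PiD a z' := by
  unfold PiD
  have e1 : (∀ j : Fin m, (j : ℕ) + 1 < a → z j = 0) ↔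
      (∀ j : Fin m, (j : ℕ) + 1 < a → z' j = 0) :=
    forall_congr' fun j => imp_congr_right fun hj => by rw [h j (by omega)]
  have e2 : (∃ j : Fin m, (j : ℕ) + 1 = a ∧ z j = 1) ↔
      (∃ j : Fin m, (j : ℕ) + 1 = a ∧ z' j = 1) :=
    exists_congr fun j => and_congr_right fun hj => by rw [h j (by omega)]
  rw [e1, e2]

lemma cntD_add_net (x : (Fin m → ZMod 2) →+ DArr s m) (A : Fin s → ℕ) (u : DArr s m)
    (v : Fin m → ZMod 2) : cntD x A (u + x v) = cntD x A u := by
  unfold cntD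
  congr 1
  refine Finset.card_equiv (Equiv.addRight v) fun w => ?_
  simp only [Finset.mem_filter, Finset.mem_univ, true_and, Equiv.coe_addRight, map_add]
  rw [show x w + (u + x v) = x w + x v + u by abel]

lemma cntD_add_of_zero (x : (Fin m → ZMod 2) →+ DArr s m) (A : Fin s → ℕ) (u h : DArr s m)
    (hh : ∀ i, ∀ j : Fin m, (j : ℕ) < A i → h i j = 0) : cntD x A (u + h) = cntD x A u := by
  unfold cntD
  congr 2
  ext w
  simp only [Finset.mem_filter, Finset.mem_univ, true_and]
  refine forall_congr' fun i => PiD_congr fun j hj => ?_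
  simp [hh i j hj]

lemma NetD.exists_eq {x : (Fin m → ZMod 2) →+ DArr s m} {t : ℕ} (hx : NetD x t) (hs : 0 < s)
    {e : Fin s → ℕ} (he : (∑ i, e i) + t ≤ m) (w : DArr s m) :
    ∃ v, ∀ i, ∀ j : Fin m, (j : ℕ) < e i → x v i j = w i j := by
  obtain ⟨d, hd, hsum⟩ := exists_ge_sum_eq hs e (M := m - t) (by omega)
  have h := hx d (by omega) w
  obtain ⟨v, hv⟩ := Finset.card_pos.1 (h ▸ Nat.two_pow_pos t)
  exact ⟨v, fun i j hj => (Finset.mem_filter.1 hv).2 i j (hj.trans_le (hd i))⟩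

lemma NetD.exists_decomp {x : (Fin m → ZMod 2) →+ DArr s m} {t : ℕ} (hx : NetD x t) (hs : 0 < s)
    {A B : Fin s → ℕ} (hAB : (∑ i, min (A i) (B i)) + t ≤ m) (w : DArr s m) :
    ∃ v h h', w = x v + h + h' ∧ (∀ i, ∀ j : Fin m, (j : ℕ) < A i → h i j = 0) ∧
      ∀ i, ∀ j : Fin m, (j : ℕ) < B i → h' i j = 0 := by
  obtain ⟨v, hv⟩ := hx.exists_eq hs hAB w
  refine ⟨v, fun i j => if (j : ℕ) < A i then 0 else w i j - x v i j,
    fun i j => if (j : ℕ) < A i then w i j - x v i j else 0, ?_, ?_, ?_⟩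
  · ext i j
    by_cases h : (j : ℕ) < A i <;> simp [h]
  · intro i j h
    simp [h]
  · intro i j h
    by_cases h' : (j : ℕ) < A i
    · simp [h', hv i j (by simp [h, h'])]
    · simp [h']

/-- Functions of the shift that are invariant under the net and depend only on the first `A`,
respectively `B`, digits are uncorrelated when the common digits are equidistributed. -/
lemma NetD.expect_mul {x : (Fin m → ZMod 2) →+ DArr s m} {t : ℕ} (hx : NetD x t) (hs : 0 < s)
    {A B : Fin s → ℕ} (hAB : (∑ i, min (A i) (B i)) + t ≤ m) {f g : DArr s m → ℝ}
    (hgx : ∀ u v, g (u + x v) = g u)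
    (hfA : ∀ u h : DArr s m, (∀ i, ∀ j : Fin m, (j : ℕ) < A i → h i j = 0) → f (u + h) = f u)
    (hgB : ∀ u h : DArr s m, (∀ i, ∀ j : Fin m, (j : ℕ) < B i → h i j = 0) → g (u + h) = g u) :
    (𝔼 u, f u * g u) = (𝔼 u, f u) * 𝔼 u, g u := by
  have key : ∀ w, (𝔼 u, f u * g (u + w)) = 𝔼 u, f u * g u := by
    intro w
    obtain ⟨v, h, h', rfl, hh, hh'⟩ := hx.exists_decomp hs hAB w
    refine Fintype.expect_equiv (Equiv.addRight h) _ _ fun u => ?_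
    rw [Equiv.coe_addRight, hfA u h hh, show u + (x v + h + h') = u + h + h' + x v by abel, hgx,
      hgB _ h' hh']
  calc (𝔼 u, f u * g u) = 𝔼 w, 𝔼 u, f u * g (u + w) := by
        simp_rw [key, Fintype.expect_const]
    _ = 𝔼 u, f u * 𝔼 w, g (u + w) := by
        rw [Finset.expect_comm]
        simp_rw [Finset.mul_expect]
    _ = 𝔼 u, f u * 𝔼 w, g w := by
        refine Finset.expect_congr rfl fun u _ => ?_
        congr 1
        exact Fintype.expect_equiv (Equiv.addLeft u) _ _ fun w => rfl
    _ = _ := by rw [Finset.expect_mul]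

lemma card_PiD {a : ℕ} (ha : a ≤ m) :
    (Finset.univ.filter fun z : Fin m → ZMod 2 => PiD a z).card * 2 ^ a = 2 ^ m := by
  rcases Nat.eq_zero_or_pos a with rfl | hpos
  · simp [PiD, ZMod.card]
  have e : (Finset.univ.filter fun z : Fin m → ZMod 2 => PiD a z) =
      Fintype.piFinset fun j : Fin m => if (j : ℕ) + 1 < a then {0} else
        if (j : ℕ) + 1 = a then {1} else Finset.univ := by
    ext z
    rw [Finset.mem_filter, Fintype.mem_piFinset, and_iff_right (Finset.mem_univ z)]
    unfold PiD
    constructor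
    · rintro (h | ⟨h1, k, hk, hk1⟩) j
      · omega
      · split_ifs with h2 h3
        · simpa using h1 j h2
        · have : j = k := Fin.ext (by omega)
          simpa [this] using hk1
        · simp
    · intro h
      refine Or.inr ⟨fun j hj => by simpa [hj] using h j, ⟨a - 1, by omega⟩, by simp; omega, ?_⟩
      have := h ⟨a - 1, by omega⟩
      rw [if_neg (by simp; omega), if_pos (by simp; omega)] at this
      simpa using this
  rw [e, Fintype.card_piFinset]
  have h1 : ∀ j : Fin m, (if (j : ℕ) + 1 < a then {0} else if (j : ℕ) + 1 = a then {1} else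
      (Finset.univ : Finset (ZMod 2))).card = if (j : ℕ) < a then 1 else 2 := by
    intro j
    split_ifs <;> first | omega | simp [ZMod.card]
  simp_rw [h1]
  rw [Finset.prod_ite]
  have h2 : (Finset.univ.filter fun j : Fin m => ¬ (j : ℕ) < a).card + a = m := by
    have h3 : (Finset.univ.filter fun j : Fin m => (j : ℕ) < a).card = a := by
      rw [Fin.card_filter_val_lt]; omega
    have h4 := Finset.card_filter_add_card_filter_not (s := (Finset.univ : Finset (Fin m)))
      (fun j : Fin m => (j : ℕ) < a)
    rw [Finset.card_univ, Fintype.card_fin] at h4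
    omega
  simp only [Finset.prod_const_one, one_mul, Finset.prod_const]
  rw [← pow_add, h2]

lemma expect_cntD (x : (Fin m → ZMod 2) →+ DArr s m) {A : Fin s → ℕ} (hA : ∀ i, A i ≤ m) :
    (𝔼 u, cntD x A u) = 2 ^ m / 2 ^ a0F A := by
  have h1 : ∀ u, cntD x A u = ∑ v, if ∀ i, PiD (A i) ((x v + u) i) then (1 : ℝ) else 0 := by
    intro u
    unfold cntD
    rw [Finset.sum_boole]
  simp_rw [h1]
  rw [Finset.expect_sum_comm]
  have h2 : ∀ v, (𝔼 u, if ∀ i, PiD (A i) ((x v + u) i) then (1 : ℝ) else 0) =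
      𝔼 u : DArr s m, if ∀ i, PiD (A i) (u i) then (1 : ℝ) else 0 := fun v =>
    Fintype.expect_equiv (Equiv.addLeft (x v)) _ _ fun u => rfl
  simp_rw [h2]
  rw [Finset.sum_const, Finset.card_univ, Fintype.card_fun, ZMod.card, Fintype.card_fin,
    nsmul_eq_mul, Fintype.expect_eq_sum_div_card, Finset.sum_boole]
  have h3 : (Finset.univ.filter fun u : DArr s m => ∀ i, PiD (A i) (u i)) =
      Fintype.piFinset fun i => Finset.univ.filter fun z : Fin m → ZMod 2 => PiD (A i) z := by
    ext u; simp
  have h4 : (Finset.univ.filter fun u : DArr s m => ∀ i, PiD (A i) (u i)).card * 2 ^ a0F A =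
      Fintype.card (DArr s m) := by
    rw [h3, Fintype.card_piFinset, a0F, ← Finset.prod_pow_eq_pow_sum, ← Finset.prod_mul_distrib,
      Finset.prod_congr rfl fun i _ => card_PiD (hA i)]
    simp [ZMod.card]
  have h5 : (Fintype.card (DArr s m) : ℝ) ≠ 0 := by positivity
  rw [← h4] at h5 ⊢
  push_cast at h5 ⊢
  have h6 := left_ne_zero_of_mul h5
  field_simp

lemma cntD_nonneg (x : (Fin m → ZMod 2) →+ DArr s m) (A : Fin s → ℕ) (u : DArr s m) :
    0 ≤ cntD x A u := Nat.cast_nonneg _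

lemma lamD_add_net (x : (Fin m → ZMod 2) →+ DArr s m) (A : Fin s → ℕ) (u : DArr s m)
    (v : Fin m → ZMod 2) : lamD x A (u + x v) = lamD x A u := by
  simp [lamD, cntD_add_net]

lemma lamD_add_of_zero (x : (Fin m → ZMod 2) →+ DArr s m) (A : Fin s → ℕ) (u h : DArr s m)
    (hh : ∀ i, ∀ j : Fin m, (j : ℕ) < A i → h i j = 0) : lamD x A (u + h) = lamD x A u := by
  simp [lamD, cntD_add_of_zero x A u h hh]

lemma expect_lamD (x : (Fin m → ZMod 2) →+ DArr s m) {A : Fin s → ℕ} (hA : ∀ i, A i ≤ m) :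
    (𝔼 u, lamD x A u) = 0 := by
  simp [lamD, Finset.expect_sub_distrib, expect_cntD x hA]

variable {x : (Fin m → ZMod 2) →+ DArr s m} {t : ℕ} {A B : Fin s → ℕ}

lemma NetD.lamD_eq_zero (hx : NetD x t) (hs : 0 < s) (hA : ∀ i, A i ≤ m)
    (h : a0F A + t ≤ m) (u : DArr s m) : lamD x A u = 0 := by
  have h1 := hx.expect_mul hs (A := A) (B := A) (by simpa [a0F] using h)
    (lamD_add_net x A) (lamD_add_of_zero x A) (lamD_add_of_zero x A)
  rw [expect_lamD x hA, mul_zero,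
    Finset.expect_eq_zero_iff_of_nonneg fun i _ => mul_self_nonneg _] at h1
  exact mul_self_eq_zero.1 (h1 u (Finset.mem_univ u))

lemma NetD.cntD_le (hx : NetD x t) (htm : t ≤ m) (h : m ≤ a0F A + t) (u : DArr s m) :
    cntD x A u ≤ 2 ^ t := by
  obtain ⟨d, hd, hsum⟩ := exists_le_sum_eq A (M := m - t) (by unfold a0F at h; omega)
  unfold cntD
  by_cases hne : (Finset.univ.filter fun v => ∀ i, PiD (A i) ((x v + u) i)).Nonempty
  · obtain ⟨v0, hv0⟩ := hne
    have h1 := hx d (by omega) (x v0)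
    rw [show (2 : ℝ) ^ t = ((2 ^ t : ℕ) : ℝ) by norm_num, ← h1]
    refine Nat.cast_le.2 (Finset.card_le_card fun v hv => ?_)
    simp only [Finset.mem_filter, Finset.mem_univ, true_and] at hv hv0 ⊢
    intro i j hj
    have hjA : (j : ℕ) < A i := hj.trans_le (hd i)
    have hz : ∀ w, PiD (A i) ((x w + u) i) → x w i j + u i j = if (j : ℕ) + 1 = A i then 1 else 0 := by
      rintro w (h0 | ⟨ha, k, hk, hk1⟩)
      · omega
      · split_ifs with hjk
        · have : j = k := Fin.ext (by omega)
          simpa [this] using hk1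
        · simpa using ha j (by omega)
    exact add_right_cancel ((hz v (hv i)).trans (hz v0 (hv0 i)).symm)
  · rw [Finset.not_nonempty_iff_eq_empty.1 hne]
    simp

lemma pow_div_pow_le (h : m ≤ a0F A + t) : (2 : ℝ) ^ m / 2 ^ a0F A ≤ 2 ^ t := by
  rw [div_le_iff₀ (by positivity), ← pow_add]
  exact pow_le_pow_right₀ one_le_two (by omega)

lemma NetD.abs_lamD_le (hx : NetD x t) (htm : t ≤ m) (h : m ≤ a0F A + t) (u : DArr s m) :
    |lamD x A u| ≤ 2 ^ t := by
  have h1 := hx.cntD_le htm h u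
  have h2 := cntD_nonneg x A u
  have h3 := pow_div_pow_le h
  have h4 : (0 : ℝ) ≤ 2 ^ m / 2 ^ a0F A := by positivity
  unfold lamD
  rw [abs_le]
  constructor <;> linarith

lemma NetD.expect_sq_lamD_le (hx : NetD x t) (htm : t ≤ m) (hA : ∀ i, A i ≤ m)
    (h : m ≤ a0F A + t) : (𝔼 u, lamD x A u ^ 2) ≤ 2 ^ t * (2 ^ m / 2 ^ a0F A) := by
  set μ : ℝ := 2 ^ m / 2 ^ a0F A with hμ
  calc (𝔼 u, lamD x A u ^ 2) ≤ 𝔼 u, ((2 ^ t - 2 * μ) * cntD x A u + μ ^ 2) := by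
        refine Finset.expect_le_expect fun u _ => ?_
        have h1 := hx.cntD_le htm h u
        have h2 := cntD_nonneg x A u
        unfold lamD
        rw [← hμ]
        nlinarith
    _ = (2 ^ t - 2 * μ) * μ + μ ^ 2 := by
        rw [Finset.expect_add_distrib, ← Finset.mul_expect, expect_cntD x hA, Fintype.expect_const]
    _ ≤ _ := by nlinarith [sq_nonneg μ]

lemma expect_sq_lamD_ge (hA : a0F A = m + 1) : (1 / 4 : ℝ) ≤ 𝔼 u, lamD x A u ^ 2 := by
  refine Finset.le_expect Finset.univ_nonempty fun u _ => ?_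
  unfold lamD cntD
  rw [hA]
  set n := (Finset.univ.filter fun v => ∀ i, PiD (A i) ((x v + u) i)).card
  have : (2 : ℝ) ^ m / 2 ^ (m + 1) = 1 / 2 := by rw [pow_succ]; field_simp
  rw [this]
  rcases Nat.eq_zero_or_pos n with h | h
  · rw [h]; norm_num
  · have : (1 : ℝ) ≤ n := by exact_mod_cast h
    nlinarith

end Digits

section Rademacher

variable {s m : ℕ}

lemma expect_add_right {G E : Type*} [Fintype G] [AddGroup G] [AddCommMonoid E] [Module ℚ≥0 E]
    (f : G → E) (w : G) : (𝔼 y, f (y + w)) = 𝔼 y, f y :=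
  Fintype.expect_equiv (Equiv.addRight w) (fun y => f (y + w)) f fun _ => rfl

lemma epsD_add (a : ℕ) (y z : Fin m → ZMod 2) : epsD a (y + z) = epsD a y * epsD a z := by
  unfold epsD
  rw [← Finset.prod_mul_distrib]
  refine Finset.prod_congr rfl fun j _ => ?_
  by_cases h : (j : ℕ) + 1 = a
  · simp only [h, true_and, Pi.add_apply]
    have h01 : ∀ p : ZMod 2, p = 0 ∨ p = 1 := by decide
    have h11 : (1 : ZMod 2) + 1 = 0 := by decide
    rcases h01 (y j) with hp | hp <;> rcases h01 (z j) with hq | hq <;> simp [hp, hq, h11]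
  · simp [h]

lemma epsD_mul_self (a : ℕ) (y : Fin m → ZMod 2) : epsD a y * epsD a y = 1 := by
  unfold epsD
  rw [← Finset.prod_mul_distrib]
  refine Finset.prod_eq_one fun j _ => ?_
  split_ifs <;> norm_num

lemma epsD_of_eq {a : ℕ} {j : Fin m} (h : (j : ℕ) + 1 = a) (y : Fin m → ZMod 2) :
    epsD a y = if y j = 1 then -1 else 1 := by
  unfold epsD
  rw [Finset.prod_eq_single j]
  · simp [h]
  · intro k _ hk
    rw [if_neg]
    rintro ⟨h1, -⟩
    exact hk (Fin.ext (by omega))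
  · simp

lemma epsD_zero (a : ℕ) : epsD a (0 : Fin m → ZMod 2) = 1 := by
  simp [epsD]

lemma epsD_single (a : ℕ) (j : Fin m) :
    epsD a (Pi.single j (1 : ZMod 2)) = if (j : ℕ) + 1 = a then -1 else 1 := by
  by_cases h : (j : ℕ) + 1 = a
  · rw [epsD_of_eq h]; simp [h]
  · rw [if_neg h]
    refine Finset.prod_eq_one fun k _ => if_neg ?_
    rintro ⟨h1, h2⟩
    by_cases hk : k = j
    · subst hk; exact h h1
    · simp [hk] at h2

lemma epsA_add (A : Fin s → ℕ) (y z : DArr s m) : epsA A (y + z) = epsA A y * epsA A z := by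
  unfold epsA
  rw [← Finset.prod_mul_distrib]
  exact Finset.prod_congr rfl fun i _ => epsD_add _ _ _

lemma epsA_mul_self (A : Fin s → ℕ) (y : DArr s m) : epsA A y * epsA A y = 1 := by
  unfold epsA
  rw [← Finset.prod_mul_distrib]
  exact Finset.prod_eq_one fun i _ => epsD_mul_self _ _

lemma abs_epsA (A : Fin s → ℕ) (y : DArr s m) : |epsA A y| = 1 := by
  rcases mul_self_eq_one_iff.1 (epsA_mul_self A y) with h | h <;> simp [h]

lemma epsA_single (A : Fin s → ℕ) (i : Fin s) (z : Fin m → ZMod 2) :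
    epsA A (Pi.single i z) = epsD (A i) z := by
  unfold epsA
  rw [Finset.prod_eq_single i]
  · simp
  · intro k _ hk
    simp [hk, epsD_zero]
  · simp

/-- The four functions pair up in each coordinate. -/
def Paired (A B C D : Fin s → ℕ) : Prop :=
  ∀ i, (A i = B i ∧ C i = D i) ∨ (A i = C i ∧ B i = D i) ∨ (A i = D i ∧ B i = C i)

lemma expect_epsA_four_le (A B C D : Fin s → ℕ) :
    |𝔼 y : DArr s m, epsA A y * epsA B y * (epsA C y * epsA D y)| ≤ 1 := by
  refine (Finset.abs_expect_le _ _).trans ?_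
  simp [abs_mul, abs_epsA]

lemma exists_odd_of_not_paired {a b c d : ℕ} (h1 : a = b → c ≠ d) (h2 : a = c → b ≠ d)
    (h3 : a = d → b ≠ c) :
    (a ≠ 0 ∧ a ≠ b ∧ a ≠ c ∧ a ≠ d) ∨ (b ≠ 0 ∧ b ≠ a ∧ b ≠ c ∧ b ≠ d) ∨
    (c ≠ 0 ∧ c ≠ a ∧ c ≠ b ∧ c ≠ d) ∨ (d ≠ 0 ∧ d ≠ a ∧ d ≠ b ∧ d ≠ c) ∨
    (a ≠ 0 ∧ a = b ∧ a = c ∧ a ≠ d) ∨ (a ≠ 0 ∧ a = b ∧ a = d ∧ a ≠ c) ∨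
    (a ≠ 0 ∧ a = c ∧ a = d ∧ a ≠ b) ∨ (b ≠ 0 ∧ b = c ∧ b = d ∧ a ≠ b) := by
  by_cases hab : a = b
  · grind
  by_cases hac : a = c
  · grind
  by_cases had : a = d
  · grind
  grind

lemma expect_epsA_four_eq_zero {A B C D : Fin s → ℕ} (hA : ∀ i, A i ≤ m) (hB : ∀ i, B i ≤ m)
    (hC : ∀ i, C i ≤ m) (hD : ∀ i, D i ≤ m) (h : ¬ Paired A B C D) :
    (𝔼 y : DArr s m, epsA A y * epsA B y * (epsA C y * epsA D y)) = 0 := by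
  unfold Paired at h
  push Not at h
  obtain ⟨i, hi⟩ := h
  have hj : ∃ j : Fin m, (if (j : ℕ) + 1 = A i then (-1 : ℝ) else 1) *
      (if (j : ℕ) + 1 = B i then -1 else 1) * ((if (j : ℕ) + 1 = C i then -1 else 1) *
      (if (j : ℕ) + 1 = D i then -1 else 1)) = -1 := by
    have aux : ∀ a ≤ m, ∀ b c d : ℕ, a ≠ 0 → a ≠ b → a ≠ c → a ≠ d → ∃ j : Fin m,
        (j : ℕ) + 1 = a ∧ (j : ℕ) + 1 ≠ b ∧ (j : ℕ) + 1 ≠ c ∧ (j : ℕ) + 1 ≠ d := by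
      intro a ha b c d h0 h1 h2 h3
      exact ⟨⟨a - 1, by omega⟩, by simp; omega, by simp; omega, by simp; omega, by simp; omega⟩
    have hex := exists_odd_of_not_paired (hi.1) hi.2.1 hi.2.2
    rcases hex with ⟨h0, h1, h2, h3⟩ | ⟨h0, h1, h2, h3⟩ | ⟨h0, h1, h2, h3⟩ | ⟨h0, h1, h2, h3⟩ |
      ⟨h0, h1, h2, h3⟩ | ⟨h0, h1, h2, h3⟩ | ⟨h0, h1, h2, h3⟩ | ⟨h0, h1, h2, h3⟩
    · obtain ⟨j, h4, h5, h6, h7⟩ := aux _ (hA i) _ _ _ h0 h1 h2 h3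
      exact ⟨j, by simp [h4, h1, h2, h3]⟩
    · obtain ⟨j, h4, h5, h6, h7⟩ := aux _ (hB i) _ _ _ h0 h1 h2 h3
      exact ⟨j, by simp [h4, h1, h2, h3]⟩
    · obtain ⟨j, h4, h5, h6, h7⟩ := aux _ (hC i) _ _ _ h0 h1 h2 h3
      exact ⟨j, by simp [h4, h1, h2, h3]⟩
    · obtain ⟨j, h4, h5, h6, h7⟩ := aux _ (hD i) _ _ _ h0 h1 h2 h3
      exact ⟨j, by simp [h4, h1, h2, h3]⟩
    · obtain ⟨j, h4, -⟩ := aux _ (hA i) _ _ _ h0 h3 h3 h3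
      exact ⟨j, by rw [h4, ← h1, ← h2, if_neg h3]; simp⟩
    · obtain ⟨j, h4, -⟩ := aux _ (hA i) _ _ _ h0 h3 h3 h3
      exact ⟨j, by rw [h4, ← h1, ← h2, if_neg h3]; simp⟩
    · obtain ⟨j, h4, -⟩ := aux _ (hA i) _ _ _ h0 h3 h3 h3
      exact ⟨j, by rw [h4, ← h1, ← h2, if_neg h3]; simp⟩
    · obtain ⟨j, h4, -⟩ := aux _ (hB i) _ _ _ h0 h3.symm h3.symm h3.symm
      exact ⟨j, by rw [h4, ← h1, ← h2, if_neg h3.symm]; simp⟩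
  obtain ⟨j, hj⟩ := hj
  have key : (𝔼 y : DArr s m, epsA A y * epsA B y * (epsA C y * epsA D y)) =
      𝔼 y : DArr s m, -(epsA A y * epsA B y * (epsA C y * epsA D y)) := by
    refine (Fintype.expect_equiv (Equiv.addRight (Pi.single i (Pi.single j (1 : ZMod 2)))) _ _
      fun y => ?_).symm
    simp only [Equiv.coe_addRight, epsA_add, epsA_single, epsD_single]
    linear_combination (-(epsA A y * epsA B y * (epsA C y * epsA D y))) * hj
  rw [Finset.expect_neg_distrib] at key
  linarith

lemma expect_epsA_mul {A B : Fin s → ℕ} (hA : ∀ i, A i ≤ m) (hB : ∀ i, B i ≤ m) :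
    (𝔼 y : DArr s m, epsA A y * epsA B y) = if A = B then 1 else 0 := by
  split_ifs with h
  · subst h
    simp [epsA_mul_self]
  · have h1 := expect_epsA_four_eq_zero (C := fun _ => 0) (D := fun _ => 0) hA hB (by simp) (by simp)
      (fun hp => h (funext fun i => by have := hp i; omega))
    simpa [epsA_mul_self] using h1

/-- A Rademacher chaos with coefficients `c`. -/
def chaos (𝒜 : Finset (Fin s → ℕ)) (c : (Fin s → ℕ) → ℝ) (y : DArr s m) : ℝ :=
  ∑ A ∈ 𝒜, c A * epsA A y

variable {𝒜 : Finset (Fin s → ℕ)} {c : (Fin s → ℕ) → ℝ}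

lemma expect_chaos_sq (h𝒜 : ∀ A ∈ 𝒜, ∀ i, A i ≤ m) :
    (𝔼 y : DArr s m, chaos 𝒜 c y ^ 2) = ∑ A ∈ 𝒜, c A ^ 2 := by
  have h1 : ∀ y : DArr s m, chaos 𝒜 c y ^ 2 =
      ∑ A ∈ 𝒜, ∑ B ∈ 𝒜, c A * c B * (epsA A y * epsA B y) := by
    intro y
    rw [sq, chaos, Finset.sum_mul_sum]
    exact Finset.sum_congr rfl fun A _ => Finset.sum_congr rfl fun B _ => by ring
  simp_rw [h1]
  rw [Finset.expect_sum_comm]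
  refine Finset.sum_congr rfl fun A hA => ?_
  rw [Finset.expect_sum_comm]
  have h2 : ∀ B ∈ 𝒜, (𝔼 y : DArr s m, c A * c B * (epsA A y * epsA B y)) =
      if A = B then c A * c B else 0 := by
    intro B hB
    rw [← Finset.mul_expect, expect_epsA_mul (h𝒜 A hA) (h𝒜 B hB)]
    simp
  rw [Finset.sum_congr rfl h2, Finset.sum_ite_eq, if_pos hA, sq]

/-- Second moment of a bilinear chaos: only paired quadruples contribute. -/
lemma expect_sq_sum_pairs_le (𝒬 : Finset ((Fin s → ℕ) × (Fin s → ℕ)))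
    (h𝒬 : ∀ p ∈ 𝒬, ∀ i, p.1 i ≤ m ∧ p.2 i ≤ m) {b : ℝ} (hb : 0 ≤ b)
    (hc : ∀ p ∈ 𝒬, |c p.1| ≤ b ∧ |c p.2| ≤ b) :
    (𝔼 y : DArr s m, (∑ p ∈ 𝒬, c p.1 * epsA p.1 y * (c p.2 * epsA p.2 y)) ^ 2) ≤
      b ^ 4 * ((𝒬 ×ˢ 𝒬).filter fun q => Paired q.1.1 q.1.2 q.2.1 q.2.2).card := by
  have h1 : ∀ y : DArr s m, (∑ p ∈ 𝒬, c p.1 * epsA p.1 y * (c p.2 * epsA p.2 y)) ^ 2 =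
      ∑ q ∈ 𝒬 ×ˢ 𝒬, c q.1.1 * c q.1.2 * (c q.2.1 * c q.2.2) *
        (epsA q.1.1 y * epsA q.1.2 y * (epsA q.2.1 y * epsA q.2.2 y)) := by
    intro y
    rw [sq, Finset.sum_mul_sum, ← Finset.sum_product']
    exact Finset.sum_congr rfl fun q _ => by ring
  simp_rw [h1]
  rw [Finset.expect_sum_comm, mul_comm, ← nsmul_eq_mul, ← Finset.sum_const, Finset.sum_filter]
  refine Finset.sum_le_sum fun q hq => ?_
  obtain ⟨hq1, hq2⟩ := Finset.mem_product.1 hq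
  rw [← Finset.mul_expect]
  split_ifs with h
  · refine (le_abs_self _).trans ?_
    rw [abs_mul, abs_mul, abs_mul, abs_mul]
    have e1 := expect_epsA_four_le (m := m) q.1.1 q.1.2 q.2.1 q.2.2
    calc _ ≤ b * b * (b * b) * 1 := by
          gcongr
          exacts [(hc _ hq1).1, (hc _ hq1).2, (hc _ hq2).1, (hc _ hq2).2]
      _ = b ^ 4 := by ring
  · rw [expect_epsA_four_eq_zero (fun i => (h𝒬 _ hq1 i).1) (fun i => (h𝒬 _ hq1 i).2)
      (fun i => (h𝒬 _ hq2 i).1) (fun i => (h𝒬 _ hq2 i).2) h, mul_zero]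

lemma expect_exp_rademacher (f : Fin m → ℝ) :
    (𝔼 η : Fin m → ZMod 2, Complex.exp (((∑ j, f j * epsD ((j : ℕ) + 1) η : ℝ) : ℂ) * Complex.I)) =
      ((∏ j, Real.cos (f j) : ℝ) : ℂ) := by
  have h1 : ∀ η : Fin m → ZMod 2,
      Complex.exp (((∑ j, f j * epsD ((j : ℕ) + 1) η : ℝ) : ℂ) * Complex.I) =
      ∏ j, Complex.exp (((f j * if η j = 1 then -1 else 1 : ℝ) : ℂ) * Complex.I) := by
    intro η
    rw [← Complex.exp_sum, Complex.ofReal_sum, Finset.sum_mul]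
    congr 1
    exact Finset.sum_congr rfl fun j _ => by rw [epsD_of_eq rfl]
  simp_rw [h1]
  rw [Fintype.expect_eq_sum_div_card,
    ← Fintype.prod_sum fun j (z : ZMod 2) =>
      Complex.exp (((f j * if z = 1 then -1 else 1 : ℝ) : ℂ) * Complex.I)]
  have h2 : ∀ j, (∑ z : ZMod 2, Complex.exp (((f j * if z = 1 then -1 else 1 : ℝ) : ℂ) * Complex.I))
      = 2 * (Real.cos (f j) : ℂ) := by
    intro j
    rw [show (Finset.univ : Finset (ZMod 2)) = {0, 1} by decide,
      Finset.sum_pair (by decide : (0 : ZMod 2) ≠ 1)]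
    rw [if_neg (by decide : (0 : ZMod 2) ≠ 1), if_pos rfl, Complex.ofReal_cos, Complex.two_cos]
    push_cast
    ring_nf
  rw [Finset.prod_congr rfl fun j _ => h2 j, Finset.prod_mul_distrib]
  simp only [Finset.prod_const, Finset.card_univ, Fintype.card_fin, Fintype.card_fun, ZMod.card]
  push_cast
  field_simp

/-- The part of the chaos with prescribed index in the coordinate `i₀`. -/
def slice (𝒜 : Finset (Fin s → ℕ)) (i₀ : Fin s) (a : ℕ) : Finset (Fin s → ℕ) :=
  𝒜.filter fun A => A i₀ = a

lemma chaos_add_single {i₀ : Fin s} (h𝒜 : ∀ A ∈ 𝒜, 1 ≤ A i₀ ∧ A i₀ ≤ m) (y : DArr s m)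
    (η : Fin m → ZMod 2) : chaos 𝒜 c (y + Pi.single i₀ η) =
      ∑ j : Fin m, chaos (slice 𝒜 i₀ ((j : ℕ) + 1)) c y * epsD ((j : ℕ) + 1) η := by
  unfold chaos
  simp_rw [epsA_add, epsA_single, Finset.sum_mul, slice, Finset.sum_filter]
  rw [Finset.sum_comm]
  refine Finset.sum_congr rfl fun A hA => ?_
  obtain ⟨h1, h2⟩ := h𝒜 A hA
  rw [Finset.sum_eq_single ⟨A i₀ - 1, by omega⟩]
  · rw [if_pos (by simp; omega), show A i₀ - 1 + 1 = A i₀ by omega, mul_assoc]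
  · intro j _ hj
    rw [if_neg]
    intro h
    exact hj (Fin.ext (by simp; omega))
  · simp

lemma expect_exp_chaos {i₀ : Fin s} (h𝒜 : ∀ A ∈ 𝒜, 1 ≤ A i₀ ∧ A i₀ ≤ m) (τ : ℝ) :
    (𝔼 y : DArr s m, Complex.exp (((τ * chaos 𝒜 c y : ℝ) : ℂ) * Complex.I)) =
      ((𝔼 y : DArr s m, ∏ j : Fin m,
        Real.cos (τ * chaos (slice 𝒜 i₀ ((j : ℕ) + 1)) c y) : ℝ) : ℂ) := by
  have h1 : ∀ η : Fin m → ZMod 2,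
      (𝔼 y : DArr s m, Complex.exp (((τ * chaos 𝒜 c y : ℝ) : ℂ) * Complex.I)) =
      𝔼 y : DArr s m, Complex.exp (((τ * chaos 𝒜 c (y + Pi.single i₀ η) : ℝ) : ℂ) * Complex.I) :=
    fun η => (expect_add_right (fun y : DArr s m =>
      Complex.exp (((τ * chaos 𝒜 c y : ℝ) : ℂ) * Complex.I)) _).symm
  rw [← Fintype.expect_const (ι := Fin m → ZMod 2)
    (𝔼 y : DArr s m, Complex.exp (((τ * chaos 𝒜 c y : ℝ) : ℂ) * Complex.I))]
  rw [Finset.expect_congr rfl fun η _ => h1 η, Finset.expect_comm]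
  rw [Fintype.expect_eq_sum_div_card, Fintype.expect_eq_sum_div_card, Complex.ofReal_div,
    Complex.ofReal_sum, Complex.ofReal_natCast]
  congr 1
  refine Finset.sum_congr rfl fun y _ => ?_
  rw [← expect_exp_rademacher]
  refine Finset.expect_congr rfl fun η _ => ?_
  rw [chaos_add_single h𝒜, Finset.mul_sum]
  simp_rw [mul_assoc]

lemma sum_slice_sq (i₀ : Fin s) (h𝒜 : ∀ A ∈ 𝒜, 1 ≤ A i₀ ∧ A i₀ ≤ m) (f : (Fin s → ℕ) → ℝ) :
    ∑ j : Fin m, ∑ A ∈ slice 𝒜 i₀ ((j : ℕ) + 1), f A = ∑ A ∈ 𝒜, f A := by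
  simp_rw [slice, Finset.sum_filter]
  rw [Finset.sum_comm]
  refine Finset.sum_congr rfl fun A hA => ?_
  obtain ⟨h1, h2⟩ := h𝒜 A hA
  rw [Finset.sum_eq_single ⟨A i₀ - 1, by omega⟩]
  · rw [if_pos (by simp; omega)]
  · intro j _ hj
    rw [if_neg]
    intro h
    exact hj (Fin.ext (by simp; omega))
  · simp

lemma chaos_sq_eq (y : DArr s m) : chaos 𝒜 c y ^ 2 = (∑ A ∈ 𝒜, c A ^ 2) +
    ∑ p ∈ 𝒜.offDiag, c p.1 * epsA p.1 y * (c p.2 * epsA p.2 y) := by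
  rw [sq, chaos, Finset.sum_mul_sum, ← Finset.sum_product', ← Finset.diag_union_offDiag,
    Finset.sum_union (Finset.disjoint_diag_offDiag _), Finset.sum_diag]
  congr 1
  refine Finset.sum_congr rfl fun A _ => ?_
  linear_combination c A ^ 2 * epsA_mul_self A y

end Rademacher

section Counting

variable {s : ℕ}

lemma eq_of_a0F_eq {A B : Fin s → ℕ} (i₁ : Fin s) (h : ∀ i, i ≠ i₁ → A i = B i)
    (h0 : a0F A = a0F B) : A = B := by
  unfold a0F at h0
  rw [← Finset.add_sum_erase _ _ (Finset.mem_univ i₁),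
    ← Finset.add_sum_erase _ B (Finset.mem_univ i₁),
    Finset.sum_congr rfl fun i hi => h i (Finset.ne_of_mem_erase hi)] at h0
  have h1 := Nat.add_right_cancel h0
  funext i
  by_cases hi : i = i₁
  · rw [hi, h1]
  · exact h i hi

/-- Index vectors in `[0,m]^s` whose sum lies in the window `(m - t, m + V)`. -/
def slab (s m t V : ℕ) : Finset (Fin s → ℕ) :=
  (Fintype.piFinset fun _ : Fin s => Finset.range (m + 1)).filter fun A =>
    m < a0F A + t ∧ a0F A < m + V

/-- The part of the slab with positive index in the coordinate `i₀`. -/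
def slabPos (m t V : ℕ) (i₀ : Fin s) : Finset (Fin s → ℕ) :=
  (slab s m t V).filter fun A => 1 ≤ A i₀

variable {m t V : ℕ} {A B : Fin s → ℕ} {i₀ i₁ : Fin s}

lemma mem_slab : A ∈ slab s m t V ↔ (∀ i, A i ≤ m) ∧ m < a0F A + t ∧ a0F A < m + V := by
  simp [slab]

lemma mem_slabPos :
    A ∈ slabPos m t V i₀ ↔ ((∀ i, A i ≤ m) ∧ m < a0F A + t ∧ a0F A < m + V) ∧ 1 ≤ A i₀ := by
  simp [slabPos, mem_slab]

/-- The window of possible sums. -/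
def window (m t V : ℕ) : Finset ℕ := Finset.Ico (m + 1 - t) (m + V)

lemma card_window_le : (window m t V).card ≤ t + V := by
  simp [window]; omega

lemma a0F_mem_window (h : A ∈ slab s m t V) : a0F A ∈ window m t V := by
  have := (mem_slab.1 h).2
  simp [window]
  omega

lemma card_piFinset_zero_off (m : ℕ) (J : Finset (Fin s)) :
    (Fintype.piFinset fun i : Fin s => if i ∈ J then {0} else Finset.range (m + 1)).card =
      (m + 1) ^ (s - J.card) := by
  rw [Fintype.card_piFinset]
  have h : ∀ i : Fin s, (if i ∈ J then {0} else Finset.range (m + 1)).card =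
      if i ∈ J then 1 else m + 1 := fun i => by split_ifs <;> simp
  rw [Finset.prod_congr rfl fun i _ => h i, Finset.prod_ite]
  simp only [Finset.prod_const_one, one_mul, Finset.prod_const]
  congr 1
  rw [Finset.filter_not, Finset.card_sdiff_of_subset (Finset.filter_subset _ _)]
  simp

/-- Set the coordinates in `J` to zero. -/
def zeroOff (J : Finset (Fin s)) (A : Fin s → ℕ) : Fin s → ℕ := fun i => if i ∈ J then 0 else A i

lemma zeroOff_mem (J : Finset (Fin s)) (hA : ∀ i, A i ≤ m) :
    zeroOff J A ∈ Fintype.piFinset fun i : Fin s =>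
      if i ∈ J then {0} else Finset.range (m + 1) := by
  rw [Fintype.mem_piFinset]
  intro i
  unfold zeroOff
  split_ifs
  · simp
  · simpa [Nat.lt_succ_iff] using hA i

lemma zeroOff_eq {J : Finset (Fin s)} (h : zeroOff J A = zeroOff J B) {i : Fin s} (hi : i ∉ J) :
    A i = B i := by
  have := congrFun h i
  simpa [zeroOff, hi] using this

lemma card_slab_le (hs : 0 < s) : (slab s m t V).card ≤ (m + 1) ^ (s - 1) * (t + V) := by
  let i₁ : Fin s := ⟨0, hs⟩
  calc (slab s m t V).card ≤ ((Fintype.piFinset fun i : Fin s =>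
          if i ∈ ({i₁} : Finset (Fin s)) then {0} else Finset.range (m + 1)) ×ˢ
          window m t V).card := by
        refine Finset.card_le_card_of_injOn (fun A => (zeroOff {i₁} A, a0F A)) ?_ ?_
        · intro A hA
          exact Finset.mem_product.2 ⟨zeroOff_mem _ (mem_slab.1 hA).1, a0F_mem_window hA⟩
        · intro A _ B _ h
          obtain ⟨h1, h2⟩ := Prod.ext_iff.1 h
          exact eq_of_a0F_eq i₁ (fun i hi => zeroOff_eq h1 (by simpa using hi)) h2
    _ ≤ _ := by
        rw [Finset.card_product, card_piFinset_zero_off, Finset.card_singleton]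
        exact Nat.mul_le_mul_left _ card_window_le

lemma card_slice_slab_le (h : i₁ ≠ i₀) (a : ℕ) :
    (slice (slab s m t V) i₀ a).card ≤ (m + 1) ^ (s - 2) * (t + V) := by
  calc (slice (slab s m t V) i₀ a).card ≤ ((Fintype.piFinset fun i : Fin s =>
          if i ∈ ({i₁, i₀} : Finset (Fin s)) then {0} else Finset.range (m + 1)) ×ˢ
          window m t V).card := by
        refine Finset.card_le_card_of_injOn (fun A => (zeroOff {i₁, i₀} A, a0F A)) ?_ ?_
        · intro A hA
          have hA' := (Finset.mem_filter.1 hA).1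
          exact Finset.mem_product.2 ⟨zeroOff_mem _ (mem_slab.1 hA').1, a0F_mem_window hA'⟩
        · intro A hA B hB h
          obtain ⟨h1, h2⟩ := Prod.ext_iff.1 h
          refine eq_of_a0F_eq i₁ (fun i hi => ?_) h2
          by_cases hi0 : i = i₀
          · rw [hi0, (Finset.mem_filter.1 hA).2, (Finset.mem_filter.1 hB).2]
          · exact zeroOff_eq h1 (by simp [hi, hi0])
    _ ≤ _ := by
        rw [Finset.card_product, card_piFinset_zero_off, Finset.card_pair h]
        exact Nat.mul_le_mul_left _ card_window_le

/-- Distinct pairs of index vectors with the same index in the coordinate `i₀`. -/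
def slabPairs (m t V : ℕ) (i₀ : Fin s) : Finset ((Fin s → ℕ) × (Fin s → ℕ)) :=
  (slabPos m t V i₀).offDiag.filter fun p => p.1 i₀ = p.2 i₀

/-- Pairing of four numbers according to a pattern. -/
def PatternPair (k : Fin 3) (a b c d : ℕ) : Prop :=
  if k = 0 then a = b ∧ c = d else if k = 1 then a = c ∧ b = d else a = d ∧ b = c

/-- Quadruples that are paired with a given pattern. -/
def quads (m t V : ℕ) (i₀ : Fin s) (π : Fin s → Fin 3) (i₁ : Fin s) :
    Finset (((Fin s → ℕ) × (Fin s → ℕ)) × ((Fin s → ℕ) × (Fin s → ℕ))) :=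
  (slabPairs m t V i₀ ×ˢ slabPairs m t V i₀).filter fun q =>
    (π i₁ ≠ 0 ∧ i₁ ≠ i₀) ∧ ∀ i, PatternPair (π i) (q.1.1 i) (q.1.2 i) (q.2.1 i) (q.2.2 i)

lemma card_quads_le (π : Fin s → Fin 3) (i₁ : Fin s) :
    (quads m t V i₀ π i₁).card ≤
      (m + 1) ^ (s - 1) * (m + 1) ^ (s - 2) * ((t + V) * (t + V) * (t + V)) := by
  by_cases hi : π i₁ ≠ 0 ∧ i₁ ≠ i₀
  swap
  · rw [quads, Finset.filter_eq_empty_iff.2 fun q _ h => hi h.1]; simp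
  obtain ⟨hi1, hi2⟩ := hi
  have hmem : ∀ q ∈ quads m t V i₀ π i₁, q.1.1 ∈ slab s m t V ∧ q.1.2 ∈ slab s m t V ∧
      q.2.1 ∈ slab s m t V ∧ q.1.1 i₀ = q.1.2 i₀ ∧
      ∀ i, PatternPair (π i) (q.1.1 i) (q.1.2 i) (q.2.1 i) (q.2.2 i) := by
    intro q hq
    simp only [quads, slabPairs, slabPos, Finset.mem_filter, Finset.mem_product,
      Finset.mem_offDiag] at hq
    tauto
  calc (quads m t V i₀ π i₁).card ≤ (((Fintype.piFinset fun i : Fin s =>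
          if i ∈ ({i₁} : Finset (Fin s)) then {0} else Finset.range (m + 1)) ×ˢ
        (Fintype.piFinset fun i : Fin s =>
          if i ∈ ({i₁, i₀} : Finset (Fin s)) then {0} else Finset.range (m + 1))) ×ˢ
        ((window m t V ×ˢ window m t V) ×ˢ window m t V)).card := by
        refine Finset.card_le_card_of_injOn (fun q => ((zeroOff {i₁} q.1.1,
          zeroOff {i₁, i₀} fun i => if π i = 0 then q.2.1 i else q.1.2 i),
          (a0F q.1.1, a0F q.1.2), a0F q.2.1)) ?_ ?_
        · intro q hq
          obtain ⟨h1, h2, h3, -⟩ := hmem q hq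
          simp only [Finset.mem_coe, Finset.mem_product]
          refine ⟨⟨zeroOff_mem _ (mem_slab.1 h1).1, zeroOff_mem _ fun i => ?_⟩,
            ⟨a0F_mem_window h1, a0F_mem_window h2⟩, a0F_mem_window h3⟩
          split_ifs
          · exact (mem_slab.1 h3).1 i
          · exact (mem_slab.1 h2).1 i
        · rintro ⟨⟨A, B⟩, C, D⟩ hq ⟨⟨A', B'⟩, C', D'⟩ hq' h
          obtain ⟨-, -, -, h4, h5⟩ := hmem _ hq
          obtain ⟨-, -, -, h4', h5'⟩ := hmem _ hq'
          simp only [Prod.mk.injEq] at h h4 h4' h5 h5' ⊢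
          obtain ⟨⟨hz, hv⟩, ⟨hA, hB⟩, hC⟩ := h
          have eA : A = A' := eq_of_a0F_eq i₁ (fun i hi => zeroOff_eq hz (by simpa using hi)) hA
          subst eA
          have ev : ∀ i, i ≠ i₁ → i ≠ i₀ → (if π i = 0 then C i else B i) =
              if π i = 0 then C' i else B' i :=
            fun i h1 h2 => zeroOff_eq hv (by simp [h1, h2])
          have eB : B = B' := by
            refine eq_of_a0F_eq i₁ (fun i hi => ?_) hB
            by_cases hi0 : i = i₀
            · rw [hi0, ← h4, h4']
            · have e1 := ev i hi hi0
              have e2 := h5 i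
              have e3 := h5' i
              unfold PatternPair at e2 e3
              split_ifs at e1 e2 e3 <;> omega
          subst eB
          have eC : C = C' := by
            refine eq_of_a0F_eq i₀ (fun i hi => ?_) hC
            have e2 := h5 i
            have e3 := h5' i
            unfold PatternPair at e2 e3
            by_cases hi0 : i = i₁
            · subst hi0
              rw [if_neg hi1] at e2 e3
              split_ifs at e2 e3 <;> omega
            · have e1 := ev i hi0 hi
              split_ifs at e1 e2 e3 <;> omega
          subst eC
          refine ⟨⟨rfl, rfl⟩, rfl, ?_⟩
          funext i
          have e2 := h5 i
          have e3 := h5' i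
          unfold PatternPair at e2 e3
          split_ifs at e2 e3 <;> omega
    _ ≤ _ := by
        simp only [Finset.card_product, card_piFinset_zero_off, Finset.card_singleton,
          Finset.card_pair hi2]
        gcongr <;> exact card_window_le

lemma card_paired_le :
    ((slabPairs m t V i₀ ×ˢ slabPairs m t V i₀).filter fun q =>
      Paired q.1.1 q.1.2 q.2.1 q.2.2).card ≤
      3 ^ s * s * ((m + 1) ^ (s - 1) * (m + 1) ^ (s - 2) * ((t + V) * (t + V) * (t + V))) := by
  have hsub : ((slabPairs m t V i₀ ×ˢ slabPairs m t V i₀).filter fun q =>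
      Paired q.1.1 q.1.2 q.2.1 q.2.2) ⊆
      (Finset.univ : Finset ((Fin s → Fin 3) × Fin s)).biUnion fun p =>
        quads m t V i₀ p.1 p.2 := by
    intro q hq
    obtain ⟨hq1, hq2⟩ := Finset.mem_filter.1 hq
    have hne : q.1.1 ≠ q.1.2 ∧ q.1.1 i₀ = q.1.2 i₀ ∧ q.2.1 i₀ = q.2.2 i₀ := by
      simp only [slabPairs, Finset.mem_filter, Finset.mem_product, Finset.mem_offDiag] at hq1
      tauto
    obtain ⟨i₁, hi₁⟩ := Function.ne_iff.1 hne.1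
    have hex : ∀ i, ∃ k : Fin 3, (q.1.1 i ≠ q.1.2 i → k ≠ 0) ∧
        PatternPair k (q.1.1 i) (q.1.2 i) (q.2.1 i) (q.2.2 i) := by
      intro i
      by_cases h1 : q.1.1 i = q.1.2 i ∧ q.2.1 i = q.2.2 i
      · exact ⟨0, fun h => absurd h1.1 h, by simpa [PatternPair] using h1⟩
      · rcases hq2 i with h | h | h
        · exact absurd h h1
        · exact ⟨1, fun _ => by decide, by simpa [PatternPair] using h⟩
        · exact ⟨2, fun _ => by decide, by simpa [PatternPair] using h⟩
    choose π hπ0 hπ using hex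
    refine Finset.mem_biUnion.2 ⟨(π, i₁), Finset.mem_univ _,
      Finset.mem_filter.2 ⟨hq1, ⟨hπ0 i₁ hi₁, ?_⟩, hπ⟩⟩
    rintro rfl
    exact hi₁ hne.2.1
  refine (Finset.card_le_card hsub).trans ((Finset.card_biUnion_le_card_mul _ _ _
    fun p _ => card_quads_le p.1 p.2).trans ?_)
  simp

lemma card_correlated_le (hs : 0 < s) :
    ((slabPos m t V i₀ ×ˢ slabPos m t V i₀).filter fun p =>
      m < (∑ i, min (p.1 i) (p.2 i)) + t).card ≤
      (m + 1) ^ (s - 1) * (t + V) * (2 * (t + V)) ^ s := by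
  have hsub : ((slabPos m t V i₀ ×ˢ slabPos m t V i₀).filter fun p =>
      m < (∑ i, min (p.1 i) (p.2 i)) + t) ⊆
      (slab s m t V).biUnion fun A => (Fintype.piFinset fun i : Fin s =>
        Finset.Ico (A i - (t + V)) (A i + (t + V))).image fun B => (A, B) := by
    rintro ⟨A, B⟩ h
    simp only [slabPos, Finset.mem_filter, Finset.mem_product] at h
    obtain ⟨⟨⟨hA, -⟩, hB, -⟩, hm⟩ := h
    refine Finset.mem_biUnion.2 ⟨A, hA, Finset.mem_image.2 ⟨B, ?_, rfl⟩⟩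
    rw [Fintype.mem_piFinset]
    intro i
    have h1 : A i + ∑ k, min (A k) (B k) ≤ a0F A + min (A i) (B i) := by
      unfold a0F
      rw [← Finset.add_sum_erase _ _ (Finset.mem_univ i),
        ← Finset.add_sum_erase _ A (Finset.mem_univ i)]
      have := Finset.sum_le_sum fun k (_ : k ∈ Finset.univ.erase i) => min_le_left (A k) (B k)
      omega
    have h2 : B i + ∑ k, min (A k) (B k) ≤ a0F B + min (A i) (B i) := by
      unfold a0F
      rw [← Finset.add_sum_erase _ _ (Finset.mem_univ i),
        ← Finset.add_sum_erase _ B (Finset.mem_univ i)]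
      have := Finset.sum_le_sum fun k (_ : k ∈ Finset.univ.erase i) => min_le_right (A k) (B k)
      omega
    have h3 := (mem_slab.1 hA).2
    have h4 := (mem_slab.1 hB).2
    simp only [Finset.mem_Ico]
    omega
  refine (Finset.card_le_card hsub).trans ((Finset.card_biUnion_le_card_mul _ _
    ((2 * (t + V)) ^ s) fun A _ => ?_).trans ?_)
  · refine Finset.card_image_le.trans ?_
    rw [Fintype.card_piFinset]
    refine (Finset.prod_le_prod' fun i _ => show _ ≤ 2 * (t + V) from ?_).trans (by simp)
    simp
    omega
  · exact Nat.mul_le_mul_right _ (card_slab_le hs)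

/-- Many index vectors have sum exactly `m + 1`. -/
lemma le_card_slab (hs : 2 ≤ s) (hms : s ≤ m) (hV : 2 ≤ V) :
    (m / s) ^ (s - 1) ≤ ((slabPos m t V i₀).filter fun A => a0F A = m + 1).card := by
  set q := m / s with hq
  have hq1 : 1 ≤ q := (Nat.one_le_div_iff (by omega)).2 hms
  have hqm : q * s ≤ m := Nat.div_mul_le_self m s
  have hcard : (Fintype.piFinset fun i : Fin s =>
      if i = i₀ then {0} else Finset.Icc 1 q).card = q ^ (s - 1) := by
    rw [Fintype.card_piFinset, ← Finset.mul_prod_erase _ _ (Finset.mem_univ i₀),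
      Finset.prod_congr rfl (g := fun _ => q)]
    · simp
    · intro i hi
      rw [if_neg (Finset.ne_of_mem_erase hi)]
      simp
  rw [← hcard]
  refine Finset.card_le_card_of_injOn (fun B => Function.update B i₀ (m + 1 - a0F B)) ?_ ?_
  · intro B hB
    have hB' := Fintype.mem_piFinset.1 hB
    have hB0 : B i₀ = 0 := by simpa using hB' i₀
    have hBi : ∀ i, i ≠ i₀ → 1 ≤ B i ∧ B i ≤ q := fun i hi => by simpa [hi] using hB' i
    have hc : (Finset.univ.erase i₀).card = s - 1 := by simp
    have h1 : s - 1 ≤ a0F B := by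
      unfold a0F
      rw [← Finset.add_sum_erase _ _ (Finset.mem_univ i₀), hB0, zero_add, ← hc]
      have := Finset.sum_le_sum fun i (hi : i ∈ Finset.univ.erase i₀) =>
        (hBi i (Finset.ne_of_mem_erase hi)).1
      simpa using this
    have h2 : a0F B ≤ (s - 1) * q := by
      unfold a0F
      rw [← Finset.add_sum_erase _ _ (Finset.mem_univ i₀), hB0, zero_add, ← hc]
      have := Finset.sum_le_sum fun i (hi : i ∈ Finset.univ.erase i₀) =>
        (hBi i (Finset.ne_of_mem_erase hi)).2
      simpa using this
    have h3 : (s - 1) * q ≤ m := (Nat.mul_le_mul_right q (Nat.sub_le s 1)).trans (by linarith)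
    have h4 : a0F (Function.update B i₀ (m + 1 - a0F B)) = m + 1 := by
      have e1 : a0F B = ∑ i ∈ Finset.univ.erase i₀, B i := by
        unfold a0F
        rw [← Finset.add_sum_erase _ _ (Finset.mem_univ i₀), hB0, zero_add]
      have e2 : a0F (Function.update B i₀ (m + 1 - a0F B)) =
          (m + 1 - a0F B) + ∑ i ∈ Finset.univ.erase i₀, B i := by
        conv_lhs => unfold a0F
        rw [← Finset.add_sum_erase _ _ (Finset.mem_univ i₀), Function.update_self]
        congr 1
        exact Finset.sum_congr rfl fun i hi => by
          rw [Function.update_of_ne (Finset.ne_of_mem_erase hi)]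
      rw [e2, ← e1]
      omega
    change Function.update B i₀ (m + 1 - a0F B) ∈ _
    rw [Finset.mem_coe, Finset.mem_filter, mem_slabPos]
    refine ⟨⟨⟨fun i => ?_, by omega, by omega⟩, ?_⟩, h4⟩
    · by_cases hi : i = i₀
      · subst hi; rw [Function.update_self]; omega
      · rw [Function.update_of_ne hi]
        exact (hBi i hi).2.trans (Nat.div_le_self m s)
    · rw [Function.update_self]; omega
  · intro B hB B' hB' h
    have hB0 : B i₀ = 0 := by simpa using Fintype.mem_piFinset.1 hB i₀
    have hB0' : B' i₀ = 0 := by simpa using Fintype.mem_piFinset.1 hB' i₀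
    funext i
    by_cases hi : i = i₀
    · rw [hi, hB0, hB0']
    · simpa [Function.update_of_ne hi] using congrFun h i

end Counting

section Expectation

variable {α β : Type*} [Fintype α] [Fintype β]

lemma expect_prod_type {E : Type*} [AddCommMonoid E] [Module ℚ≥0 E] (f : α × β → E) :
    (𝔼 p, f p) = 𝔼 a, 𝔼 b, f (a, b) := by
  rw [← Finset.univ_product_univ, Finset.expect_product]

lemma expect_abs_le_sqrt [Nonempty α] (f : α → ℝ) : (𝔼 a, |f a|) ≤ Real.sqrt (𝔼 a, f a ^ 2) := by
  have h := Finset.expect_mul_sq_le_sq_mul_sq (Finset.univ : Finset α) (fun a => |f a|) fun _ => 1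
  simp only [mul_one, sq_abs, one_pow, Fintype.expect_const] at h
  exact Real.le_sqrt_of_sq_le h

end Expectation

section DigitCore

variable {s m : ℕ}

/-- The coefficients of the chaos expansion of the discrepancy. -/
def coefD (x : (Fin m → ZMod 2) →+ DArr s m) (A : Fin s → ℕ) (u : DArr s m) : ℝ :=
  (2 ^ s)⁻¹ * ((-1) ^ kapF A * lamD x A u)

/-- The box `[0,m]^s` of index vectors. -/
def boxI (s m : ℕ) : Finset (Fin s → ℕ) := Fintype.piFinset fun _ : Fin s => Finset.range (m + 1)

/-- The digit-level discrepancy. -/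
def discD (x : (Fin m → ZMod 2) →+ DArr s m) (p : DArr s m × DArr s m) : ℝ :=
  chaos (boxI s m) (fun A => coefD x A p.1) p.2

/-- The main part of the digit-level discrepancy. -/
def mainD (x : (Fin m → ZMod 2) →+ DArr s m) (t V : ℕ) (i₀ : Fin s)
    (p : DArr s m × DArr s m) : ℝ :=
  chaos (slabPos m t V i₀) (fun A => coefD x A p.1) p.2

/-- The slices of the main part. -/
def sliceD (x : (Fin m → ZMod 2) →+ DArr s m) (t V : ℕ) (i₀ : Fin s) (j : Fin m)
    (p : DArr s m × DArr s m) : ℝ :=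
  chaos (slice (slabPos m t V i₀) i₀ ((j : ℕ) + 1)) (fun A => coefD x A p.1) p.2

/-- The variance of the main part. -/
def varD (x : (Fin m → ZMod 2) →+ DArr s m) (t V : ℕ) (i₀ : Fin s) : ℝ :=
  ∑ A ∈ slabPos m t V i₀, 𝔼 u, coefD x A u ^ 2

/-- The size of the relative errors. -/
def errD (s m t V : ℕ) : ℝ :=
  (2 ^ t) ^ 4 * (2 * ((t : ℝ) + V)) ^ (s + 3) * (3 ^ s * s) / (m + 1)

variable {x : (Fin m → ZMod 2) →+ DArr s m} {t V : ℕ} {i₀ i₁ : Fin s} {A B : Fin s → ℕ}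

lemma mem_boxI : A ∈ boxI s m ↔ ∀ i, A i ≤ m := by
  simp [boxI]

lemma coefD_sq (u : DArr s m) : coefD x A u ^ 2 = ((2 ^ s)⁻¹) ^ 2 * lamD x A u ^ 2 := by
  unfold coefD
  rw [mul_pow, mul_pow, ← pow_mul, mul_comm (kapF A) 2, pow_mul]
  simp

lemma coefD_sq_le (u : DArr s m) : coefD x A u ^ 2 ≤ lamD x A u ^ 2 := by
  rw [coefD_sq]
  refine mul_le_of_le_one_left (sq_nonneg _) (pow_le_one₀ (by positivity) ?_)
  exact inv_le_one_of_one_le₀ (one_le_pow₀ one_le_two)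

lemma NetD.abs_coefD_le (hx : NetD x t) (htm : t ≤ m) (h : m ≤ a0F A + t) (u : DArr s m) :
    |coefD x A u| ≤ 2 ^ t :=
  (sq_le_sq.1 (coefD_sq_le u)).trans (hx.abs_lamD_le htm h u)

lemma expect_mainD_sq : (𝔼 p, mainD x t V i₀ p ^ 2) = varD x t V i₀ := by
  rw [expect_prod_type]
  unfold mainD
  simp_rw [expect_chaos_sq fun A hA => (mem_slabPos.1 hA).1.1]
  rw [Finset.expect_sum_comm, varD]

lemma varD_ge (hs : 2 ≤ s) (hms : s ≤ m) (hV : 2 ≤ V) :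
    (4 ^ (s + 1) * (2 * (s : ℝ)) ^ (s - 1))⁻¹ * ((m : ℝ) + 1) ^ (s - 1) ≤ varD x t V i₀ := by
  have hs0 : (0 : ℝ) < s := by exact_mod_cast (by omega : 0 < s)
  have h1 : ((slabPos m t V i₀).filter fun A => a0F A = m + 1).card • ((4 ^ (s + 1))⁻¹ : ℝ) ≤
      varD x t V i₀ := by
    rw [← Finset.sum_const]
    refine (Finset.sum_le_sum fun A hA => ?_).trans
      (Finset.sum_le_sum_of_subset_of_nonneg (Finset.filter_subset _ _) fun A _ _ =>
        Finset.expect_nonneg fun u _ => sq_nonneg _)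
    simp_rw [coefD_sq]
    rw [← Finset.mul_expect]
    have := expect_sq_lamD_ge (x := x) (Finset.mem_filter.1 hA).2
    calc ((4 ^ (s + 1))⁻¹ : ℝ) = ((2 ^ s)⁻¹) ^ 2 * (1 / 4) := by
          have h4 : (4 : ℝ) ^ s = (2 ^ s) ^ 2 := by
            rw [← pow_mul, mul_comm, pow_mul]
            norm_num
          rw [pow_succ, h4, mul_inv, inv_pow]
          norm_num
      _ ≤ _ := by gcongr
  refine le_trans ?_ h1
  have h2 := le_card_slab (t := t) (i₀ := i₀) hs hms hV
  have h3 : ((m : ℝ) + 1) ≤ 2 * s * (m / s : ℕ) := by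
    have e1 : 1 ≤ m / s := (Nat.one_le_div_iff (by omega)).2 hms
    have e2 : m < s * (m / s + 1) := Nat.lt_mul_div_succ m (by omega)
    have e3 : m + 1 ≤ 2 * s * (m / s) := by nlinarith
    exact_mod_cast e3
  have h4 : ((m : ℝ) + 1) ^ (s - 1) ≤ (2 * (s : ℝ)) ^ (s - 1) * ((m / s : ℕ) : ℝ) ^ (s - 1) := by
    rw [← mul_pow]
    gcongr
  have h5 : ((m / s : ℕ) : ℝ) ^ (s - 1) ≤
      (((slabPos m t V i₀).filter fun A => a0F A = m + 1).card : ℝ) := by exact_mod_cast h2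
  rw [nsmul_eq_mul, mul_inv, mul_assoc, mul_comm (_ : ℝ) ((4 : ℝ) ^ (s + 1))⁻¹]
  gcongr
  rw [inv_mul_le_iff₀ (by positivity)]
  exact h4.trans (by gcongr)

lemma errD_nonneg (s m t V : ℕ) : 0 ≤ errD s m t V := by
  unfold errD; positivity

lemma errD_mul (s m t V k : ℕ) : errD s m t V * ((m : ℝ) + 1) ^ (k + 1) =
    (2 ^ t) ^ 4 * (2 * ((t : ℝ) + V)) ^ (s + 3) * (3 ^ s * s) * ((m : ℝ) + 1) ^ k := by
  unfold errD
  have : (m : ℝ) + 1 ≠ 0 := by positivity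
  rw [pow_succ' ((m : ℝ) + 1) k, ← mul_assoc, div_mul_cancel₀ _ this]

lemma le_errD_aux (hs : 2 ≤ s) (hV : 2 ≤ V) {k : ℕ} (hk : k ≤ s + 3)
    {n : ℕ} (hn : n ≤ 4) :
    4 * ((2 ^ t) ^ n * ((t : ℝ) + V) ^ k) ≤
      (2 ^ t) ^ 4 * (2 * ((t : ℝ) + V)) ^ (s + 3) * (3 ^ s * s) := by
  have h1 : (1 : ℝ) ≤ 2 ^ t := one_le_pow₀ one_le_two
  have hK : (1 : ℝ) ≤ (t : ℝ) + V := by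
    have : (2 : ℝ) ≤ V := by exact_mod_cast hV
    have := Nat.cast_nonneg (α := ℝ) t
    linarith
  have h2 : ((2 : ℝ) ^ t) ^ n ≤ (2 ^ t) ^ 4 := pow_le_pow_right₀ h1 hn
  have h3 : ((t : ℝ) + V) ^ k ≤ (2 * ((t : ℝ) + V)) ^ (s + 3) :=
    (pow_le_pow_right₀ hK hk).trans (pow_le_pow_left₀ (by linarith) (by linarith) _)
  have h4 : (4 : ℝ) ≤ 3 ^ s * s := by
    have e1 : (3 : ℝ) ^ 2 ≤ 3 ^ s := pow_le_pow_right₀ (by norm_num) hs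
    have e2 : (2 : ℝ) ≤ s := by exact_mod_cast hs
    nlinarith
  calc 4 * (((2 : ℝ) ^ t) ^ n * ((t : ℝ) + V) ^ k)
      ≤ (3 ^ s * s) * ((2 ^ t) ^ 4 * (2 * ((t : ℝ) + V)) ^ (s + 3)) := by gcongr
    _ = _ := by ring

lemma NetD.expect_sub_mainD_sq_le (hx : NetD x t) (hs : 2 ≤ s) (htm : t ≤ m) (hV2 : 2 ≤ V)
    (hV : (m + 1) ^ 2 ≤ 2 ^ V) (hi : i₁ ≠ i₀) :
    (𝔼 p, (discD x p - mainD x t V i₀ p) ^ 2) ≤ errD s m t V * ((m : ℝ) + 1) ^ (s - 1) := by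
  have hsub : slabPos m t V i₀ ⊆ boxI s m := fun A hA => mem_boxI.2 (mem_slabPos.1 hA).1.1
  have hb1 : (1 : ℝ) ≤ 2 ^ t := one_le_pow₀ one_le_two
  have h1 : ∀ p, discD x p - mainD x t V i₀ p =
      chaos (boxI s m \ slabPos m t V i₀) (fun A => coefD x A p.1) p.2 := by
    intro p
    unfold discD mainD chaos
    rw [← Finset.sum_sdiff hsub]
    ring
  simp_rw [h1]
  rw [expect_prod_type]
  simp_rw [expect_chaos_sq fun A hA => mem_boxI.1 (Finset.mem_sdiff.1 hA).1]
  rw [Finset.expect_sum_comm]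
  have hQ : (0 : ℝ) < (m : ℝ) + 1 := by positivity
  have h2 : ∀ A ∈ boxI s m \ slabPos m t V i₀, (𝔼 u, coefD x A u ^ 2) ≤
      2 ^ t / ((m : ℝ) + 1) ^ 2 + if A ∈ slice (slab s m t V) i₀ 0 then (2 ^ t) ^ 2 else 0 := by
    intro A hA
    obtain ⟨hA1, hA2⟩ := Finset.mem_sdiff.1 hA
    rw [mem_boxI] at hA1
    have hle : (𝔼 u, coefD x A u ^ 2) ≤ 𝔼 u, lamD x A u ^ 2 :=
      Finset.expect_le_expect fun u _ => coefD_sq_le u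
    refine hle.trans ?_
    rcases le_or_gt (a0F A + t) m with h | h
    · simp_rw [hx.lamD_eq_zero (by omega) hA1 h]
      simp only [ne_eq, OfNat.ofNat_ne_zero, not_false_eq_true, zero_pow, Finset.expect_const_zero]
      positivity
    rcases le_or_gt (m + V) (a0F A) with h' | h'
    · refine (hx.expect_sq_lamD_le htm hA1 h.le).trans ((le_add_of_nonneg_right (by positivity)).trans'
        ?_)
      rw [div_eq_mul_inv ((2 : ℝ) ^ t)]
      refine mul_le_mul_of_nonneg_left ?_ (by positivity)
      have e1 : ((m : ℝ) + 1) ^ 2 ≤ 2 ^ V := by exact_mod_cast hV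
      rw [div_le_iff₀ (by positivity), inv_mul_eq_div, le_div_iff₀ (by positivity)]
      calc (2 : ℝ) ^ m * ((m : ℝ) + 1) ^ 2 ≤ 2 ^ m * 2 ^ V := by gcongr
        _ = 2 ^ (m + V) := (pow_add _ _ _).symm
        _ ≤ 2 ^ a0F A := pow_le_pow_right₀ one_le_two h'
    · have hm : A ∈ slab s m t V := mem_slab.2 ⟨hA1, h, h'⟩
      have h0 : A i₀ = 0 := by
        by_contra hne
        exact hA2 (Finset.mem_filter.2 ⟨hm, by omega⟩)
      have hmem : A ∈ slice (slab s m t V) i₀ 0 := Finset.mem_filter.2 ⟨hm, h0⟩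
      rw [if_pos hmem]
      refine (le_add_of_nonneg_left (by positivity)).trans' ?_
      refine Finset.expect_le Finset.univ_nonempty fun u _ => ?_
      exact sq_le_sq.2 ((hx.abs_lamD_le htm h.le u).trans (le_abs_self _))
  have hcard : ((boxI s m).card : ℝ) = ((m : ℝ) + 1) ^ (s - 2) * ((m : ℝ) + 1) ^ 2 := by
    rw [← pow_add, Nat.sub_add_cancel hs]
    simp [boxI]
  have hslice : ((slice (slab s m t V) i₀ 0).card : ℝ) ≤ ((m : ℝ) + 1) ^ (s - 2) * (t + V) := by
    exact_mod_cast card_slice_slab_le hi 0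
  have hK : (1 : ℝ) ≤ (t : ℝ) + V := by
    have : (2 : ℝ) ≤ V := by exact_mod_cast hV2
    have := Nat.cast_nonneg (α := ℝ) t
    linarith
  calc _ ≤ ∑ A ∈ boxI s m \ slabPos m t V i₀, (2 ^ t / ((m : ℝ) + 1) ^ 2 +
        if A ∈ slice (slab s m t V) i₀ 0 then ((2 : ℝ) ^ t) ^ 2 else 0) := Finset.sum_le_sum h2
    _ ≤ ∑ A ∈ boxI s m, (2 ^ t / ((m : ℝ) + 1) ^ 2 +
        if A ∈ slice (slab s m t V) i₀ 0 then ((2 : ℝ) ^ t) ^ 2 else 0) :=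
      Finset.sum_le_sum_of_subset_of_nonneg Finset.sdiff_subset fun A _ _ => by positivity
    _ ≤ ((m : ℝ) + 1) ^ (s - 2) * 2 ^ t + ((m : ℝ) + 1) ^ (s - 2) * (t + V) * (2 ^ t) ^ 2 := by
        rw [Finset.sum_add_distrib, Finset.sum_const, nsmul_eq_mul, hcard, ← Finset.sum_filter,
          Finset.sum_const, nsmul_eq_mul]
        refine add_le_add (le_of_eq (by field_simp)) (mul_le_mul_of_nonneg_right ?_ (by positivity))
        refine le_trans ?_ hslice
        exact_mod_cast Finset.card_le_card fun A hA => (Finset.mem_filter.1 hA).2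
    _ ≤ (4 * ((2 ^ t) ^ 2 * ((t : ℝ) + V) ^ 1)) * ((m : ℝ) + 1) ^ (s - 2) := by
        have e1 : (2 : ℝ) ^ t ≤ (2 ^ t) ^ 2 * (t + V) := by
          calc (2 : ℝ) ^ t = 2 ^ t * 1 * 1 := by ring
            _ ≤ 2 ^ t * 2 ^ t * (t + V) := by gcongr
            _ = _ := by ring
        have e2 : (0 : ℝ) ≤ (2 ^ t) ^ 2 * ((t : ℝ) + V) := by positivity
        have e3 : (0 : ℝ) ≤ ((m : ℝ) + 1) ^ (s - 2) := by positivity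
        nlinarith [mul_le_mul_of_nonneg_left e1 e3, mul_nonneg e2 e3]
    _ ≤ _ := by
        rw [show s - 1 = (s - 2) + 1 by omega, errD_mul]
        exact mul_le_mul_of_nonneg_right (le_errD_aux hs hV2 (by omega) (by norm_num))
          (by positivity)

end DigitCore

section FourthMoment

variable {s m : ℕ} {x : (Fin m → ZMod 2) →+ DArr s m} {t V : ℕ} {i₀ i₁ : Fin s}

/-- The off-diagonal part of a squared chaos. -/
def offD (x : (Fin m → ZMod 2) →+ DArr s m) (𝒬 : Finset ((Fin s → ℕ) × (Fin s → ℕ)))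
    (p : DArr s m × DArr s m) : ℝ :=
  ∑ q ∈ 𝒬, coefD x q.1 p.1 * epsA q.1 p.2 * (coefD x q.2 p.1 * epsA q.2 p.2)

lemma mem_slabPairs {q : (Fin s → ℕ) × (Fin s → ℕ)} : q ∈ slabPairs m t V i₀ ↔
    (q.1 ∈ slabPos m t V i₀ ∧ q.2 ∈ slabPos m t V i₀ ∧ q.1 ≠ q.2) ∧ q.1 i₀ = q.2 i₀ := by
  rw [slabPairs, Finset.mem_filter, Finset.mem_offDiag]

lemma NetD.abs_coefD_le_of_mem (hx : NetD x t) (htm : t ≤ m) {A : Fin s → ℕ}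
    (hA : A ∈ slabPos m t V i₀) (u : DArr s m) : |coefD x A u| ≤ 2 ^ t :=
  hx.abs_coefD_le htm (mem_slabPos.1 hA).1.2.1.le u

lemma NetD.expect_offD_sq_le (hx : NetD x t) (htm : t ≤ m)
    {𝒬 : Finset ((Fin s → ℕ) × (Fin s → ℕ))} (h𝒬 : 𝒬 ⊆ slabPairs m t V i₀) :
    (𝔼 p, offD x 𝒬 p ^ 2) ≤
      (2 ^ t) ^ 4 * ((𝒬 ×ˢ 𝒬).filter fun q => Paired q.1.1 q.1.2 q.2.1 q.2.2).card := by
  rw [expect_prod_type]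
  refine Finset.expect_le Finset.univ_nonempty fun u _ => ?_
  refine expect_sq_sum_pairs_le (c := fun A => coefD x A u) 𝒬 (fun q hq i => ?_) (by positivity)
    fun q hq => ?_
  · have h := (mem_slabPairs.1 (h𝒬 hq)).1
    exact ⟨(mem_slabPos.1 h.1).1.1 i, (mem_slabPos.1 h.2.1).1.1 i⟩
  · have h := (mem_slabPairs.1 (h𝒬 hq)).1
    exact ⟨hx.abs_coefD_le_of_mem htm h.1 u, hx.abs_coefD_le_of_mem htm h.2.1 u⟩

lemma paired_bound (hs : 2 ≤ s) :
    ((2 : ℝ) ^ t) ^ 4 * ((slabPairs m t V i₀ ×ˢ slabPairs m t V i₀).filter fun q =>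
      Paired q.1.1 q.1.2 q.2.1 q.2.2).card ≤ errD s m t V * (((m : ℝ) + 1) ^ (s - 1)) ^ 2 := by
  have h1 : (((slabPairs m t V i₀ ×ˢ slabPairs m t V i₀).filter fun q =>
      Paired q.1.1 q.1.2 q.2.1 q.2.2).card : ℝ) ≤
      3 ^ s * s * (((m : ℝ) + 1) ^ (s - 1) * ((m : ℝ) + 1) ^ (s - 2) *
        (((t : ℝ) + V) * (t + V) * (t + V))) := by
    exact_mod_cast card_paired_le
  rcases Nat.eq_zero_or_pos (t + V) with h0 | hpos
  · have h2 : (t : ℝ) + V = 0 := by exact_mod_cast h0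
    rw [h2] at h1
    simp only [mul_zero] at h1
    refine (mul_nonpos_of_nonneg_of_nonpos (by positivity) h1).trans ?_
    have := errD_nonneg s m t V
    positivity
  have hK : (1 : ℝ) ≤ (t : ℝ) + V := by exact_mod_cast hpos
  rw [← pow_mul ((m : ℝ) + 1) (s - 1) 2, show (s - 1) * 2 = ((s - 1) + (s - 2)) + 1 by omega, errD_mul, pow_add]
  have h3 : ((t : ℝ) + V) * (t + V) * (t + V) ≤ (2 * ((t : ℝ) + V)) ^ (s + 3) := by
    calc ((t : ℝ) + V) * (t + V) * (t + V) = (t + V) ^ 3 := by ring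
      _ ≤ (t + V) ^ (s + 3) := pow_le_pow_right₀ hK (by omega)
      _ ≤ _ := pow_le_pow_left₀ (by linarith) (by linarith) _
  calc _ ≤ ((2 : ℝ) ^ t) ^ 4 * (3 ^ s * s * (((m : ℝ) + 1) ^ (s - 1) * ((m : ℝ) + 1) ^ (s - 2) *
        (((t : ℝ) + V) * (t + V) * (t + V)))) := by gcongr
    _ ≤ ((2 : ℝ) ^ t) ^ 4 * (3 ^ s * s * (((m : ℝ) + 1) ^ (s - 1) * ((m : ℝ) + 1) ^ (s - 2) *
        (2 * ((t : ℝ) + V)) ^ (s + 3))) := by gcongr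
    _ = _ := by ring

lemma offDiag_slice_subset (j : Fin m) :
    (slice (slabPos m t V i₀) i₀ ((j : ℕ) + 1)).offDiag ⊆ slabPairs m t V i₀ := by
  intro q hq
  obtain ⟨h1, h2, h3⟩ := Finset.mem_offDiag.1 hq
  obtain ⟨h4, h5⟩ := Finset.mem_filter.1 h1
  obtain ⟨h6, h7⟩ := Finset.mem_filter.1 h2
  exact mem_slabPairs.2 ⟨⟨h4, h6, h3⟩, h5.trans h7.symm⟩

lemma sliceD_sq (j : Fin m) (p : DArr s m × DArr s m) : sliceD x t V i₀ j p ^ 2 =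
    (∑ A ∈ slice (slabPos m t V i₀) i₀ ((j : ℕ) + 1), coefD x A p.1 ^ 2) +
      offD x (slice (slabPos m t V i₀) i₀ ((j : ℕ) + 1)).offDiag p :=
  chaos_sq_eq p.2

lemma mem_slabPos_range {A : Fin s → ℕ} (hA : A ∈ slabPos m t V i₀) : 1 ≤ A i₀ ∧ A i₀ ≤ m :=
  ⟨(mem_slabPos.1 hA).2, (mem_slabPos.1 hA).1.1 i₀⟩

lemma sum_sliceD_sq (p : DArr s m × DArr s m) : ∑ j, sliceD x t V i₀ j p ^ 2 =
    (∑ A ∈ slabPos m t V i₀, coefD x A p.1 ^ 2) + offD x (slabPairs m t V i₀) p := by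
  simp_rw [sliceD_sq]
  rw [Finset.sum_add_distrib, sum_slice_sq i₀ fun A hA => mem_slabPos_range hA]
  congr 1
  unfold offD
  rw [← Finset.sum_biUnion]
  · refine Finset.sum_congr ?_ fun _ _ => rfl
    ext q
    rw [Finset.mem_biUnion]
    constructor
    · rintro ⟨j, -, hq⟩
      exact offDiag_slice_subset j hq
    · intro hq
      obtain ⟨⟨h1, h2, h3⟩, h4⟩ := mem_slabPairs.1 hq
      have h5 := mem_slabPos_range h1
      refine ⟨⟨q.1 i₀ - 1, by omega⟩, Finset.mem_univ _, Finset.mem_offDiag.2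
        ⟨Finset.mem_filter.2 ⟨h1, ?_⟩, Finset.mem_filter.2 ⟨h2, ?_⟩, h3⟩⟩
      · simp; omega
      · simp; omega
  · intro j _ k _ hjk
    refine Finset.disjoint_left.2 fun q hq hq' => hjk ?_
    have h1 := (Finset.mem_filter.1 (Finset.mem_offDiag.1 hq).1).2
    have h2 := (Finset.mem_filter.1 (Finset.mem_offDiag.1 hq').1).2
    exact Fin.ext (by omega)

lemma NetD.sum_expect_offD_sq_le (hx : NetD x t) (hs : 2 ≤ s) (htm : t ≤ m) :
    ∑ j : Fin m, (𝔼 p, offD x (slice (slabPos m t V i₀) i₀ ((j : ℕ) + 1)).offDiag p ^ 2) ≤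
      errD s m t V * (((m : ℝ) + 1) ^ (s - 1)) ^ 2 := by
  refine le_trans ?_ (paired_bound (i₀ := i₀) hs)
  refine (Finset.sum_le_sum fun j _ => hx.expect_offD_sq_le htm (offDiag_slice_subset j)).trans ?_
  rw [← Finset.mul_sum]
  refine mul_le_mul_of_nonneg_left ?_ (by positivity)
  rw [← Nat.cast_sum, ← Finset.card_biUnion]
  · refine Nat.cast_le.2 (Finset.card_le_card fun q hq => ?_)
    obtain ⟨j, -, hj⟩ := Finset.mem_biUnion.1 hq
    obtain ⟨h1, h2⟩ := Finset.mem_filter.1 hj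
    obtain ⟨h3, h4⟩ := Finset.mem_product.1 h1
    exact Finset.mem_filter.2 ⟨Finset.mem_product.2
      ⟨offDiag_slice_subset j h3, offDiag_slice_subset j h4⟩, h2⟩
  · intro j _ k _ hjk
    refine Finset.disjoint_left.2 fun q hq hq' => hjk ?_
    have h1 := (Finset.mem_filter.1 (Finset.mem_offDiag.1
      (Finset.mem_product.1 (Finset.mem_filter.1 hq).1).1).1).2
    have h2 := (Finset.mem_filter.1 (Finset.mem_offDiag.1
      (Finset.mem_product.1 (Finset.mem_filter.1 hq').1).1).1).2
    exact Fin.ext (by omega)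

lemma NetD.sum_expect_sliceD_pow_le (hx : NetD x t) (hs : 2 ≤ s) (htm : t ≤ m) (hV : 2 ≤ V)
    (hi : i₁ ≠ i₀) : (𝔼 p, ∑ j, sliceD x t V i₀ j p ^ 4) ≤
      4 * (errD s m t V * (((m : ℝ) + 1) ^ (s - 1)) ^ 2) := by
  set D : ℝ := (2 ^ t) ^ 2 * (((m : ℝ) + 1) ^ (s - 2) * (t + V)) with hD
  have h1 : ∀ j p, sliceD x t V i₀ j p ^ 4 ≤ 2 * D ^ 2 +
      2 * offD x (slice (slabPos m t V i₀) i₀ ((j : ℕ) + 1)).offDiag p ^ 2 := by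
    intro j p
    have e1 : (∑ A ∈ slice (slabPos m t V i₀) i₀ ((j : ℕ) + 1), coefD x A p.1 ^ 2) ≤ D := by
      refine (Finset.sum_le_sum (g := fun _ => ((2 : ℝ) ^ t) ^ 2) fun A hA => ?_).trans ?_
      · exact sq_le_sq.2 ((hx.abs_coefD_le_of_mem htm (Finset.mem_filter.1 hA).1 _).trans
          (le_abs_self _))
      · rw [Finset.sum_const, nsmul_eq_mul, mul_comm, hD]
        refine mul_le_mul_of_nonneg_left ?_ (by positivity)
        have e2 : (slice (slabPos m t V i₀) i₀ ((j : ℕ) + 1)).card ≤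
            (m + 1) ^ (s - 2) * (t + V) :=
          (Finset.card_le_card (Finset.filter_subset_filter _ (Finset.filter_subset _ _))).trans
            (card_slice_slab_le hi _)
        exact_mod_cast e2
    have e0 : (0 : ℝ) ≤ ∑ A ∈ slice (slabPos m t V i₀) i₀ ((j : ℕ) + 1), coefD x A p.1 ^ 2 :=
      Finset.sum_nonneg fun A _ => sq_nonneg _
    rw [show sliceD x t V i₀ j p ^ 4 = (sliceD x t V i₀ j p ^ 2) ^ 2 by ring, sliceD_sq]
    generalize offD x (slice (slabPos m t V i₀) i₀ ((j : ℕ) + 1)).offDiag p = o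
    generalize (∑ A ∈ slice (slabPos m t V i₀) i₀ ((j : ℕ) + 1), coefD x A p.1 ^ 2) = d at e0 e1
    nlinarith [sq_nonneg (d - o), mul_nonneg e0 (sub_nonneg.2 e1)]
  have h2 : (m : ℝ) * (2 * D ^ 2) ≤ 2 * (errD s m t V * (((m : ℝ) + 1) ^ (s - 1)) ^ 2) := by
    have e1 := le_errD_aux (t := t) (V := V) hs hV (k := 2) (by omega) (n := 4) le_rfl
    rw [← pow_mul ((m : ℝ) + 1) (s - 1) 2, show (s - 1) * 2 = ((s - 2) * 2 + 1) + 1 by omega, errD_mul, pow_succ ((m : ℝ) + 1) ((s - 2) * 2)]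
    have e2 : (0 : ℝ) ≤ ((m : ℝ) + 1) ^ ((s - 2) * 2) := by positivity
    have e3 : D ^ 2 = ((2 ^ t) ^ 4 * ((t : ℝ) + V) ^ 2) * ((m : ℝ) + 1) ^ ((s - 2) * 2) := by
      rw [hD, pow_mul]; ring
    rw [e3]
    have e4 : (0 : ℝ) ≤ (2 ^ t) ^ 4 * ((t : ℝ) + V) ^ 2 := by positivity
    have e5 : (0 : ℝ) ≤ m := Nat.cast_nonneg m
    generalize ((m : ℝ) + 1) ^ ((s - 2) * 2) = q at *
    generalize ((2 : ℝ) ^ t) ^ 4 * ((t : ℝ) + V) ^ 2 = r at *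
    generalize ((2 : ℝ) ^ t) ^ 4 * (2 * ((t : ℝ) + V)) ^ (s + 3) * (3 ^ s * s) = E at *
    calc (m : ℝ) * (2 * (r * q)) = 2 * (r * (q * m)) := by ring
      _ ≤ 2 * (E * (q * (m + 1))) := by gcongr <;> linarith
  rw [Finset.expect_sum_comm]
  calc _ ≤ ∑ j : Fin m, (2 * D ^ 2 +
        2 * 𝔼 p, offD x (slice (slabPos m t V i₀) i₀ ((j : ℕ) + 1)).offDiag p ^ 2) := by
        refine Finset.sum_le_sum fun j _ => ?_
        refine (Finset.expect_le_expect fun p _ => h1 j p).trans (le_of_eq ?_)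
        rw [Finset.expect_add_distrib, Fintype.expect_const, ← Finset.mul_expect]
    _ = m * (2 * D ^ 2) +
        2 * ∑ j : Fin m, 𝔼 p, offD x (slice (slabPos m t V i₀) i₀ ((j : ℕ) + 1)).offDiag p ^ 2 := by
        rw [Finset.sum_add_distrib, Finset.sum_const, Finset.mul_sum]
        simp
    _ ≤ _ := by
        have := hx.sum_expect_offD_sq_le (V := V) (i₀ := i₀) hs htm
        linarith

lemma NetD.expect_diag_sub_sq_le (hx : NetD x t) (hs : 2 ≤ s) (htm : t ≤ m) (hV : 2 ≤ V) :
    (𝔼 u, ((∑ A ∈ slabPos m t V i₀, coefD x A u ^ 2) - varD x t V i₀) ^ 2) ≤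
      errD s m t V * (((m : ℝ) + 1) ^ (s - 1)) ^ 2 := by
  have hinv : ∀ A u v, coefD x A (u + x v) ^ 2 = coefD x A u ^ 2 := fun A u v => by
    rw [coefD, lamD_add_net, coefD]
  have hzero : ∀ A, ∀ u h : DArr s m, (∀ i, ∀ j : Fin m, (j : ℕ) < A i → h i j = 0) →
      coefD x A (u + h) ^ 2 = coefD x A u ^ 2 := fun A u h hh => by
    rw [coefD, lamD_add_of_zero x A u h hh, coefD]
  have h1 : (𝔼 u, ((∑ A ∈ slabPos m t V i₀, coefD x A u ^ 2) - varD x t V i₀) ^ 2) =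
      ∑ q ∈ slabPos m t V i₀ ×ˢ slabPos m t V i₀, ((𝔼 u, coefD x q.1 u ^ 2 * coefD x q.2 u ^ 2) -
        (𝔼 u, coefD x q.1 u ^ 2) * 𝔼 u, coefD x q.2 u ^ 2) := by
    have e1 : ∀ u, ((∑ A ∈ slabPos m t V i₀, coefD x A u ^ 2) - varD x t V i₀) ^ 2 =
        (∑ A ∈ slabPos m t V i₀, coefD x A u ^ 2) ^ 2 -
          2 * varD x t V i₀ * (∑ A ∈ slabPos m t V i₀, coefD x A u ^ 2) + varD x t V i₀ ^ 2 :=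
      fun u => by ring
    have e2 : (𝔼 u, ∑ A ∈ slabPos m t V i₀, coefD x A u ^ 2) = varD x t V i₀ := by
      rw [Finset.expect_sum_comm, varD]
    have e3 : (𝔼 u, (∑ A ∈ slabPos m t V i₀, coefD x A u ^ 2) ^ 2) =
        ∑ q ∈ slabPos m t V i₀ ×ˢ slabPos m t V i₀,
          𝔼 u, coefD x q.1 u ^ 2 * coefD x q.2 u ^ 2 := by
      rw [← Finset.expect_sum_comm]
      refine Finset.expect_congr rfl fun u _ => ?_
      rw [sq, Finset.sum_mul_sum, Finset.sum_product]
    have e4 : (∑ q ∈ slabPos m t V i₀ ×ˢ slabPos m t V i₀,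
        (𝔼 u, coefD x q.1 u ^ 2) * 𝔼 u, coefD x q.2 u ^ 2) = varD x t V i₀ ^ 2 := by
      rw [Finset.sum_product, sq, varD, Finset.sum_mul_sum]
    rw [Finset.sum_sub_distrib, e4, ← e3]
    simp_rw [e1]
    rw [Finset.expect_add_distrib, Finset.expect_sub_distrib, ← Finset.mul_expect, e2,
      Fintype.expect_const]
    ring
  rw [h1]
  have h2 : ∀ q ∈ slabPos m t V i₀ ×ˢ slabPos m t V i₀,
      ((𝔼 u, coefD x q.1 u ^ 2 * coefD x q.2 u ^ 2) -
        (𝔼 u, coefD x q.1 u ^ 2) * 𝔼 u, coefD x q.2 u ^ 2) ≤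
      if m < (∑ i, min (q.1 i) (q.2 i)) + t then ((2 : ℝ) ^ t) ^ 4 else 0 := by
    intro q hq
    obtain ⟨hq1, hq2⟩ := Finset.mem_product.1 hq
    split_ifs with h
    · refine (sub_le_self _ (mul_nonneg (Finset.expect_nonneg fun _ _ => sq_nonneg _)
        (Finset.expect_nonneg fun _ _ => sq_nonneg _))).trans ?_
      refine Finset.expect_le Finset.univ_nonempty fun u _ => ?_
      rw [show ((2 : ℝ) ^ t) ^ 4 = (2 ^ t) ^ 2 * (2 ^ t) ^ 2 by ring]
      gcongr ?_ * ?_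
      · exact sq_le_sq.2 ((hx.abs_coefD_le_of_mem htm hq1 _).trans (le_abs_self _))
      · exact sq_le_sq.2 ((hx.abs_coefD_le_of_mem htm hq2 _).trans (le_abs_self _))
    · rw [hx.expect_mul (by omega) (not_lt.1 h) (hinv q.2) (hzero q.1) (hzero q.2), sub_self]
  refine (Finset.sum_le_sum h2).trans ?_
  rw [← Finset.sum_filter, Finset.sum_const, nsmul_eq_mul]
  have h3 : ((((slabPos m t V i₀ ×ˢ slabPos m t V i₀).filter fun p =>
      m < (∑ i, min (p.1 i) (p.2 i)) + t).card : ℕ) : ℝ) ≤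
      ((m : ℝ) + 1) ^ (s - 1) * (t + V) * (2 * (t + V)) ^ s := by
    exact_mod_cast card_correlated_le (by omega)
  have hK : (1 : ℝ) ≤ (t : ℝ) + V := by
    have : (2 : ℝ) ≤ V := by exact_mod_cast hV
    have := Nat.cast_nonneg (α := ℝ) t
    linarith
  have h4 : ((t : ℝ) + V) * (2 * (t + V)) ^ s ≤ (2 * (t + V)) ^ (s + 3) := by
    calc ((t : ℝ) + V) * (2 * (t + V)) ^ s ≤ (2 * (t + V)) * (2 * (t + V)) ^ s := by
          gcongr; linarith
      _ = (2 * (t + V)) ^ (s + 1) := by ring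
      _ ≤ _ := pow_le_pow_right₀ (by linarith) (by omega)
  have h5 : (1 : ℝ) ≤ 3 ^ s * s := by
    have e1 : (1 : ℝ) ≤ 3 ^ s := one_le_pow₀ (by norm_num)
    have e2 : (2 : ℝ) ≤ s := by exact_mod_cast hs
    nlinarith
  have h6 : ((m : ℝ) + 1) ^ (s - 1) ≤ ((m : ℝ) + 1) ^ ((s - 1) + (s - 2)) :=
    pow_le_pow_right₀ (by linarith [Nat.cast_nonneg (α := ℝ) m]) (by omega)
  rw [← pow_mul ((m : ℝ) + 1) (s - 1) 2, show (s - 1) * 2 = ((s - 1) + (s - 2)) + 1 by omega, errD_mul]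
  calc _ ≤ ((m : ℝ) + 1) ^ (s - 1) * (t + V) * (2 * (t + V)) ^ s * ((2 : ℝ) ^ t) ^ 4 := by gcongr
    _ = ((2 : ℝ) ^ t) ^ 4 * (((t : ℝ) + V) * (2 * (t + V)) ^ s) * 1 * ((m : ℝ) + 1) ^ (s - 1) := by
      ring
    _ ≤ _ := by gcongr

lemma NetD.expect_abs_sum_sliceD_sq_sub_le (hx : NetD x t) (hs : 2 ≤ s) (htm : t ≤ m)
    (hV : 2 ≤ V) : (𝔼 p, |∑ j, sliceD x t V i₀ j p ^ 2 - varD x t V i₀|) ≤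
      2 * (Real.sqrt (errD s m t V) * ((m : ℝ) + 1) ^ (s - 1)) := by
  have hsq : Real.sqrt (errD s m t V * (((m : ℝ) + 1) ^ (s - 1)) ^ 2) =
      Real.sqrt (errD s m t V) * ((m : ℝ) + 1) ^ (s - 1) := by
    rw [Real.sqrt_mul (errD_nonneg _ _ _ _), Real.sqrt_sq (by positivity)]
  have h1 : (𝔼 p, |offD x (slabPairs m t V i₀) p|) ≤
      Real.sqrt (errD s m t V) * ((m : ℝ) + 1) ^ (s - 1) := by
    rw [← hsq]
    exact (expect_abs_le_sqrt _).trans (Real.sqrt_le_sqrt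
      ((hx.expect_offD_sq_le htm subset_rfl).trans (paired_bound hs)))
  have h2 : (𝔼 u, |(∑ A ∈ slabPos m t V i₀, coefD x A u ^ 2) - varD x t V i₀|) ≤
      Real.sqrt (errD s m t V) * ((m : ℝ) + 1) ^ (s - 1) := by
    rw [← hsq]
    exact (expect_abs_le_sqrt _).trans (Real.sqrt_le_sqrt (hx.expect_diag_sub_sq_le hs htm hV))
  have h3 : (𝔼 p : DArr s m × DArr s m,
      |(∑ A ∈ slabPos m t V i₀, coefD x A p.1 ^ 2) - varD x t V i₀|) =
      𝔼 u, |(∑ A ∈ slabPos m t V i₀, coefD x A u ^ 2) - varD x t V i₀| := by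
    rw [expect_prod_type]
    simp_rw [Fintype.expect_const]
  calc _ ≤ 𝔼 p : DArr s m × DArr s m,
        (|(∑ A ∈ slabPos m t V i₀, coefD x A p.1 ^ 2) - varD x t V i₀| +
          |offD x (slabPairs m t V i₀) p|) := by
        refine Finset.expect_le_expect fun p _ => ?_
        rw [sum_sliceD_sq, add_sub_right_comm]
        exact abs_add_le _ _
    _ ≤ _ := by
        rw [Finset.expect_add_distrib, h3]
        linarith

lemma ofReal_expect {α : Type*} [Fintype α] (f : α → ℝ) :
    ((𝔼 a, f a : ℝ) : ℂ) = 𝔼 a, (f a : ℂ) := by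
  rw [Fintype.expect_eq_sum_div_card, Fintype.expect_eq_sum_div_card]
  push_cast
  rfl

/-- The characteristic function of the main part. -/
lemma NetD.charFun_mainD (hx : NetD x t) (hs : 2 ≤ s) (htm : t ≤ m) (hV : 2 ≤ V) (hi : i₁ ≠ i₀)
    {M : ℝ} (hM : 0 < M) (θ : ℝ) :
    ‖(𝔼 p, Complex.exp (((θ / M * mainD x t V i₀ p : ℝ) : ℂ) * Complex.I)) -
      Complex.exp (-((θ : ℂ) ^ 2 / 2))‖ ≤
      8 * θ ^ 4 * (errD s m t V * (((m : ℝ) + 1) ^ (s - 1)) ^ 2) / M ^ 4 +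
        θ ^ 2 / 2 * ((2 * (Real.sqrt (errD s m t V) * ((m : ℝ) + 1) ^ (s - 1)) +
          |varD x t V i₀ - M ^ 2|) / M ^ 2) := by
  have h1 : (𝔼 p, Complex.exp (((θ / M * mainD x t V i₀ p : ℝ) : ℂ) * Complex.I)) =
      ((𝔼 p, ∏ j, Real.cos (θ * (sliceD x t V i₀ j p / M)) : ℝ) : ℂ) := by
    rw [expect_prod_type]
    unfold mainD
    simp_rw [expect_exp_chaos fun A (hA : A ∈ slabPos m t V i₀) => mem_slabPos_range hA]
    rw [expect_prod_type, ofReal_expect]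
    refine Finset.expect_congr rfl fun u _ => ?_
    congr 1
    refine Finset.expect_congr rfl fun y _ => ?_
    refine Finset.prod_congr rfl fun j _ => ?_
    unfold sliceD
    rw [div_mul_eq_mul_div, mul_div_assoc]
  have h2 : Complex.exp (-((θ : ℂ) ^ 2 / 2)) = ((Real.exp (-(θ ^ 2 / 2)) : ℝ) : ℂ) := by
    push_cast; rfl
  rw [h1, h2, ← Complex.ofReal_sub, Complex.norm_real, Real.norm_eq_abs]
  have h3 : (𝔼 p, ∏ j, Real.cos (θ * (sliceD x t V i₀ j p / M))) - Real.exp (-(θ ^ 2 / 2)) =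
      𝔼 p, (∏ j, Real.cos (θ * (sliceD x t V i₀ j p / M)) - Real.exp (-(θ ^ 2 / 2))) := by
    rw [Finset.expect_sub_distrib, Fintype.expect_const]
  rw [h3]
  refine (Finset.abs_expect_le _ _).trans ?_
  have h4 : ∀ p, |∏ j, Real.cos (θ * (sliceD x t V i₀ j p / M)) - Real.exp (-(θ ^ 2 / 2))| ≤
      2 * θ ^ 4 / M ^ 4 * ∑ j, sliceD x t V i₀ j p ^ 4 + θ ^ 2 / 2 / M ^ 2 *
        (|∑ j, sliceD x t V i₀ j p ^ 2 - varD x t V i₀| + |varD x t V i₀ - M ^ 2|) := by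
    intro p
    refine (abs_prod_cos_sub_exp_le Finset.univ _ θ).trans (add_le_add (le_of_eq ?_) ?_)
    · simp_rw [div_pow]
      rw [← Finset.sum_div]
      ring
    · simp_rw [div_pow]
      rw [← Finset.sum_div, div_sub_one (by positivity), abs_div,
        abs_of_pos (by positivity : 0 < M ^ 2), mul_div_assoc']
      have h5 := mul_le_mul_of_nonneg_left
        (abs_sub_le (∑ j, sliceD x t V i₀ j p ^ 2) (varD x t V i₀) (M ^ 2))
        (by positivity : 0 ≤ θ ^ 2 / 2 / M ^ 2)
      refine le_trans (le_of_eq ?_) h5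
      ring
  refine (Finset.expect_le_expect fun p _ => h4 p).trans ?_
  rw [Finset.expect_add_distrib, ← Finset.mul_expect, ← Finset.mul_expect,
    Finset.expect_add_distrib, Fintype.expect_const]
  have h5 := hx.sum_expect_sliceD_pow_le hs htm hV hi
  have h6 := hx.expect_abs_sum_sliceD_sq_sub_le (i₀ := i₀) hs htm hV
  calc _ ≤ 2 * θ ^ 4 / M ^ 4 * (4 * (errD s m t V * (((m : ℝ) + 1) ^ (s - 1)) ^ 2)) +
        θ ^ 2 / 2 / M ^ 2 * (2 * (Real.sqrt (errD s m t V) * ((m : ℝ) + 1) ^ (s - 1)) +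
          |varD x t V i₀ - M ^ 2|) := by gcongr
    _ = _ := by ring

end FourthMoment

section BinaryExpansion

/-- The real number with a given sequence of binary digits. -/
def dval (b : ℕ → ZMod 2) : ℝ := ∑' j : ℕ, ((b j).val : ℝ) / 2 ^ (j + 1)

/-- The natural number formed by the first binary digits. -/
def dhead : ℕ → (ℕ → ZMod 2) → ℕ
  | 0, _ => 0
  | d + 1, b => 2 * dhead d b + (b d).val

/-- The sequence of binary digits of a real number in `[0,1)`. -/
def digs (x : ℝ) (j : ℕ) : ZMod 2 := (bdigit (j + 1) x : ZMod 2)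

lemma zmod_two_cases (a : ZMod 2) : a = 0 ∨ a = 1 := by
  revert a; decide

lemma val_le_one (a : ZMod 2) : a.val ≤ 1 := Nat.lt_succ_iff.1 (ZMod.val_lt a)

lemma val_one_two : (1 : ZMod 2).val = 1 := rfl

lemma summable_half : Summable fun j : ℕ => (1 : ℝ) / 2 ^ (j + 1) := by
  have h := summable_geometric_two' (1 : ℝ)
  refine h.congr fun j => ?_
  rw [pow_succ]; field_simp

lemma tsum_half : (∑' j : ℕ, (1 : ℝ) / 2 ^ (j + 1)) = 1 := by
  refine (tsum_congr fun j => ?_).trans (tsum_geometric_two' (1 : ℝ))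
  rw [pow_succ]; field_simp

lemma dval_term_le (b : ℕ → ZMod 2) (j : ℕ) : ((b j).val : ℝ) / 2 ^ (j + 1) ≤ 1 / 2 ^ (j + 1) := by
  gcongr
  exact_mod_cast val_le_one (b j)

lemma summable_dval (b : ℕ → ZMod 2) : Summable fun j : ℕ => ((b j).val : ℝ) / 2 ^ (j + 1) :=
  summable_half.of_nonneg_of_le (fun j => by positivity) (dval_term_le b)

lemma dval_nonneg (b : ℕ → ZMod 2) : 0 ≤ dval b := tsum_nonneg fun j => by positivity

lemma dval_lt_one {b : ℕ → ZMod 2} {j : ℕ} (h : b j = 0) : dval b < 1 := by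
  rw [← tsum_half]
  refine (summable_dval b).tsum_lt_tsum (i := j) (dval_term_le b) ?_ summable_half
  rw [h]; simp

lemma dval_eq_one {b : ℕ → ZMod 2} (h : ∀ j, b j = 1) : dval b = 1 := by
  rw [← tsum_half]
  unfold dval
  simp [h, val_one_two]

lemma dval_mul_two (b : ℕ → ZMod 2) : dval b * 2 = (b 0).val + dval fun j => b (j + 1) := by
  unfold dval
  rw [(summable_dval b).tsum_eq_zero_add, add_mul, ← tsum_mul_right]
  congr 1
  · simp
  · refine tsum_congr fun j => ?_
    rw [pow_succ 2 (j + 1)]; field_simp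

lemma dval_mul_pow (b : ℕ → ZMod 2) (d : ℕ) :
    dval b * 2 ^ d = dhead d b + dval fun j => b (j + d) := by
  induction d with
  | zero => simp [dhead]
  | succ d ih =>
    rw [pow_succ, ← mul_assoc, ih, add_mul, dval_mul_two]
    simp only [dhead, Nat.zero_add, Nat.cast_add, Nat.cast_mul, Nat.cast_ofNat]
    simp_rw [show ∀ j, j + 1 + d = j + (d + 1) from fun j => by ring]
    ring

lemma dhead_lt (b : ℕ → ZMod 2) (d : ℕ) : dhead d b < 2 ^ d := by
  induction d with
  | zero => simp [dhead]
  | succ d ih =>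
    have := val_le_one (b d)
    rw [dhead, pow_succ]
    omega

lemma dhead_eq_iff {b c : ℕ → ZMod 2} {d : ℕ} :
    dhead d b = dhead d c ↔ ∀ j < d, b j = c j := by
  induction d with
  | zero => simp [dhead]
  | succ d ih =>
    have h1 := val_le_one (b d)
    have h2 := val_le_one (c d)
    rw [Nat.forall_lt_succ_right, ← ih, ← (ZMod.val_injective 2).eq_iff]
    simp only [dhead]
    omega

lemma dhead_congr {b c : ℕ → ZMod 2} {d : ℕ} (h : ∀ j < d, b j = c j) : dhead d b = dhead d c :=
  dhead_eq_iff.2 h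

lemma dhead_zero_fun (d : ℕ) : dhead d 0 = 0 := by
  induction d with
  | zero => rfl
  | succ d ih => simp [dhead, ih]

lemma floor_dval_of_exists {b : ℕ → ZMod 2} {d : ℕ} (h : ∃ j, d ≤ j ∧ b j = 0) :
    ⌊dval b * 2 ^ d⌋₊ = dhead d b := by
  obtain ⟨j, hj, hb⟩ := h
  have h1 : dval (fun k => b (k + d)) < 1 :=
    dval_lt_one (j := j - d) (by simpa [Nat.sub_add_cancel hj] using hb)
  have h2 := dval_nonneg fun k => b (k + d)
  rw [dval_mul_pow, Nat.floor_eq_iff (by positivity)]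
  constructor <;> linarith

lemma floor_dval_of_forall {b : ℕ → ZMod 2} {d : ℕ} (h : ∀ j, d ≤ j → b j = 1) :
    ⌊dval b * 2 ^ d⌋₊ = dhead d b + 1 := by
  rw [dval_mul_pow, dval_eq_one fun j => h _ (Nat.le_add_left _ _)]
  exact_mod_cast Nat.floor_natCast (dhead d b + 1)

lemma floor_mul_pow_succ_div {x : ℝ} (d : ℕ) : ⌊x * 2 ^ (d + 1)⌋₊ / 2 = ⌊x * 2 ^ d⌋₊ := by
  have h := Nat.floor_div_natCast (x * 2 ^ (d + 1)) 2
  rw [← h]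
  congr 1
  rw [pow_succ]
  push_cast
  ring

lemma digs_val (x : ℝ) (j : ℕ) : (digs x j).val = ⌊x * 2 ^ (j + 1)⌋₊ % 2 := by
  rw [digs, ZMod.val_natCast, bdigit, Nat.mod_mod, Int.floor_toNat]

lemma bdigit_eq_val (x : ℝ) (j : ℕ) : bdigit (j + 1) x = (digs x j).val := by
  rw [digs_val, bdigit, Int.floor_toNat]

lemma dhead_digs {x : ℝ} (hx : x ∈ Set.Ico (0 : ℝ) 1) (d : ℕ) :
    dhead d (digs x) = ⌊x * 2 ^ d⌋₊ := by
  induction d with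
  | zero =>
    rw [dhead, pow_zero, mul_one]
    exact (Nat.floor_eq_zero.2 hx.2).symm
  | succ d ih =>
    have := floor_mul_pow_succ_div (x := x) d
    rw [dhead, ih, digs_val]
    omega

lemma digs_dval {b : ℕ → ZMod 2} (h : ∀ d, ∃ j, d ≤ j ∧ b j = 0) : digs (dval b) = b := by
  funext j
  apply ZMod.val_injective 2
  rw [digs_val, floor_dval_of_exists (h _), dhead]
  have := val_le_one (b j)
  omega

lemma dval_mem_Ico {b : ℕ → ZMod 2} (h : ∃ j, b j = 0) : dval b ∈ Set.Ico (0 : ℝ) 1 :=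
  ⟨dval_nonneg b, dval_lt_one h.choose_spec⟩

lemma xorReal_eq_dval (x y : ℝ) : xorReal x y = dval (digs x + digs y) := by
  unfold xorReal dval
  refine tsum_congr fun j => ?_
  rw [Pi.add_apply, ZMod.val_add, bdigit_eq_val, bdigit_eq_val]

lemma lt_of_digs {x y : ℝ} (hx : x ∈ Set.Ico (0 : ℝ) 1) (hy : y ∈ Set.Ico (0 : ℝ) 1) {j : ℕ}
    (h : ∀ l < j, digs x l = digs y l) (hxj : digs x j = 0) (hyj : digs y j = 1) : x < y := by
  have h1 : ⌊x * 2 ^ (j + 1)⌋₊ < ⌊y * 2 ^ (j + 1)⌋₊ := by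
    rw [← dhead_digs hx, ← dhead_digs hy, dhead, dhead, dhead_congr h, hxj, hyj]
    simp [val_one_two]
  by_contra! hle
  exact absurd (Nat.floor_le_floor (mul_le_mul_of_nonneg_right hle (by positivity :
    (0 : ℝ) ≤ 2 ^ (j + 1)))) (not_le.2 h1)

/-- A finite vector of digits, extended by zero. -/
def extD {m : ℕ} (y : Fin m → ZMod 2) (j : ℕ) : ZMod 2 := if h : j < m then y ⟨j, h⟩ else 0

lemma extD_coe {m : ℕ} (y : Fin m → ZMod 2) (j : Fin m) : extD y j = y j := by
  simp [extD]

lemma digs_natCast_div {m : ℕ} (T : ℕ) {j : ℕ} (hj : m ≤ j) : digs ((T : ℝ) / 2 ^ m) j = 0 := by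
  apply ZMod.val_injective 2
  rw [digs_val, ZMod.val_zero, show (T : ℝ) / 2 ^ m * 2 ^ (j + 1) =
    ((T * 2 ^ (j - m) * 2 : ℕ) : ℝ) by
      rw [show j + 1 = m + (j - m) + 1 by omega, pow_succ, pow_add]
      push_cast
      field_simp, Nat.floor_natCast]
  exact Nat.mul_mod_left _ _

end BinaryExpansion

section NoAnomaly

variable {G : Type*} [AddCommGroup G] [Fintype G] {φ : ℕ → G →+ ZMod 2}

/-- The elements whose first digits vanish. -/
def headKer (φ : ℕ → G →+ ZMod 2) (d : ℕ) : Finset G :=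
  Finset.univ.filter fun v => ∀ j < d, φ j v = 0

/-- The elements whose first digits vanish and whose other digits are all `1`. -/
def headOnes (φ : ℕ → G →+ ZMod 2) (d : ℕ) : Finset G :=
  Finset.univ.filter fun v => (∀ j < d, φ j v = 0) ∧ ∀ j, d ≤ j → φ j v = 1

lemma dhead_eq_zero_iff {b : ℕ → ZMod 2} {d : ℕ} : dhead d b = 0 ↔ ∀ j < d, b j = 0 := by
  rw [← dhead_zero_fun d, dhead_eq_iff]
  rfl

lemma not_forall_one {b : ℕ → ZMod 2} {d : ℕ} (h : ¬ ∀ j, d ≤ j → b j = 1) :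
    ∃ j, d ≤ j ∧ b j = 0 := by
  push Not at h
  obtain ⟨j, h1, h2⟩ := h
  exact ⟨j, h1, (zmod_two_cases _).resolve_right h2⟩

lemma card_floor_zero_add (φ : ℕ → G →+ ZMod 2) (d : ℕ) :
    (Finset.univ.filter fun v => ⌊dval (fun j => φ j v) * 2 ^ d⌋₊ = 0).card + (headOnes φ d).card =
      (headKer φ d).card := by
  rw [← Finset.card_union_of_disjoint]
  · congr 1
    ext v
    simp only [headOnes, headKer, Finset.mem_union, Finset.mem_filter, Finset.mem_univ, true_and]
    by_cases h : ∀ j, d ≤ j → φ j v = 1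
    · rw [floor_dval_of_forall h]
      simpa using fun _ => h
    · rw [floor_dval_of_exists (b := fun j => φ j v) (not_forall_one h), dhead_eq_zero_iff]
      simp [h]
  · refine Finset.disjoint_left.2 fun v h1 h2 => ?_
    have h3 := (Finset.mem_filter.1 h1).2
    rw [floor_dval_of_forall (b := fun j => φ j v) (Finset.mem_filter.1 h2).2.2] at h3
    omega

lemma card_fiber_le (φ : ℕ → G →+ ZMod 2) (d a : ℕ) :
    (Finset.univ.filter fun v => dhead d (fun j => φ j v) = a).card ≤ (headKer φ d).card := by
  rcases Finset.eq_empty_or_nonempty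
    (Finset.univ.filter fun v => dhead d (fun j => φ j v) = a) with h | ⟨w, hw⟩
  · rw [h]; simp
  · refine Finset.card_le_card_of_injOn (fun v => v - w) (fun v hv => ?_) fun v _ v' _ h => by
      simpa using h
    have h1 := (Finset.mem_filter.1 hv).2.trans (Finset.mem_filter.1 hw).2.symm
    rw [dhead_eq_iff] at h1
    simp only [headKer, Finset.coe_filter, Finset.mem_univ, true_and, Set.mem_ofPred_eq]
    intro j hj
    rw [map_sub, h1 j hj, sub_self]

/-- If a level has no tails of ones above zero, then it has none at all. -/
lemma not_forall_one_of_headOnes {d N : ℕ} (h : headOnes φ d = ∅) (hN : ∀ a < 2 ^ d,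
    (Finset.univ.filter fun v => ⌊dval (fun j => φ j v) * 2 ^ d⌋₊ = a).card = N) (v : G) :
    ¬ ∀ j, d ≤ j → φ j v = 1 := by
  intro hv
  have hex : ∃ a, ∃ v : G, (∀ j, d ≤ j → φ j v = 1) ∧ dhead d (fun j => φ j v) = a :=
    ⟨_, v, hv, rfl⟩
  obtain ⟨w, hw, hwa⟩ := Nat.find_spec hex
  set a := Nat.find hex with ha
  have hmin : ∀ a' < a, ¬ ∃ v : G, (∀ j, d ≤ j → φ j v = 1) ∧ dhead d (fun j => φ j v) = a' :=
    fun a' h' => Nat.find_min hex h'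
  have h0 := card_floor_zero_add φ d
  rw [h, Finset.card_empty, add_zero, hN 0 (by positivity)] at h0
  have hlt : (Finset.univ.filter fun v => ⌊dval (fun j => φ j v) * 2 ^ d⌋₊ = a).card <
      (Finset.univ.filter fun v => dhead d (fun j => φ j v) = a).card := by
    refine Finset.card_lt_card ((Finset.ssubset_iff_of_subset fun u hu => ?_).2 ⟨w, ?_, ?_⟩)
    · have h1 := (Finset.mem_filter.1 hu).2
      refine Finset.mem_filter.2 ⟨Finset.mem_univ _, ?_⟩
      by_cases h2 : ∀ j, d ≤ j → φ j u = 1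
      · rw [floor_dval_of_forall h2] at h1
        exact absurd ⟨u, h2, rfl⟩ (hmin (dhead d fun j => φ j u) (by omega))
      · rwa [floor_dval_of_exists (b := fun j => φ j u) (not_forall_one h2)] at h1
    · exact Finset.mem_filter.2 ⟨Finset.mem_univ _, hwa⟩
    · intro h1
      have h2 := (Finset.mem_filter.1 h1).2
      rw [floor_dval_of_forall hw] at h2
      omega
  have := card_fiber_le φ d a
  rw [hN a (hwa ▸ dhead_lt _ _)] at hlt
  omega

/-- Points of a digital net of positive strength have no digit expansion ending in ones. -/
lemma not_forall_one_of_card {k N : ℕ} (hN : ∀ a < 2 ^ (k + 1),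
    (Finset.univ.filter fun v => ⌊dval (fun j => φ j v) * 2 ^ (k + 1)⌋₊ = a).card = N) (v : G) :
    ¬ ∀ j, k ≤ j → φ j v = 1 := by
  have hN' : ∀ a < 2 ^ k,
      (Finset.univ.filter fun v => ⌊dval (fun j => φ j v) * 2 ^ k⌋₊ = a).card = 2 * N := by
    intro a ha
    have e : (Finset.univ.filter fun v => ⌊dval (fun j => φ j v) * 2 ^ k⌋₊ = a) =
        (Finset.univ.filter fun v => ⌊dval (fun j => φ j v) * 2 ^ (k + 1)⌋₊ = 2 * a) ∪
        (Finset.univ.filter fun v => ⌊dval (fun j => φ j v) * 2 ^ (k + 1)⌋₊ = 2 * a + 1) := by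
      ext v
      simp only [Finset.mem_union, Finset.mem_filter, Finset.mem_univ, true_and]
      rw [← floor_mul_pow_succ_div]
      omega
    rw [e, Finset.card_union_of_disjoint, hN _ (by rw [pow_succ]; omega),
      hN _ (by rw [pow_succ]; omega), two_mul]
    refine Finset.disjoint_left.2 fun v h1 h2 => ?_
    have h3 := (Finset.mem_filter.1 h1).2
    have h4 := (Finset.mem_filter.1 h2).2
    omega
  intro hv
  rcases Finset.eq_empty_or_nonempty (headOnes φ k) with h | ⟨p, hp⟩
  · exact not_forall_one_of_headOnes h hN' v hv
  rcases Finset.eq_empty_or_nonempty (headOnes φ (k + 1)) with h' | ⟨q, hq⟩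
  · exact not_forall_one_of_headOnes h' hN v fun j hj => hv j (by omega)
  have hp' := (Finset.mem_filter.1 hp).2
  have hq' := (Finset.mem_filter.1 hq).2
  have c1 := card_floor_zero_add φ k
  have c2 := card_floor_zero_add φ (k + 1)
  rw [hN' 0 (by positivity)] at c1
  rw [hN 0 (by positivity)] at c2
  have c3 : 2 * (headKer φ (k + 1)).card ≤ (headKer φ k).card := by
    have e : (headKer φ (k + 1)).card = ((headKer φ (k + 1)).image fun v => v + p).card :=
      (Finset.card_image_of_injective _ (add_left_injective p)).symm
    have hd : Disjoint (headKer φ (k + 1)) ((headKer φ (k + 1)).image fun v => v + p) := by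
      refine Finset.disjoint_left.2 fun u h1 h2 => ?_
      obtain ⟨u', h3, rfl⟩ := Finset.mem_image.1 h2
      have h4 := (Finset.mem_filter.1 h1).2 k (by omega)
      have h5 := (Finset.mem_filter.1 h3).2 k (by omega)
      rw [map_add, h5, hp'.2 k le_rfl] at h4
      simp at h4
    rw [two_mul]
    nth_rewrite 2 [e]
    rw [← Finset.card_union_of_disjoint hd]
    refine Finset.card_le_card fun u hu => Finset.mem_filter.2 ⟨Finset.mem_univ _, fun j hj => ?_⟩
    rcases Finset.mem_union.1 hu with h1 | h1
    · exact (Finset.mem_filter.1 h1).2 j (by omega)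
    · obtain ⟨u', h3, rfl⟩ := Finset.mem_image.1 h1
      rw [map_add, (Finset.mem_filter.1 h3).2 j (by omega), hp'.1 j hj, add_zero]
  have c4 : (headOnes φ k).card ≤ (headOnes φ (k + 1)).card := by
    refine Finset.card_le_card_of_injOn (fun u => u + (p + q)) (fun u hu => ?_) fun u _ u' _ h => by
      simpa using h
    have hu' := (Finset.mem_filter.1 hu).2
    refine Finset.mem_coe.2 (Finset.mem_filter.2 ⟨Finset.mem_univ _, fun j hj => ?_, fun j hj => ?_⟩)
    · rw [map_add, map_add, hq'.1 j hj]
      rcases Nat.lt_succ_iff_lt_or_eq.1 hj with h1 | rfl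
      · rw [hu'.1 j h1, hp'.1 j h1]; rfl
      · rw [hu'.2 j le_rfl, hp'.2 j le_rfl]; rfl
    · rw [map_add, map_add, hu'.2 j (by omega), hp'.2 j (by omega), hq'.2 j hj]; rfl
  have c5 : 0 < (headOnes φ (k + 1)).card := Finset.card_pos.2 ⟨q, hq⟩
  omega

end NoAnomaly

section Sequence

variable {s : ℕ} {C : Fin s → ℕ → ℕ → ZMod 2} {Tf : ℕ → ℕ}

/-- The binary digits of `n < 2 ^ m`. -/
def bitsV (m : ℕ) (n : Fin (2 ^ m)) : Fin m → ZMod 2 :=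
  fun r => if (n : ℕ).testBit r then 1 else 0

lemma bitsV_bijective (m : ℕ) : Function.Bijective (bitsV m) := by
  rw [Fintype.bijective_iff_injective_and_card]
  refine ⟨fun n n' h => Fin.ext (Nat.eq_of_testBit_eq fun r => ?_), by simp [ZMod.card]⟩
  by_cases hr : r < m
  · have h1 := congrFun h ⟨r, hr⟩
    simp only [bitsV] at h1
    cases h2 : (n : ℕ).testBit r <;> cases h3 : (n' : ℕ).testBit r <;> simp [h2, h3] at h1 ⊢
  · rw [Nat.testBit_lt_two_pow (n.2.trans_le (Nat.pow_le_pow_right two_pos (not_lt.1 hr))),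
      Nat.testBit_lt_two_pow (n'.2.trans_le (Nat.pow_le_pow_right two_pos (not_lt.1 hr)))]

/-- The `j`-th digit of coordinate `i` as a linear function of the binary digits of the index. -/
def digHom (C : Fin s → ℕ → ℕ → ZMod 2) (m : ℕ) (i : Fin s) (j : ℕ) :
    (Fin m → ZMod 2) →+ ZMod 2 where
  toFun v := ∑ r : Fin m, C i j r * v r
  map_zero' := by simp
  map_add' v w := by simp [mul_add, Finset.sum_add_distrib]

lemma seqDig_eq {m : ℕ} (n : Fin (2 ^ m)) (i : Fin s) (j : ℕ) :
    seqDig s C n i j = digHom C m i j (bitsV m n) := by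
  have h0 : ∀ r, (n : ℕ) < 2 ^ r → C i j r * (if (n : ℕ).testBit r then 1 else 0) = 0 :=
    fun r hr => by rw [Nat.testBit_lt_two_pow hr]; simp
  change _ = ∑ r : Fin m, C i j r * bitsV m n r
  unfold bitsV seqDig
  rw [Fin.sum_univ_eq_sum_range (fun r => C i j r * (if (n : ℕ).testBit r then 1 else 0)) m]
  rw [Finset.sum_subset (Finset.range_subset_range.2 (le_max_left ((n : ℕ) + 1) m)),
    Finset.sum_subset (Finset.range_subset_range.2 (le_max_right ((n : ℕ) + 1) m))]
  · intro r _ hr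
    rw [Finset.mem_range, not_lt] at hr
    exact h0 r (n.2.trans_le (Nat.pow_le_pow_right two_pos hr))
  · intro r _ hr
    rw [Finset.mem_range, not_lt] at hr
    exact h0 r ((Nat.lt_of_succ_le hr).trans Nat.lt_two_pow_self)

lemma seqPoint_eq {m : ℕ} (n : Fin (2 ^ m)) (i : Fin s) :
    seqPoint s C n i = dval fun j => digHom C m i j (bitsV m n) := by
  unfold seqPoint dval
  simp_rw [seqDig_eq]

/-- The first digits of the points of an initial segment of the sequence. -/
def netHom (C : Fin s → ℕ → ℕ → ZMod 2) (m : ℕ) : (Fin m → ZMod 2) →+ DArr s m where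
  toFun v i j := digHom C m i j v
  map_zero' := by ext; simp
  map_add' v w := by ext; simp

lemma netHom_apply {m : ℕ} (v : Fin m → ZMod 2) (i : Fin s) (j : Fin m) :
    netHom C m v i j = digHom C m i j v := rfl

lemma mem_box_iff {x : ℝ} (hx : 0 ≤ x) (a d : ℕ) :
    ((a : ℝ) / 2 ^ d ≤ x ∧ x < ((a : ℝ) + 1) / 2 ^ d) ↔ ⌊x * 2 ^ d⌋₊ = a := by
  rw [Nat.floor_eq_iff (by positivity), div_le_iff₀ (by positivity), lt_div_iff₀ (by positivity)]

lemma IsTSeq.card_floor (h : IsTSeq s Tf C) {m : ℕ} (hm : 1 ≤ m) {d a : Fin s → ℕ}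
    (ha : ∀ i, a i < 2 ^ d i) (hd : (∑ i, d i) + Tf m = m) :
    (Finset.univ.filter fun v : Fin m → ZMod 2 => ∀ i,
      ⌊dval (fun j => digHom C m i j v) * 2 ^ d i⌋₊ = a i).card = 2 ^ Tf m := by
  rw [← h.2 m hm 0 d a ha hd]
  symm
  refine Finset.card_equiv (Equiv.ofBijective _ (bitsV_bijective m)) fun n => ?_
  simp only [Finset.mem_filter, Finset.mem_univ, true_and, Equiv.ofBijective_apply, zero_mul,
    zero_add]
  refine forall_congr' fun i => ?_
  rw [seqPoint_eq, mem_box_iff (dval_nonneg _)]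

lemma IsTSeq.exists_digit_eq_zero (h : IsTSeq s Tf C)
    (hT : ∀ m, (Tf m : ℝ) ≤ Real.logb 2 m / 10) (n : ℕ) (i : Fin s) (M : ℕ) :
    ∃ j, M ≤ j ∧ seqDig s C n i j = 0 := by
  set m := max (n + 1) (2 * M + 4) with hm
  have hn : n < 2 ^ m := (Nat.lt_of_succ_le (le_max_left _ _)).trans Nat.lt_two_pow_self
  have hm1 : 2 * M + 4 ≤ m := le_max_right _ _
  have ht : 2 * Tf m ≤ m := by
    have h1 : Real.logb 2 m ≤ m := by
      have h3 : (0 : ℝ) < m := by exact_mod_cast (by omega : 0 < m)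
      rw [Real.logb_le_iff_le_rpow one_lt_two h3, Real.rpow_natCast]
      exact_mod_cast (Nat.lt_two_pow_self (n := m)).le
    have h2 := hT m
    have : (2 * Tf m : ℝ) ≤ m := by
      have := Nat.cast_nonneg (α := ℝ) m
      linarith
    exact_mod_cast this
  obtain ⟨k, hk⟩ : ∃ k, m - Tf m = k + 1 := ⟨m - Tf m - 1, by omega⟩
  set f : (Fin m → ZMod 2) → ℕ := fun v => ⌊dval (fun j => digHom C m i j v) * 2 ^ (k + 1)⌋₊
    with hf
  set S : Finset (Fin m → ZMod 2) := Finset.univ.filter fun v =>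
    (∀ i', i' ≠ i → ⌊dval (fun j => digHom C m i' j v)⌋₊ = 0) ∧ f v < 2 ^ (k + 1) with hS
  have hbox : ∀ a < 2 ^ (k + 1), (S.filter fun v => f v = a).card = 2 ^ Tf m := by
    intro a ha
    rw [← h.card_floor (m := m) (by omega) (d := fun i' => if i' = i then k + 1 else 0)
      (a := fun i' => if i' = i then a else 0)
      (fun i' => by by_cases hi : i' = i <;> simp [hi, ha]) (by simp; omega)]
    congr 1
    ext v
    simp only [hS, hf, Finset.mem_filter, Finset.mem_univ, true_and]
    constructor
    · rintro ⟨⟨h2, -⟩, h3⟩ i'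
      by_cases hi : i' = i
      · subst hi; simpa using h3
      · simpa [hi] using h2 i' hi
    · intro h2
      have h3 : ⌊dval (fun j => digHom C m i j v) * 2 ^ (k + 1)⌋₊ = a := by simpa using h2 i
      exact ⟨⟨fun i' hi => by simpa [hi] using h2 i', h3.trans_lt ha⟩, h3⟩
  have huniv : S = Finset.univ := by
    rw [← Finset.card_eq_iff_eq_univ, Finset.card_eq_sum_card_fiberwise (f := f)
      (t := Finset.range (2 ^ (k + 1)))
      (fun v hv => Finset.mem_coe.2 (Finset.mem_range.2 (Finset.mem_filter.1 hv).2.2)),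
      Finset.sum_congr rfl fun a ha => hbox a (Finset.mem_range.1 ha)]
    simp only [Finset.sum_const, Finset.card_range, smul_eq_mul, Fintype.card_fun, ZMod.card,
      Fintype.card_fin]
    rw [← pow_add]
    congr 1
    omega
  have hcard : ∀ a < 2 ^ (k + 1), (Finset.univ.filter fun v : Fin m → ZMod 2 =>
      ⌊dval (fun j => digHom C m i j v) * 2 ^ (k + 1)⌋₊ = a).card = 2 ^ Tf m := by
    rw [← huniv]
    exact hbox
  have h1 := not_forall_one_of_card (φ := fun j => digHom C m i j) hcard (bitsV m ⟨n, hn⟩)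
  obtain ⟨j, hj, hj'⟩ := not_forall_one (b := fun j => digHom C m i j (bitsV m ⟨n, hn⟩)) h1
  refine ⟨j, by omega, ?_⟩
  rw [← hj', ← seqDig_eq]

lemma IsTSeq.netD (h : IsTSeq s Tf C) (hT : ∀ m, (Tf m : ℝ) ≤ Real.logb 2 m / 10) {m : ℕ}
    (hm : 1 ≤ m) : NetD (netHom C m) (Tf m) := by
  intro d hd u
  rw [← h.card_floor hm (d := d) (a := fun i => dhead (d i) (extD (u i)))
    (fun i => dhead_lt _ _) hd]
  congr 1
  ext v
  simp only [Finset.mem_filter, Finset.mem_univ, true_and]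
  refine forall_congr' fun i => ?_
  have hdm : d i ≤ m := by
    have := Finset.single_le_sum (f := d) (fun i _ => Nat.zero_le _) (Finset.mem_univ i)
    omega
  obtain ⟨n, rfl⟩ := (bitsV_bijective m).2 v
  rw [floor_dval_of_exists (b := fun j => digHom C m i j (bitsV m n)), dhead_eq_iff]
  · constructor
    · intro h1 j hj
      exact (h1 ⟨j, by omega⟩ hj).trans (extD_coe (u i) ⟨j, by omega⟩).symm
    · intro h1 j hj
      exact (h1 j hj).trans (extD_coe (u i) j)
  · obtain ⟨j, hj, hj'⟩ := h.exists_digit_eq_zero hT n i (d i)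
    exact ⟨j, hj, by rw [← hj', ← seqDig_eq]⟩

/-- The digits of the points of the shifted net. -/
lemma IsTSeq.xorVec_spec (h : IsTSeq s Tf C) (hT : ∀ m, (Tf m : ℝ) ≤ Real.logb 2 m / 10)
    {m : ℕ} (n : Fin (2 ^ m)) (T : Fin s → Fin (2 ^ m)) (i : Fin s) :
    xorVec (seqPoint s C n) (Qpt m T) i ∈ Set.Ico (0 : ℝ) 1 ∧
      ∀ j : Fin m, digs (xorVec (seqPoint s C n) (Qpt m T) i) j =
        netHom C m (bitsV m n) i j + digs (Qpt m T i) j := by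
  have h1 : digs (seqPoint s C n i) = seqDig s C n i :=
    digs_dval (h.exists_digit_eq_zero hT n i)
  have h2 : ∀ d, ∃ j, d ≤ j ∧ (seqDig s C n i + digs (Qpt m T i)) j = 0 := by
    intro d
    obtain ⟨j, hj, hj'⟩ := h.exists_digit_eq_zero hT n i (max d m)
    refine ⟨j, (le_max_left _ _).trans hj, ?_⟩
    rw [Pi.add_apply, hj', Qpt, digs_natCast_div _ ((le_max_right _ _).trans hj), add_zero]
  rw [xorVec, xorReal_eq_dval, h1]
  refine ⟨dval_mem_Ico ((h2 0).imp fun j hj => hj.2), fun j => ?_⟩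
  rw [digs_dval h2, Pi.add_apply, seqDig_eq, netHom_apply]

end Sequence

section Approximation

variable {s m : ℕ}

/-- The sign `(-1)` for positive indices. -/
def sgnD (a : ℕ) : ℝ := if a = 0 then 1 else -1

/-- The digit-level indicator of `x < y`, in terms of `z = x + y` and `y`. -/
def indD (z y : Fin m → ZMod 2) : ℝ :=
  2⁻¹ * ∑ a ∈ Finset.range (m + 1), sgnD a * (if PiD a z then 1 else 0) * epsD a y

/-- The digit-level approximation of the length of `[0,y)`. -/
def lenD (y : Fin m → ZMod 2) : ℝ :=
  2⁻¹ * ∑ a ∈ Finset.range (m + 1), sgnD a * (2 ^ a)⁻¹ * epsD a y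

lemma epsD_index_zero (y : Fin m → ZMod 2) : epsD 0 y = 1 := by
  simp [epsD]

lemma prod_sgnD (A : Fin s → ℕ) : ∏ i, sgnD (A i) = (-1) ^ kapF A := by
  unfold sgnD kapF
  rw [← Finset.prod_const, Finset.prod_filter]
  refine Finset.prod_congr rfl fun i _ => ?_
  by_cases h : A i = 0 <;> simp [h]

lemma prod_two_inv_mul_sum (f : Fin s → ℕ → ℝ) :
    ∏ i, (2⁻¹ * ∑ a ∈ Finset.range (m + 1), f i a) =
      (2 ^ s)⁻¹ * ∑ A ∈ boxI s m, ∏ i, f i (A i) := by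
  rw [Finset.prod_mul_distrib, Finset.prod_const, Finset.card_univ, Fintype.card_fin, inv_pow,
    Finset.prod_univ_sum, boxI]

lemma discD_eq (x : (Fin m → ZMod 2) →+ DArr s m) (u y : DArr s m) :
    discD x (u, y) = (∑ v, ∏ i, indD ((x v + u) i) (y i)) - 2 ^ m * ∏ i, lenD (y i) := by
  unfold indD lenD
  simp_rw [prod_two_inv_mul_sum]
  rw [← Finset.mul_sum, Finset.sum_comm, mul_left_comm, ← mul_sub, Finset.mul_sum (boxI s m),
    ← Finset.sum_sub_distrib, discD, chaos, Finset.mul_sum]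
  refine Finset.sum_congr rfl fun A _ => ?_
  simp_rw [Finset.prod_mul_distrib, prod_sgnD]
  have h1 : cntD x A u = ∑ v, ∏ i, if PiD (A i) ((x v + u) i) then (1 : ℝ) else 0 := by
    unfold cntD
    rw [Finset.card_filter]
    push_cast
    refine Finset.sum_congr rfl fun v _ => ?_
    rw [Finset.prod_ite_zero]
    simp
  have h2 : ∏ i, ((2 : ℝ) ^ A i)⁻¹ = (2 ^ a0F A)⁻¹ := by
    rw [Finset.prod_inv_distrib, Finset.prod_pow_eq_pow_sum, a0F]
  rw [coefD, lamD, h1, h2, epsA, ← Finset.sum_mul, ← Finset.mul_sum]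
  ring

lemma PiD_succ_iff {z : Fin m → ZMod 2} {j₀ : Fin m} (h : ∀ j < j₀, z j = 0) (h₀ : z j₀ = 1)
    (a : ℕ) : PiD (a + 1) z ↔ a = j₀ := by
  constructor
  · rintro (h1 | ⟨h1, j, h2, h3⟩)
    · omega
    · rcases lt_trichotomy j j₀ with h4 | h4 | h4
      · rw [h j h4] at h3; exact absurd h3 (by decide)
      · subst h4; omega
      · have h5 : (j₀ : ℕ) < j := h4
        rw [h1 j₀ (by omega)] at h₀; exact absurd h₀ (by decide)
  · intro h1
    exact Or.inr ⟨fun j hj => h j (by rw [Fin.lt_def]; omega), j₀, by omega, h₀⟩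

lemma indD_of_first {z y : Fin m → ZMod 2} {j₀ : Fin m} (h : ∀ j < j₀, z j = 0) (h₀ : z j₀ = 1) :
    indD z y = if y j₀ = 1 then 1 else 0 := by
  rw [indD, Finset.sum_range_succ']
  have h1 : ∀ a ∈ Finset.range m, sgnD (a + 1) * (if PiD (a + 1) z then 1 else 0) *
      epsD (a + 1) y = if a = j₀ then -epsD (j₀ + 1 : ℕ) y else 0 := by
    intro a _
    rw [PiD_succ_iff h h₀]
    by_cases ha : a = j₀ <;> simp [ha, sgnD]
  rw [Finset.sum_congr rfl h1, Finset.sum_ite_eq', if_pos (Finset.mem_range.2 j₀.2),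
    epsD_of_eq rfl, epsD_index_zero, if_pos (show PiD 0 z from Or.inl rfl), sgnD, if_pos rfl]
  split_ifs <;> norm_num

lemma indD_zero (y : Fin m → ZMod 2) : indD 0 y = 2⁻¹ := by
  rw [indD, Finset.sum_range_succ', Finset.sum_eq_zero, epsD_index_zero, if_pos (show PiD 0 (0 : Fin m → ZMod 2) from Or.inl rfl), sgnD]
  · norm_num
  · intro a _
    rw [if_neg]
    · simp
    · rintro (h1 | ⟨-, j, -, h3⟩)
      · omega
      · exact absurd h3 (by simp)

lemma lenD_digs {y : Fin m → ZMod 2} {b : ℕ → ZMod 2} (h : ∀ j : Fin m, y j = b j) :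
    lenD y * 2 ^ m = dhead m b + 2⁻¹ := by
  have h1 : ∀ d, (1 - ∑ j ∈ Finset.range d, ((2 : ℝ) ^ (j + 1))⁻¹ * (1 - 2 * (b j).val)) * 2 ^ d =
      2 * dhead d b + 1 := by
    intro d
    induction d with
    | zero => simp [dhead]
    | succ d ih =>
      rw [Finset.sum_range_succ, ← sub_sub, sub_mul, pow_succ, ← mul_assoc, ih, dhead]
      push_cast
      field_simp
      ring
  have h2 : lenD y = 2⁻¹ *
      (1 - ∑ j ∈ Finset.range m, ((2 : ℝ) ^ (j + 1))⁻¹ * (1 - 2 * (b j).val)) := by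
    rw [lenD, Finset.sum_range_succ', epsD_index_zero, add_comm, sub_eq_add_neg, ← Finset.sum_neg_distrib]
    congr 2
    · simp [sgnD]
    · refine Finset.sum_congr rfl fun j hj => ?_
      rw [epsD_of_eq (j := ⟨j, Finset.mem_range.1 hj⟩) rfl, h]
      rcases zmod_two_cases (b j) with hb | hb <;> simp [hb, sgnD, val_one_two]
      ring
  rw [h2, mul_assoc, h1]
  ring

lemma abs_sub_lenD_le {Y : ℝ} (hY : Y ∈ Set.Ico (0 : ℝ) 1) {y : Fin m → ZMod 2}
    (h : ∀ j : Fin m, y j = digs Y j) : |Y - lenD y| ≤ (2 ^ m)⁻¹ := by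
  have h1 := lenD_digs h
  have hp : (0 : ℝ) < 2 ^ m := by positivity
  have h2 := Nat.floor_le (mul_nonneg hY.1 hp.le)
  have h3 := Nat.lt_floor_add_one (Y * 2 ^ m)
  rw [← dhead_digs hY] at h2 h3
  rw [← mul_le_mul_iff_left₀ hp, ← abs_of_pos hp, ← abs_mul, sub_mul, abs_of_pos hp, h1,
    inv_mul_cancel₀ hp.ne', abs_le]
  constructor <;> linarith

lemma abs_lenD_le (y : Fin m → ZMod 2) : |lenD y| ≤ 1 := by
  have h1 := lenD_digs (y := y) (b := extD y) fun j => (extD_coe y j).symm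
  have hp : (0 : ℝ) < 2 ^ m := by positivity
  have h2 : ((dhead m (extD y) : ℕ) : ℝ) + 1 ≤ 2 ^ m := by exact_mod_cast dhead_lt (extD y) m
  have h3 := Nat.cast_nonneg (α := ℝ) (dhead m (extD y))
  rw [← mul_le_mul_iff_left₀ hp, ← abs_of_pos hp, ← abs_mul, abs_of_pos hp, h1, one_mul, abs_le]
  constructor <;> linarith

lemma exists_first {z : Fin m → ZMod 2} (hz : z ≠ 0) :
    ∃ j₀, (∀ j < j₀, z j = 0) ∧ z j₀ = 1 := by
  obtain ⟨j, hj⟩ := Function.ne_iff.1 hz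
  have hne : (Finset.univ.filter fun j => z j ≠ 0).Nonempty := ⟨j, by simpa using hj⟩
  refine ⟨Finset.min' _ hne, fun k hk => ?_, ?_⟩
  · by_contra h
    exact absurd (Finset.min'_le _ k (by simpa using h)) (not_le.2 hk)
  · exact (zmod_two_cases _).resolve_left (Finset.mem_filter.1 (Finset.min'_mem _ hne)).2

lemma abs_indD_le (z y : Fin m → ZMod 2) : |indD z y| ≤ 1 := by
  by_cases hz : z = 0
  · rw [hz, indD_zero]; norm_num [abs_of_pos]
  · obtain ⟨j₀, h, h₀⟩ := exists_first hz
    rw [indD_of_first h h₀]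
    split_ifs <;> simp

lemma zmod_two_add_eq_zero {a b : ZMod 2} : a + b = 0 ↔ a = b := by
  revert a b; decide

lemma zmod_two_add_eq_one {a b : ZMod 2} (h : a + b = 1) : (a = 0 ∧ b = 1) ∨ (a = 1 ∧ b = 0) := by
  revert a b; decide

lemma abs_ite_lt_sub_indD_le {X Y : ℝ} (hX : X ∈ Set.Ico (0 : ℝ) 1) (hY : Y ∈ Set.Ico (0 : ℝ) 1)
    {z y : Fin m → ZMod 2} (hy : ∀ j : Fin m, y j = digs Y j)
    (hz : ∀ j : Fin m, z j = digs X j + digs Y j) :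
    |(if 0 ≤ X ∧ X < Y then 1 else 0) - indD z y| ≤ if z = 0 then 1 else 0 := by
  by_cases h0 : z = 0
  · rw [if_pos h0, h0, indD_zero]
    split_ifs <;> norm_num [abs_of_pos, abs_of_neg]
  rw [if_neg h0]
  obtain ⟨j₀, h, h₀⟩ := exists_first h0
  rw [indD_of_first h h₀, hy]
  have h1 : ∀ l < (j₀ : ℕ), digs X l = digs Y l := fun l hl => by
    have h2 := h ⟨l, hl.trans j₀.2⟩ hl
    rw [hz] at h2
    exact zmod_two_add_eq_zero.1 h2
  rw [hz] at h₀
  rcases zmod_two_add_eq_one h₀ with ⟨h2, h3⟩ | ⟨h2, h3⟩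
  · rw [if_pos ⟨hX.1, lt_of_digs hX hY h1 h2 h3⟩, if_pos h3]
    simp
  · have h4 := lt_of_digs hY hX (fun l hl => (h1 l hl).symm) h3 h2
    rw [if_neg (fun h5 => absurd h5.2 (not_lt.2 h4.le)), if_neg (by rw [h3]; decide)]
    simp

/-- The array of the first digits of a vector. -/
def digArr (m : ℕ) (Y : Fin s → ℝ) : DArr s m := fun i j => digs (Y i) j

lemma NetD.card_coord_le {x : (Fin m → ZMod 2) →+ DArr s m} {t : ℕ} (hx : NetD x t) (htm : t ≤ m)
    (i : Fin s) (u : DArr s m) :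
    (Finset.univ.filter fun v => (x v + u) i = 0).card ≤ 2 ^ t := by
  rw [← hx (fun i' => if i' = i then m - t else 0) (by simp; omega) u]
  refine Finset.card_le_card fun v hv => ?_
  have h1 := (Finset.mem_filter.1 hv).2
  refine Finset.mem_filter.2 ⟨Finset.mem_univ _, fun i' j hj => ?_⟩
  by_cases hi : i' = i
  · subst hi
    exact zmod_two_add_eq_zero.1 (congrFun h1 j)
  · simp [hi] at hj

variable {C : Fin s → ℕ → ℕ → ZMod 2} {Tf : ℕ → ℕ}

/-- The local discrepancy of the shifted net is close to its digit-level counterpart. -/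
lemma IsTSeq.abs_Dloc_sub_discD_le (h : IsTSeq s Tf C)
    (hT : ∀ m, (Tf m : ℝ) ≤ Real.logb 2 m / 10) (hm : 1 ≤ m) (T : Fin s → Fin (2 ^ m))
    {Y : Fin s → ℝ} (hY : ∀ i, Y i ∈ Set.Ico (0 : ℝ) 1) :
    |Dloc (fun n : Fin (2 ^ m) => xorVec (seqPoint s C n) (Qpt m T)) Y -
      discD (netHom C m) (digArr m (Qpt m T) + digArr m Y, digArr m Y)| ≤ 2 * s * 2 ^ Tf m := by
  have hx := h.netD hT hm
  have hspec := fun n => h.xorVec_spec (m := m) hT n T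
  rw [discD_eq, Dloc]
  have e1 : (∑ v, ∏ i, indD ((netHom C m v + (digArr m (Qpt m T) + digArr m Y)) i)
      (digArr m Y i)) = ∑ n : Fin (2 ^ m), ∏ i,
        indD ((netHom C m (bitsV m n) + (digArr m (Qpt m T) + digArr m Y)) i) (digArr m Y i) :=
    (Equiv.sum_comp (Equiv.ofBijective _ (bitsV_bijective m)) _).symm
  have e2 : ∀ n : Fin (2 ^ m), (if ∀ i, 0 ≤ xorVec (seqPoint s C n) (Qpt m T) i ∧
      xorVec (seqPoint s C n) (Qpt m T) i < Y i then (1 : ℝ) else 0) =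
      ∏ i, if 0 ≤ xorVec (seqPoint s C n) (Qpt m T) i ∧
        xorVec (seqPoint s C n) (Qpt m T) i < Y i then (1 : ℝ) else 0 := fun n => by
    rw [Finset.prod_ite_zero]; simp
  simp_rw [e1, e2]
  rw [sub_sub_sub_comm, ← Finset.sum_sub_distrib]
  refine (abs_sub _ _).trans ?_
  have h1 : |∑ n : Fin (2 ^ m), ((∏ i, if 0 ≤ xorVec (seqPoint s C n) (Qpt m T) i ∧
        xorVec (seqPoint s C n) (Qpt m T) i < Y i then (1 : ℝ) else 0) -
      ∏ i, indD ((netHom C m (bitsV m n) + (digArr m (Qpt m T) + digArr m Y)) i)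
        (digArr m Y i))| ≤ s * 2 ^ Tf m := by
    calc _ ≤ ∑ n : Fin (2 ^ m), ∑ i, if (netHom C m (bitsV m n) +
          (digArr m (Qpt m T) + digArr m Y)) i = 0 then (1 : ℝ) else 0 := by
          refine (Finset.abs_sum_le_sum_abs _ _).trans (Finset.sum_le_sum fun n _ => ?_)
          refine (abs_prod_sub_prod_le _ _ _ (fun i _ => ?_) fun i _ => abs_indD_le _ _).trans
            (Finset.sum_le_sum fun i _ => ?_)
          · split_ifs <;> simp
          · refine abs_ite_lt_sub_indD_le (hspec n i).1 (hY i) (fun j => rfl) fun j => ?_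
            rw [(hspec n i).2 j, add_assoc]
            rfl
      _ = ∑ i, ((Finset.univ.filter fun v => (netHom C m v +
          (digArr m (Qpt m T) + digArr m Y)) i = 0).card : ℝ) := by
          rw [Finset.sum_comm]
          refine Finset.sum_congr rfl fun i _ => ?_
          rw [Finset.card_filter, Nat.cast_sum]
          push_cast
          exact Equiv.sum_comp (Equiv.ofBijective _ (bitsV_bijective m)) fun v =>
            if (netHom C m v + (digArr m (Qpt m T) + digArr m Y)) i = 0 then (1 : ℝ) else 0
      _ ≤ ∑ i : Fin s, (2 : ℝ) ^ Tf m :=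
          Finset.sum_le_sum fun i _ => by exact_mod_cast hx.card_coord_le (h.1 m) i _
      _ = s * 2 ^ Tf m := by simp
  have h2 : |((2 ^ m : ℕ) : ℝ) * ∏ i, Y i - 2 ^ m * ∏ i, lenD (digArr m Y i)| ≤ s := by
    rw [Nat.cast_pow, Nat.cast_ofNat, ← mul_sub, abs_mul, abs_of_pos (by positivity)]
    calc _ ≤ (2 : ℝ) ^ m * ∑ i : Fin s, (2 ^ m)⁻¹ := by
          gcongr
          refine (abs_prod_sub_prod_le _ _ _ (fun i _ => ?_) fun i _ => abs_lenD_le _).trans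
            (Finset.sum_le_sum fun i _ => abs_sub_lenD_le (hY i) fun j => rfl)
          rw [abs_of_nonneg (hY i).1]
          exact (hY i).2.le
      _ = s := by
          rw [Finset.sum_const, Finset.card_univ, Fintype.card_fin, nsmul_eq_mul]
          field_simp
  have h3 : (1 : ℝ) ≤ 2 ^ Tf m := one_le_pow₀ one_le_two
  have h4 := Nat.cast_nonneg (α := ℝ) s
  nlinarith

end Approximation

section MeasureLayer

variable {s m : ℕ}

/-- The half-open unit cube `[0,1)^s`. -/
def icube (s : ℕ) : Set (Fin s → ℝ) := Set.univ.pi fun _ => Set.Ico (0 : ℝ) 1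

lemma mem_icube {Y : Fin s → ℝ} : Y ∈ icube s ↔ ∀ i, Y i ∈ Set.Ico (0 : ℝ) 1 := by
  simp [icube]

lemma measurableSet_icube (s : ℕ) : MeasurableSet (icube s) :=
  MeasurableSet.univ_pi fun _ => measurableSet_Ico

lemma volume_icube (s : ℕ) : volume (icube s) = 1 := by
  simp [icube, volume_pi_pi]

instance isProbabilityMeasure_icube (s : ℕ) :
    IsProbabilityMeasure ((volume : Measure (Fin s → ℝ)).restrict (icube s)) :=
  ⟨by rw [Measure.restrict_apply_univ, volume_icube]⟩

lemma restrict_cube_eq (s : ℕ) : (volume : Measure (Fin s → ℝ)).restrict (cube s) =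
    (volume : Measure (Fin s → ℝ)).restrict (icube s) := by
  have h := Measure.univ_pi_Ico_ae_eq_Icc (μ := fun _ : Fin s => (volume : Measure ℝ))
    (f := fun _ => 0) (g := fun _ => 1)
  rw [← Set.pi_univ_Icc] at h
  exact Measure.restrict_congr_set h.symm

/-- The dyadic cube of side `2^(-m)` with digit array `y`. -/
def dbox (y : DArr s m) : Set (Fin s → ℝ) :=
  Set.univ.pi fun i => Set.Ico ((dhead m (extD (y i)) : ℝ) / 2 ^ m)
    (((dhead m (extD (y i)) : ℝ) + 1) / 2 ^ m)

lemma measurableSet_dbox (y : DArr s m) : MeasurableSet (dbox y) :=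
  MeasurableSet.univ_pi fun _ => measurableSet_Ico

lemma dbox_subset (y : DArr s m) : dbox y ⊆ icube s := by
  refine Set.pi_mono fun i _ => Set.Ico_subset_Ico (by positivity) ?_
  rw [div_le_one (by positivity)]
  exact_mod_cast dhead_lt (extD (y i)) m

lemma mem_dbox_iff {Y : Fin s → ℝ} (hY : Y ∈ icube s) (y : DArr s m) :
    Y ∈ dbox y ↔ digArr m Y = y := by
  rw [mem_icube] at hY
  simp only [dbox, Set.mem_univ_pi, Set.mem_Ico, funext_iff]
  refine forall_congr' fun i => ?_
  rw [mem_box_iff (hY i).1, ← dhead_digs (hY i), dhead_eq_iff]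
  refine ⟨fun h j => ?_, fun h j hj => ?_⟩
  · rw [← extD_coe (y i) j]
    exact h j j.2
  · have := h ⟨j, hj⟩
    rw [← extD_coe (y i) ⟨j, hj⟩] at this
    exact this

lemma card_DArr (s m : ℕ) : Fintype.card (DArr s m) = 2 ^ (s * m) := by
  simp [DArr, ← pow_mul, mul_comm]

lemma volume_real_dbox (y : DArr s m) : volume.real (dbox y) = ((2 : ℝ) ^ (s * m))⁻¹ := by
  rw [Measure.real, dbox, volume_pi_pi]
  simp only [Real.volume_Ico, ← sub_div, add_sub_cancel_left, Finset.prod_const, Finset.card_univ,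
    Fintype.card_fin]
  rw [ENNReal.toReal_pow, ENNReal.toReal_ofReal (by positivity), one_div, inv_pow, ← pow_mul, mul_comm]

lemma comp_digArr_eq {E : Type*} [AddCommMonoid E] (f : DArr s m → E) {Y : Fin s → ℝ}
    (hY : Y ∈ icube s) :
    f (digArr m Y) = ∑ y, (dbox y).indicator (fun _ => f y) Y := by
  rw [Finset.sum_eq_single (digArr m Y)]
  · rw [Set.indicator_of_mem ((mem_dbox_iff hY _).2 rfl)]
  · exact fun y _ hy => Set.indicator_of_notMem (fun h => hy ((mem_dbox_iff hY y).1 h).symm) _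
  · simp

variable {𝕜 : Type*} [RCLike 𝕜]

lemma integrable_comp_digArr (f : DArr s m → 𝕜) :
    Integrable (fun Y => f (digArr m Y)) (volume.restrict (icube s)) := by
  have h : Integrable (fun Y => ∑ y, (dbox y).indicator (fun _ => f y) Y)
      ((volume : Measure (Fin s → ℝ)).restrict (icube s)) :=
    integrable_finsetSum _ fun y _ => (integrable_const _).indicator (measurableSet_dbox y)
  refine h.congr ?_
  filter_upwards [ae_restrict_mem (measurableSet_icube s)] with Y hY
  exact (comp_digArr_eq f hY).symm

lemma integral_comp_digArr (f : DArr s m → 𝕜) :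
    ∫ Y in icube s, f (digArr m Y) = 𝔼 y, f y := by
  rw [setIntegral_congr_fun (measurableSet_icube s) fun Y hY => comp_digArr_eq f hY,
    integral_finsetSum _ fun y _ => (integrable_const _).indicator (measurableSet_dbox y),
    Fintype.expect_eq_sum_div_card, card_DArr, Finset.sum_div]
  refine Finset.sum_congr rfl fun y _ => ?_
  rw [integral_indicator_const _ (measurableSet_dbox y), measureReal_restrict_apply
    (measurableSet_dbox y), Set.inter_eq_left.2 (dbox_subset y), volume_real_dbox,
    RCLike.real_smul_eq_coe_mul, div_eq_inv_mul]
  push_cast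
  rfl

lemma Qpt_mem_Ico (T : Fin s → Fin (2 ^ m)) (i : Fin s) : Qpt m T i ∈ Set.Ico (0 : ℝ) 1 := by
  refine ⟨by unfold Qpt; positivity, ?_⟩
  unfold Qpt
  rw [div_lt_one (by positivity)]
  exact_mod_cast (T i).2

lemma digArr_Qpt_bijective (s m : ℕ) :
    Function.Bijective fun T : Fin s → Fin (2 ^ m) => digArr m (Qpt m T) := by
  rw [Fintype.bijective_iff_injective_and_card]
  refine ⟨fun T U h => ?_, by rw [card_DArr]; simp [← pow_mul, mul_comm]⟩
  funext i
  have h1 : dhead m (digs (Qpt m T i)) = dhead m (digs (Qpt m U i)) :=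
    dhead_congr fun j hj => congrFun (congrFun h i) ⟨j, hj⟩
  rw [dhead_digs (Qpt_mem_Ico T i), dhead_digs (Qpt_mem_Ico U i)] at h1
  simp only [Qpt] at h1
  rw [div_mul_cancel₀ _ (by positivity), div_mul_cancel₀ _ (by positivity), Nat.floor_natCast,
    Nat.floor_natCast] at h1
  exact Fin.ext h1

/-- The pair of digit arrays attached to a shift `T` and a point `Y`. -/
def digPair (m : ℕ) (T : Fin s → Fin (2 ^ m)) (Y : Fin s → ℝ) : DArr s m × DArr s m :=
  (digArr m (Qpt m T) + digArr m Y, digArr m Y)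

lemma expect_integral_digPair (h : DArr s m × DArr s m → 𝕜) :
    (𝔼 T : Fin s → Fin (2 ^ m), ∫ Y in icube s, h (digPair m T Y)) = 𝔼 p, h p := by
  unfold digPair
  simp_rw [fun u : DArr s m => integral_comp_digArr fun y => h (u + y, y)]
  rw [Fintype.expect_bijective _ (digArr_Qpt_bijective s m) _
      (fun u : DArr s m => 𝔼 y, h (u + y, y)) fun T => rfl,
    Finset.expect_comm, expect_prod_type, Finset.expect_comm (f := fun a b => h (a, b))]
  exact Finset.expect_congr rfl fun y _ => expect_add_right (fun u => h (u, y)) y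

lemma integrable_comp_digPair (h : DArr s m × DArr s m → 𝕜) (T : Fin s → Fin (2 ^ m)) :
    Integrable (fun Y => h (digPair m T Y)) (volume.restrict (icube s)) :=
  integrable_comp_digArr fun y => h (digArr m (Qpt m T) + y, y)

lemma norm_expect_integral_sub_le {f : (Fin s → Fin (2 ^ m)) → (Fin s → ℝ) → 𝕜}
    (hf : ∀ T, AEStronglyMeasurable (f T) (volume.restrict (icube s)))
    (h : DArr s m × DArr s m → 𝕜) (g : DArr s m × DArr s m → ℝ)
    (hg : ∀ T, ∀ Y ∈ icube s, ‖f T Y - h (digPair m T Y)‖ ≤ g (digPair m T Y)) :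
    ‖(𝔼 T, ∫ Y in icube s, f T Y) - 𝔼 p, h p‖ ≤ 𝔼 p, g p := by
  have hi : ∀ T, Integrable (fun Y => f T Y - h (digPair m T Y)) (volume.restrict (icube s)) :=
    fun T => (integrable_comp_digPair g T).mono'
      ((hf T).sub (integrable_comp_digPair h T).aestronglyMeasurable)
      ((ae_restrict_mem (measurableSet_icube s)).mono fun Y hY => hg T Y hY)
  have hfi : ∀ T, Integrable (f T) (volume.restrict (icube s)) := fun T =>
    ((hi T).add (integrable_comp_digPair h T)).congr (ae_of_all _ fun Y => by simp)
  rw [← expect_integral_digPair h, ← expect_integral_digPair g, ← Finset.expect_sub_distrib]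
  refine (RCLike.norm_expect_le (K := ℝ)).trans (Finset.expect_le_expect fun T _ => ?_)
  rw [← integral_sub (hfi T) (integrable_comp_digPair h T)]
  refine norm_integral_le_of_norm_le (integrable_comp_digPair g T) ?_
  exact (ae_restrict_mem (measurableSet_icube s)).mono fun Y hY => hg T Y hY

lemma expect_shift_eq {E : Type*} [Field E] [CharZero E] (f : (Fin s → Fin (2 ^ m)) → E) :
    (𝔼 T, f T) = (2 : E) ^ (-(s * m : ℤ)) * ∑ T, f T := by
  rw [Fintype.expect_eq_sum_div_card, div_eq_inv_mul, zpow_neg]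
  congr 2
  have : ((s : ℤ) * m) = ((s * m : ℕ) : ℤ) := by push_cast; rfl
  rw [this, zpow_natCast]
  simp [← pow_mul, mul_comm]

lemma measurable_Dloc {N : ℕ} (P : Fin N → Fin s → ℝ) : Measurable (Dloc P) := by
  unfold Dloc
  refine Measurable.sub (Finset.measurable_fun_sum _ fun n _ => Measurable.ite ?_ measurable_const
    measurable_const) (by fun_prop)
  simp only [Set.ofPred_forall, Set.ofPred_and]
  refine MeasurableSet.iInter fun i => (MeasurableSet.const _).inter ?_
  exact measurableSet_lt measurable_const (measurable_pi_apply i)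

end MeasureLayer

section Limit

variable {s : ℕ} {Tf : ℕ → ℕ} {C : Fin s → ℕ → ℕ → ZMod 2} {m V : ℕ} {i₀ i₁ : Fin s}

/-- The local discrepancy of the shifted initial segment of the sequence. -/
def shiftDisc (C : Fin s → ℕ → ℕ → ZMod 2) (m : ℕ) (T : Fin s → Fin (2 ^ m))
    (Y : Fin s → ℝ) : ℝ :=
  Dloc (fun n : Fin (2 ^ m) => xorVec (seqPoint s C (n : ℕ)) (Qpt m T)) Y

lemma measurable_shiftDisc (T : Fin s → Fin (2 ^ m)) : Measurable (shiftDisc C m T) :=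
  measurable_Dloc _

/-- The quadratic mean of the discrepancy. -/
def rmsDisc (C : Fin s → ℕ → ℕ → ZMod 2) (m : ℕ) : ℝ :=
  Msp s m 2 fun n : Fin (2 ^ m) => seqPoint s C (n : ℕ)

/-- The constant in the lower bound for the variance. -/
def varConst (s : ℕ) : ℝ := (4 ^ (s + 1) * (2 * (s : ℝ)) ^ (s - 1))⁻¹

/-- A bound for the relative error of the variance. -/
def relErr (s : ℕ) (e : ℝ) : ℝ :=
  Real.sqrt e + (e + Real.sqrt e) * ((2 * s ^ 2 + 2) / varConst s)

/-- A bound for the error of the characteristic function. -/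
def charErr (s : ℕ) (θ e : ℝ) : ℝ :=
  |θ| * (s + 1) * Real.sqrt (2 * (2 * e / varConst s)) + 32 * θ ^ 4 * e / varConst s ^ 2 +
    θ ^ 2 / 2 * (4 * Real.sqrt e / varConst s + 2 * relErr s e)

lemma varConst_pos (hs : 2 ≤ s) : 0 < varConst s := by
  have : (0 : ℝ) < s := by exact_mod_cast (by omega : 0 < s)
  unfold varConst
  positivity

lemma relErr_nonneg (hs : 2 ≤ s) {e : ℝ} (he : 0 ≤ e) : 0 ≤ relErr s e := by
  have := varConst_pos hs
  unfold relErr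
  positivity

lemma tendsto_relErr (s : ℕ) : Tendsto (relErr s) (nhds 0) (nhds 0) := by
  have h : Continuous (relErr s) := by unfold relErr; fun_prop
  simpa [relErr] using h.tendsto 0

lemma tendsto_charErr (s : ℕ) (θ : ℝ) : Tendsto (charErr s θ) (nhds 0) (nhds 0) := by
  have h : Continuous (charErr s θ) := by unfold charErr relErr; fun_prop
  simpa [charErr, relErr] using h.tendsto 0

lemma rmsDisc_nonneg (C : Fin s → ℕ → ℕ → ZMod 2) (m : ℕ) : 0 ≤ rmsDisc C m := by
  refine Real.rpow_nonneg (mul_nonneg (by positivity) (Finset.sum_nonneg fun T _ => ?_)) _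
  exact integral_nonneg fun Y => by positivity

lemma rmsDisc_sq (C : Fin s → ℕ → ℕ → ZMod 2) (m : ℕ) : rmsDisc C m ^ 2 =
    𝔼 T : Fin s → Fin (2 ^ m), ∫ Y in icube s, shiftDisc C m T Y ^ 2 := by
  have h0 : 0 ≤ (2 : ℝ) ^ (-(s * m : ℤ)) * ∑ T : Fin s → Fin (2 ^ m),
      ∫ Y in icube s, shiftDisc C m T Y ^ 2 :=
    mul_nonneg (by positivity) (Finset.sum_nonneg fun T _ => integral_nonneg fun Y => by positivity)
  rw [expect_shift_eq, rmsDisc, Msp, restrict_cube_eq]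
  simp only [Real.rpow_two, sq_abs]
  rw [← Real.sqrt_eq_rpow]
  exact Real.sq_sqrt h0

lemma IsTSeq.expect_error_sq_le (h : IsTSeq s Tf C) (hT : ∀ m, (Tf m : ℝ) ≤ Real.logb 2 m / 10)
    (hm : 1 ≤ m) (hs : 2 ≤ s) (hV2 : 2 ≤ V) (hV : (m + 1) ^ 2 ≤ 2 ^ V) (hi : i₁ ≠ i₀) :
    (𝔼 p, (2 * s * 2 ^ Tf m + |discD (netHom C m) p - mainD (netHom C m) (Tf m) V i₀ p|) ^ 2) ≤
      (2 * s ^ 2 + 2) * (errD s m (Tf m) V * ((m : ℝ) + 1) ^ (s - 1)) := by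
  have h1 := (h.netD hT hm).expect_sub_mainD_sq_le hs (h.1 m) hV2 hV hi
  have h2 : (2 * (s : ℝ) * 2 ^ Tf m) ^ 2 ≤ s ^ 2 * (errD s m (Tf m) V * ((m : ℝ) + 1) ^ (s - 1)) := by
    have h3 := le_errD_aux (t := Tf m) hs hV2 (Nat.zero_le (s + 3)) (n := 2) (by norm_num)
    obtain ⟨k, rfl⟩ : ∃ k, s = k + 2 := ⟨s - 2, by omega⟩
    rw [show k + 2 - 1 = k + 1 by omega, errD_mul]
    have h4 : (1 : ℝ) ≤ ((m : ℝ) + 1) ^ k :=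
      one_le_pow₀ (le_add_of_nonneg_left (Nat.cast_nonneg m))
    have h5 := h3.trans (le_mul_of_one_le_right (by positivity) h4)
    calc (2 * ((k + 2 : ℕ) : ℝ) * 2 ^ Tf m) ^ 2 =
        ((k + 2 : ℕ) : ℝ) ^ 2 * (4 * ((2 ^ Tf m) ^ 2 * ((Tf m : ℝ) + V) ^ 0)) := by ring
      _ ≤ _ := mul_le_mul_of_nonneg_left h5 (by positivity)
  calc (𝔼 p, (2 * s * 2 ^ Tf m +
        |discD (netHom C m) p - mainD (netHom C m) (Tf m) V i₀ p|) ^ 2)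
      ≤ 𝔼 p, (2 * (2 * (s : ℝ) * 2 ^ Tf m) ^ 2 +
          2 * (discD (netHom C m) p - mainD (netHom C m) (Tf m) V i₀ p) ^ 2) := by
        refine Finset.expect_le_expect fun p _ => ?_
        rw [← sq_abs (discD _ p - _)]
        nlinarith [sq_nonneg (2 * (s : ℝ) * 2 ^ Tf m -
          |discD (netHom C m) p - mainD (netHom C m) (Tf m) V i₀ p|)]
    _ = 2 * (2 * (s : ℝ) * 2 ^ Tf m) ^ 2 +
          2 * 𝔼 p, (discD (netHom C m) p - mainD (netHom C m) (Tf m) V i₀ p) ^ 2 := by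
        rw [Finset.expect_add_distrib, Fintype.expect_const, Finset.mul_expect]
    _ ≤ _ := by linarith

lemma abs_shiftDisc_sub_mainD_le (h : IsTSeq s Tf C)
    (hT : ∀ m, (Tf m : ℝ) ≤ Real.logb 2 m / 10) (hm : 1 ≤ m) (T : Fin s → Fin (2 ^ m))
    {Y : Fin s → ℝ} (hY : Y ∈ icube s) :
    |shiftDisc C m T Y - mainD (netHom C m) (Tf m) V i₀ (digPair m T Y)| ≤
      2 * s * 2 ^ Tf m + |discD (netHom C m) (digPair m T Y) -
        mainD (netHom C m) (Tf m) V i₀ (digPair m T Y)| :=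
  (abs_sub_le _ (discD (netHom C m) (digPair m T Y)) _).trans
    (add_le_add_left (h.abs_Dloc_sub_discD_le hT hm T (mem_icube.1 hY)) _)

lemma abs_sq_sub_sq_le {a b r η : ℝ} (hη : 0 < η) (h : |a - b| ≤ r) :
    |a ^ 2 - b ^ 2| ≤ η * b ^ 2 + (1 + η⁻¹) * r ^ 2 := by
  have h1 : a ^ 2 - b ^ 2 = 2 * b * (a - b) + (a - b) ^ 2 := by ring
  have h2 : |2 * b * (a - b)| ≤ η * b ^ 2 + η⁻¹ * (a - b) ^ 2 := by
    have e : η * η⁻¹ = 1 := mul_inv_cancel₀ hη.ne'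
    have h3 := mul_nonneg hη.le (sq_nonneg (b + η⁻¹ * (a - b)))
    have h4 := mul_nonneg hη.le (sq_nonneg (b - η⁻¹ * (a - b)))
    rw [show η * (b + η⁻¹ * (a - b)) ^ 2 = η * b ^ 2 + η * η⁻¹ * (2 * b * (a - b)) +
      η * η⁻¹ * η⁻¹ * (a - b) ^ 2 by ring, e] at h3
    rw [show η * (b - η⁻¹ * (a - b)) ^ 2 = η * b ^ 2 - η * η⁻¹ * (2 * b * (a - b)) +
      η * η⁻¹ * η⁻¹ * (a - b) ^ 2 by ring, e] at h4
    rw [abs_le]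
    constructor <;> linarith
  have h3 : (a - b) ^ 2 ≤ r ^ 2 := by
    rw [← sq_abs]
    exact pow_le_pow_left₀ (abs_nonneg _) h 2
  rw [h1]
  refine (abs_add_le _ _).trans ?_
  rw [abs_of_nonneg (sq_nonneg (a - b))]
  have := mul_le_mul_of_nonneg_left h3 (inv_nonneg.2 hη.le)
  linarith

lemma errD_pos (hs : 2 ≤ s) (hV2 : 2 ≤ V) (t : ℕ) : 0 < errD s m t V := by
  have : (0 : ℝ) < s := by exact_mod_cast (by omega : 0 < s)
  have : (0 : ℝ) < V := by exact_mod_cast (by omega : 0 < V)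
  unfold errD
  positivity

lemma abs_rmsDisc_sq_sub_le (h : IsTSeq s Tf C) (hT : ∀ m, (Tf m : ℝ) ≤ Real.logb 2 m / 10)
    (hm : s ≤ m) (hs : 2 ≤ s) (hV2 : 2 ≤ V) (hV : (m + 1) ^ 2 ≤ 2 ^ V) (hi : i₁ ≠ i₀) :
    |rmsDisc C m ^ 2 - varD (netHom C m) (Tf m) V i₀| ≤
      relErr s (errD s m (Tf m) V) * varD (netHom C m) (Tf m) V i₀ := by
  set e := errD s m (Tf m) V with he
  set σ := varD (netHom C m) (Tf m) V i₀ with hσ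
  have hm1 : 1 ≤ m := by omega
  have hep : 0 < e := errD_pos hs hV2 _
  have hη : 0 < Real.sqrt e := Real.sqrt_pos.2 hep
  have hc := varConst_pos hs
  have hvar : varConst s * ((m : ℝ) + 1) ^ (s - 1) ≤ σ := varD_ge hs hm hV2
  have h1 := norm_expect_integral_sub_le (𝕜 := ℝ) (f := fun T Y => shiftDisc C m T Y ^ 2)
    (fun T => ((measurable_shiftDisc T).pow_const 2).aestronglyMeasurable)
    (fun p => mainD (netHom C m) (Tf m) V i₀ p ^ 2)
    (fun p => Real.sqrt e * mainD (netHom C m) (Tf m) V i₀ p ^ 2 + (1 + (Real.sqrt e)⁻¹) *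
      (2 * s * 2 ^ Tf m + |discD (netHom C m) p - mainD (netHom C m) (Tf m) V i₀ p|) ^ 2)
    (fun T Y hY => abs_sq_sub_sq_le hη (abs_shiftDisc_sub_mainD_le h hT hm1 T hY))
  rw [← rmsDisc_sq, expect_mainD_sq, Finset.expect_add_distrib, ← Finset.mul_expect,
    ← Finset.mul_expect, expect_mainD_sq, Real.norm_eq_abs] at h1
  refine h1.trans ?_
  have h2 := h.expect_error_sq_le hT hm1 hs hV2 hV hi
  have h3 : (1 + (Real.sqrt e)⁻¹) * e = e + Real.sqrt e := by
    rw [add_mul, one_mul]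
    nth_rw 3 [← Real.mul_self_sqrt hep.le]
    rw [inv_mul_cancel_left₀ hη.ne']
  have h4 : ((m : ℝ) + 1) ^ (s - 1) ≤ σ / varConst s := by
    rw [le_div_iff₀ hc, mul_comm]
    exact hvar
  calc Real.sqrt e * σ + (1 + (Real.sqrt e)⁻¹) * _
      ≤ Real.sqrt e * σ + (1 + (Real.sqrt e)⁻¹) *
        ((2 * s ^ 2 + 2) * (e * ((m : ℝ) + 1) ^ (s - 1))) := by gcongr
    _ = Real.sqrt e * σ + (e + Real.sqrt e) * (2 * s ^ 2 + 2) * ((m : ℝ) + 1) ^ (s - 1) := by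
        rw [← h3]; ring
    _ ≤ Real.sqrt e * σ + (e + Real.sqrt e) * (2 * s ^ 2 + 2) * (σ / varConst s) := by gcongr
    _ = _ := by unfold relErr; ring

lemma norm_exp_mul_I_sub_le (a b : ℝ) :
    ‖Complex.exp ((a : ℂ) * Complex.I) - Complex.exp ((b : ℂ) * Complex.I)‖ ≤ |a - b| := by
  have h : Complex.exp ((a : ℂ) * Complex.I) - Complex.exp ((b : ℂ) * Complex.I) =
      Complex.exp ((b : ℂ) * Complex.I) *
        (Complex.exp (Complex.I * ((a - b : ℝ) : ℂ)) - 1) := by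
    rw [mul_sub, ← Complex.exp_add, mul_one]
    congr 2
    push_cast
    ring
  rw [h, norm_mul, Complex.norm_exp_ofReal_mul_I, one_mul]
  exact Real.norm_exp_I_mul_ofReal_sub_one_le

lemma norm_expect_exp_sub_le (h : IsTSeq s Tf C) (hT : ∀ m, (Tf m : ℝ) ≤ Real.logb 2 m / 10)
    (hm : s ≤ m) (hs : 2 ≤ s) (hV2 : 2 ≤ V) (hV : (m + 1) ^ 2 ≤ 2 ^ V) (hi : i₁ ≠ i₀)
    (hr : relErr s (errD s m (Tf m) V) ≤ 1 / 2) (θ : ℝ) :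
    ‖(𝔼 T : Fin s → Fin (2 ^ m), ∫ Y in icube s,
        Complex.exp (((θ / rmsDisc C m * shiftDisc C m T Y : ℝ) : ℂ) * Complex.I)) -
      Complex.exp (-((θ : ℂ) ^ 2 / 2))‖ ≤ charErr s θ (errD s m (Tf m) V) := by
  have hm1 : 1 ≤ m := by omega
  have hx := h.netD hT hm1
  have hbd := abs_rmsDisc_sq_sub_le h hT hm hs hV2 hV hi
  have hsq := h.expect_error_sq_le hT hm1 hs hV2 hV hi
  have hvar : varConst s * ((m : ℝ) + 1) ^ (s - 1) ≤ varD (netHom C m) (Tf m) V i₀ :=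
    varD_ge hs hm hV2
  have hep : 0 ≤ errD s m (Tf m) V := errD_nonneg _ _ _ _
  have hc := varConst_pos hs
  have hQ : (0 : ℝ) < ((m : ℝ) + 1) ^ (s - 1) := by positivity
  have hcQ := mul_pos hc hQ
  have hMain := fun (M : ℝ) (hM : 0 < M) => hx.charFun_mainD hs (h.1 m) hV2 hi hM θ
  set e := errD s m (Tf m) V
  set σ := varD (netHom C m) (Tf m) V i₀
  set M := rmsDisc C m
  set Q := ((m : ℝ) + 1) ^ (s - 1)
  have hρ := relErr_nonneg hs hep
  have hσ : 0 < σ := hcQ.trans_le hvar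
  have hM2 : σ ≤ 2 * M ^ 2 := by
    have := (abs_le.1 hbd).1
    nlinarith
  have hM : 0 < M := by
    refine lt_of_le_of_ne (rmsDisc_nonneg C m) fun h0 => ?_
    have : M = 0 := h0.symm
    rw [this] at hM2
    linarith
  have hQM : Q / M ^ 2 ≤ 2 / varConst s := by
    rw [div_le_div_iff₀ (by positivity) hc]
    linarith
  have h1 := norm_expect_integral_sub_le (𝕜 := ℂ) (f := fun T Y =>
      Complex.exp (((θ / M * shiftDisc C m T Y : ℝ) : ℂ) * Complex.I))
    (fun T => by
      have := measurable_shiftDisc (C := C) T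
      exact (by fun_prop : Measurable _).aestronglyMeasurable)
    (fun p => Complex.exp (((θ / M * mainD (netHom C m) (Tf m) V i₀ p : ℝ) : ℂ) * Complex.I))
    (fun p => |θ| / M *
      |(2 * s * 2 ^ Tf m + |discD (netHom C m) p - mainD (netHom C m) (Tf m) V i₀ p|)|)
    (fun T Y hY => by
      refine (norm_exp_mul_I_sub_le _ _).trans ?_
      rw [← mul_sub, abs_mul, abs_div, abs_of_pos hM]
      exact mul_le_mul_of_nonneg_left
        ((abs_shiftDisc_sub_mainD_le h hT hm1 T hY).trans (le_abs_self _)) (by positivity))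
  have h2 : (𝔼 p, |θ| / M * |(2 * s * 2 ^ Tf m +
      |discD (netHom C m) p - mainD (netHom C m) (Tf m) V i₀ p|)|) ≤
      |θ| * (s + 1) * Real.sqrt (2 * (2 * e / varConst s)) := by
    rw [← Finset.mul_expect]
    have h3 := (expect_abs_le_sqrt _).trans (Real.sqrt_le_sqrt hsq)
    have h4 : Real.sqrt ((2 * s ^ 2 + 2) * (e * Q)) / M ≤
        (s + 1) * Real.sqrt (2 * (2 * e / varConst s)) := by
      rw [← Real.sqrt_sq hM.le, ← Real.sqrt_div' _ (sq_nonneg M),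
        ← Real.sqrt_sq (by positivity : (0 : ℝ) ≤ s + 1), ← Real.sqrt_mul (by positivity)]
      refine Real.sqrt_le_sqrt ?_
      have h5 : (2 * (s : ℝ) ^ 2 + 2) ≤ 2 * (s + 1) ^ 2 := by
        have := Nat.cast_nonneg (α := ℝ) s
        nlinarith
      calc (2 * (s : ℝ) ^ 2 + 2) * (e * Q) / M ^ 2 = (2 * (s : ℝ) ^ 2 + 2) * (e * (Q / M ^ 2)) := by
            ring
        _ ≤ (2 * (s + 1) ^ 2) * (e * (2 / varConst s)) := by gcongr
        _ = _ := by ring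
    calc |θ| / M * _ ≤ |θ| / M * Real.sqrt ((2 * s ^ 2 + 2) * (e * Q)) := by gcongr
      _ = |θ| * (Real.sqrt ((2 * s ^ 2 + 2) * (e * Q)) / M) := by ring
      _ ≤ |θ| * ((s + 1) * Real.sqrt (2 * (2 * e / varConst s))) := by gcongr
      _ = _ := by ring
  have h3 : 8 * θ ^ 4 * (e * Q ^ 2) / M ^ 4 ≤ 32 * θ ^ 4 * e / varConst s ^ 2 := by
    calc 8 * θ ^ 4 * (e * Q ^ 2) / M ^ 4 = 8 * θ ^ 4 * e * (Q / M ^ 2) ^ 2 := by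
          field_simp
      _ ≤ 8 * θ ^ 4 * e * (2 / varConst s) ^ 2 := by
          have : 0 ≤ θ ^ 4 := by positivity
          gcongr
      _ = _ := by ring
  have h4 : (2 * (Real.sqrt e * Q) + |σ - M ^ 2|) / M ^ 2 ≤
      4 * Real.sqrt e / varConst s + 2 * relErr s e := by
    have h5 : |σ - M ^ 2| / M ^ 2 ≤ 2 * relErr s e := by
      rw [div_le_iff₀ (by positivity), abs_sub_comm]
      refine hbd.trans ?_
      calc relErr s e * σ ≤ relErr s e * (2 * M ^ 2) := by gcongr
        _ = _ := by ring
    rw [add_div]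
    refine add_le_add ?_ h5
    calc 2 * (Real.sqrt e * Q) / M ^ 2 = 2 * Real.sqrt e * (Q / M ^ 2) := by ring
      _ ≤ 2 * Real.sqrt e * (2 / varConst s) := by gcongr
      _ = _ := by ring
  refine (norm_sub_le_norm_sub_add_norm_sub _ _ _).trans
    ((add_le_add (h1.trans h2) ((hMain M hM).trans (add_le_add h3
      (mul_le_mul_of_nonneg_left h4 (by positivity))))).trans_eq ?_)
  unfold charErr
  ring

/-- The number of slices used at resolution `m`. -/
def cutoff (m : ℕ) : ℕ := 2 * Nat.log 2 m + 2

lemma le_two_pow_cutoff (m : ℕ) : (m + 1) ^ 2 ≤ 2 ^ cutoff m := by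
  rw [show cutoff m = (Nat.log 2 m + 1) * 2 by unfold cutoff; ring, pow_mul]
  exact Nat.pow_le_pow_left (Nat.lt_pow_succ_log_self one_lt_two m) 2

lemma tendsto_errD (s : ℕ) (hT : ∀ m, (Tf m : ℝ) ≤ Real.logb 2 m / 10) :
    Tendsto (fun m : ℕ => errD s m (Tf m) (cutoff m)) atTop (nhds 0) := by
  have h1 : Tendsto (fun m : ℕ => (10 / Real.log 2) ^ (s + 3) * (3 ^ s * s) *
      (Real.log m ^ ((s + 3 : ℕ) : ℝ) / (m : ℝ) ^ (3 / 5 : ℝ))) atTop (nhds 0) := by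
    rw [← mul_zero ((10 / Real.log 2) ^ (s + 3) * (3 ^ s * (s : ℝ)))]
    exact (((isLittleO_log_rpow_rpow_atTop _ (by norm_num)).tendsto_div_nhds_zero).comp
      tendsto_natCast_atTop_atTop).const_mul _
  refine squeeze_zero' (Eventually.of_forall fun m => errD_nonneg _ _ _ _) ?_ h1
  filter_upwards [eventually_ge_atTop 2] with m hm
  have hm0 : (0 : ℝ) < m := by exact_mod_cast (by omega : 0 < m)
  have hm2 : (2 : ℝ) ≤ m := by exact_mod_cast hm
  have hL : 1 ≤ Real.logb 2 m := by
    rw [Real.le_logb_iff_rpow_le one_lt_two hm0, Real.rpow_one]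
    exact hm2
  have h2 : ((2 : ℝ) ^ Tf m) ^ 4 ≤ (m : ℝ) ^ (2 / 5 : ℝ) := by
    calc ((2 : ℝ) ^ Tf m) ^ 4 = (2 : ℝ) ^ ((Tf m : ℝ) * 4) := by
          rw [Real.rpow_mul (by norm_num), Real.rpow_natCast]
          norm_num
      _ ≤ (2 : ℝ) ^ (Real.logb 2 m * (2 / 5)) := by
          refine Real.rpow_le_rpow_of_exponent_le one_le_two ?_
          have := hT m
          linarith
      _ = _ := by rw [Real.rpow_mul (by norm_num), Real.rpow_logb (by norm_num) (by norm_num) hm0]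
  have h3 : 2 * ((Tf m : ℝ) + cutoff m) ≤ 10 * Real.logb 2 m := by
    have h4 := Real.natLog_le_logb m 2
    have h5 := hT m
    unfold cutoff
    push_cast at h4 ⊢
    linarith
  have h6 : (m : ℝ) ^ (2 / 5 : ℝ) / m = ((m : ℝ) ^ (3 / 5 : ℝ))⁻¹ := by
    rw [← Real.rpow_neg hm0.le]
    nth_rw 2 [← Real.rpow_one (m : ℝ)]
    rw [← Real.rpow_sub hm0]
    norm_num
  calc errD s m (Tf m) (cutoff m)
      ≤ (m : ℝ) ^ (2 / 5 : ℝ) * (10 * Real.logb 2 m) ^ (s + 3) * (3 ^ s * s) / m := by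
        unfold errD
        gcongr
        linarith
    _ = ((m : ℝ) ^ (2 / 5 : ℝ) / m) * ((10 * Real.logb 2 m) ^ (s + 3) * (3 ^ s * s)) := by ring
    _ = _ := by
        rw [h6, Real.logb, ← mul_div_assoc, mul_div_right_comm, mul_pow, Real.rpow_natCast]
        ring

/-- The law of the normalised discrepancy under a random shift and a random box. -/
def lawDisc (C : Fin s → ℕ → ℕ → ZMod 2) (m : ℕ) : Measure ℝ :=
  ∑ T : Fin s → Fin (2 ^ m), ((2 : ENNReal) ^ (s * m))⁻¹ •
    (volume.restrict (icube s)).map fun Y => shiftDisc C m T Y / rmsDisc C m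

lemma measurable_normalised (T : Fin s → Fin (2 ^ m)) :
    Measurable fun Y => shiftDisc C m T Y / rmsDisc C m :=
  (measurable_shiftDisc T).div_const _

instance isProbabilityMeasure_lawDisc (C : Fin s → ℕ → ℕ → ZMod 2) (m : ℕ) :
    IsProbabilityMeasure (lawDisc C m) := by
  constructor
  have h : ∀ T : Fin s → Fin (2 ^ m), ((volume.restrict (icube s)).map fun Y =>
      shiftDisc C m T Y / rmsDisc C m) Set.univ = 1 := fun T => by
    rw [Measure.map_apply (measurable_normalised T) MeasurableSet.univ, Set.preimage_univ,
      measure_univ]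
  simp only [lawDisc, Measure.coe_finsetSum, Finset.sum_apply, Measure.smul_apply, h, smul_eq_mul,
    mul_one, Finset.sum_const, Finset.card_univ, nsmul_eq_mul]
  rw [Fintype.card_fun, Fintype.card_fin, Fintype.card_fin, ← pow_mul, mul_comm m s]
  push_cast
  exact ENNReal.mul_inv_cancel (by simp) (by simp)

lemma charFun_lawDisc (C : Fin s → ℕ → ℕ → ZMod 2) (m : ℕ) (θ : ℝ) :
    charFun (lawDisc C m) θ = 𝔼 T : Fin s → Fin (2 ^ m), ∫ Y in icube s,
      Complex.exp (((θ / rmsDisc C m * shiftDisc C m T Y : ℝ) : ℂ) * Complex.I) := by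
  have hmeas : Measurable fun x : ℝ => Complex.exp ((θ : ℂ) * x * Complex.I) := by fun_prop
  have hInt : ∀ T : Fin s → Fin (2 ^ m), Integrable
      (fun x : ℝ => Complex.exp ((θ : ℂ) * x * Complex.I))
      (((2 : ENNReal) ^ (s * m))⁻¹ • (volume.restrict (icube s)).map fun Y =>
        shiftDisc C m T Y / rmsDisc C m) := fun T => by
    have := Measure.isProbabilityMeasure_map (μ := volume.restrict (icube s))
      (measurable_normalised (C := C) T).aemeasurable
    refine Integrable.smul_measure ?_ (by simp)
    refine Integrable.of_bound hmeas.aestronglyMeasurable 1 (ae_of_all _ fun x => ?_)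
    rw [← Complex.ofReal_mul, Complex.norm_exp_ofReal_mul_I]
  rw [charFun_apply_real, lawDisc, integral_finsetSum_measure fun T _ => hInt T, expect_shift_eq,
    Finset.mul_sum]
  refine Finset.sum_congr rfl fun T _ => ?_
  rw [integral_smul_measure, integral_map (measurable_normalised T).aemeasurable
    hmeas.aestronglyMeasurable, Complex.real_smul]
  congr 1
  · rw [zpow_neg, show ((s : ℤ) * m) = ((s * m : ℕ) : ℤ) by push_cast; rfl, zpow_natCast]
    simp
  · refine integral_congr_ae (ae_of_all _ fun Y => ?_)
    simp only
    congr 2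
    push_cast
    ring

lemma toReal_lawDisc_Iio (C : Fin s → ℕ → ℕ → ZMod 2) (m : ℕ) (w : ℝ) :
    (lawDisc C m (Set.Iio w)).toReal = (2 : ℝ) ^ (-(s * m : ℤ)) * ∑ T : Fin s → Fin (2 ^ m),
      (volume {Y : Fin s → ℝ | (∀ i, Y i ∈ Set.Ico (0 : ℝ) 1) ∧
        shiftDisc C m T Y / rmsDisc C m < w}).toReal := by
  simp only [lawDisc, Measure.coe_finsetSum, Finset.sum_apply, Measure.smul_apply, smul_eq_mul]
  rw [ENNReal.toReal_sum fun T _ => ENNReal.mul_ne_top (by simp) (measure_ne_top _ _),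
    Finset.mul_sum]
  refine Finset.sum_congr rfl fun T _ => ?_
  rw [ENNReal.toReal_mul, Measure.map_apply (measurable_normalised T) measurableSet_Iio,
    Measure.restrict_apply (measurable_normalised T measurableSet_Iio), Set.inter_comm]
  congr 1
  · rw [zpow_neg, show ((s : ℤ) * m) = ((s * m : ℕ) : ℤ) by push_cast; rfl, zpow_natCast]
    simp
  · congr 2
    ext Y
    simp [mem_icube]

lemma tendsto_charFun_lawDisc (h : IsTSeq s Tf C)
    (hT : ∀ m, (Tf m : ℝ) ≤ Real.logb 2 m / 10) (hs : 2 ≤ s) (θ : ℝ) :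
    Tendsto (fun m => charFun (lawDisc C m) θ) atTop
      (nhds (Complex.exp (-((θ : ℂ) ^ 2 / 2)))) := by
  have he := tendsto_errD s hT
  have hB := (tendsto_charErr s θ).comp he
  have hr := ((tendsto_relErr s).comp he).eventually_le_const (by norm_num : (0 : ℝ) < 1 / 2)
  refine tendsto_iff_norm_sub_tendsto_zero.2 (squeeze_zero'
    (Eventually.of_forall fun m => norm_nonneg _) ?_ hB)
  filter_upwards [hr, eventually_ge_atTop s] with m hrm hm
  have hi : (⟨1, by omega⟩ : Fin s) ≠ ⟨0, by omega⟩ := by simp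
  rw [charFun_lawDisc]
  exact norm_expect_exp_sub_le h hT hm hs (Nat.le_add_left 2 _) (le_two_pow_cutoff m) hi hrm θ

end Limit

/-- Corollary 1, first part: CLT for the initial segments
`Ṗ_m = (X_n)_{n=0}^{2^m-1}` of a digital `(T,s)`-sequence with
`T(m) ≤ (1/10) log₂ m`. -/
theorem statement2 (s : ℕ) (hs : 2 ≤ s) (Tf : ℕ → ℕ) (C : Fin s → ℕ → ℕ → ZMod 2)
    (hseq : IsTSeq s Tf C) (hT : ∀ m, (Tf m : ℝ) ≤ Real.logb 2 m / 10) (w : ℝ) :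
    Tendsto (fun m : ℕ =>
        (2 : ℝ) ^ (-(s * m : ℤ)) * ∑ T : Fin s → Fin (2 ^ m),
          (volume {Y : Fin s → ℝ | (∀ i, Y i ∈ Set.Ico (0 : ℝ) 1) ∧
              Dloc (fun n : Fin (2 ^ m) => xorVec (seqPoint s C (n : ℕ)) (Qpt m T)) Y /
                  Msp s m 2 (fun n : Fin (2 ^ m) => seqPoint s C (n : ℕ)) < w}).toReal)
      atTop (nhds (PhiCDF w)) := by
  refine (tendsto_Iio_of_charFun (μ := fun m => ⟨lawDisc C m, inferInstance⟩)
    (tendsto_charFun_lawDisc hseq hT hs) w).congr fun m => ?_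
  exact toReal_lawDisc_Iio C m w
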